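/- Let n ∈ ℕ and let C_nuc_n be the class of separable unital C*-algebras D with nuclear dimension dim_nuc(D) ≤ n. If A is a separable unital C*-algebra which is a unital local C_nuc_n-algebra, then dim_nuc(A) ≤ n. -/

import Mathlib

noncomputable section
set_option linter.unusedSectionVars false

open scoped ComplexOrder Matrix.Norms.L2Operator
open Filter Topology

/-- An element of a `*`-ring is *positive* (in the C*-algebraic sense) if it has the
form `star y * y`. -/
def IsPosElem {R : Type*} [Mul R] [Star R] (a : R) : Prop :=
  ∃ y : R, a = star y * y

/-- A linear functional on a unital complex `*`-algebra is a *tracial state* if it is unital,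
positive and tracial. -/
def IsTracialState {R : Type*} [Ring R] [StarRing R] [Module ℂ R] (τ : R →ₗ[ℂ] ℂ) : Prop :=
  τ 1 = 1 ∧ (∀ x : R, 0 ≤ τ (star x * x)) ∧ ∀ a b : R, τ (a * b) = τ (b * a)

/-- A linear map between complex `*`-algebras is *completely positive* if all of its matrix
amplifications map positive elements to positive elements. -/
def IsCompletelyPositive {A B : Type*} [Ring A] [StarRing A] [Module ℂ A]
    [Ring B] [StarRing B] [Module ℂ B] (φ : A →ₗ[ℂ] B) : Prop :=
  ∀ (k : ℕ) (x : Matrix (Fin k) (Fin k) A), IsPosElem x → IsPosElem (x.map φ)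

/-- A map has *order zero* on a subset if it preserves orthogonality there. -/
def OrderZeroOn {F D : Type*} [Mul F] [Zero F] [Mul D] [Zero D] (φ : F → D) (s : Set F) : Prop :=
  ∀ e ∈ s, ∀ f ∈ s, e * f = 0 → f * e = 0 → φ e * φ f = 0 ∧ φ f * φ e = 0

/-- The finite-dimensional C*-algebra `⊕_{i=1}^s M_{r i}(ℂ)`. -/
abbrev FDBlock (s : ℕ) (r : Fin s → ℕ) : Type :=
  ∀ i : Fin s, Matrix (Fin (r i)) (Fin (r i)) ℂ

/-- The elements of `⊕_{i=1}^s M_{r i}(ℂ)` supported on the blocks with label `j`. -/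
def blockSupp {s : ℕ} {r : Fin s → ℕ} {n : ℕ} (J : Fin s → Fin (n + 1)) (j : Fin (n + 1)) :
    Set (FDBlock s r) :=
  {x | ∀ i : Fin s, J i ≠ j → x i = 0}

/-- `DecompositionRankLE n D` : the C*-algebra `D` has decomposition rank at most `n`. -/
def DecompositionRankLE (n : ℕ) (D : Type*) [NormedRing D] [StarRing D]
    [NormedAlgebra ℂ D] : Prop :=
  ∀ (S : Finset D) (ε : ℝ), 0 < ε →
    ∃ (s : ℕ) (r : Fin s → ℕ) (J : Fin s → Fin (n + 1))
      (ψ : D →ₗ[ℂ] FDBlock s r) (φ : FDBlock s r →ₗ[ℂ] D),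
      IsCompletelyPositive ψ ∧ IsCompletelyPositive φ ∧
      (∀ a : D, ‖ψ a‖ ≤ ‖a‖) ∧ (∀ x : FDBlock s r, ‖φ x‖ ≤ ‖x‖) ∧
      (∀ j : Fin (n + 1), OrderZeroOn φ (blockSupp J j)) ∧
      ∀ a ∈ S, ‖φ (ψ a) - a‖ < ε

/-- `NuclearDimensionLE n D` : the C*-algebra `D` has nuclear dimension at most `n`. -/
def NuclearDimensionLE (n : ℕ) (D : Type*) [NormedRing D] [StarRing D]
    [NormedAlgebra ℂ D] : Prop :=
  ∀ (S : Finset D) (ε : ℝ), 0 < ε →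
    ∃ (s : ℕ) (r : Fin s → ℕ) (J : Fin s → Fin (n + 1))
      (ψ : D →ₗ[ℂ] FDBlock s r) (φ : FDBlock s r →ₗ[ℂ] D),
      IsCompletelyPositive ψ ∧ IsCompletelyPositive φ ∧
      (∀ a : D, ‖ψ a‖ ≤ ‖a‖) ∧
      (∀ j : Fin (n + 1), (∀ x ∈ blockSupp J j, ‖φ x‖ ≤ ‖x‖) ∧
        OrderZeroOn φ (blockSupp J j)) ∧
      ∀ a ∈ S, ‖φ (ψ a) - a‖ < ε

/-- A bundled unital C*-algebra. -/
structure CStarAlg : Type 1 where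
  carrier : Type
  [str : CStarAlgebra carrier]

attribute [instance] CStarAlg.str

/-- The *finite saturation* of a class `𝒞` of unital C*-algebras: the smallest class
containing `𝒞` which is closed under isomorphism, finite direct sums, matrix amplifications
and corners by nonzero projections. -/
inductive FinSat (𝒞 : CStarAlg → Prop) : CStarAlg → Prop
  | base {B : CStarAlg} : 𝒞 B → FinSat 𝒞 B
  | iso {B B' : CStarAlg} : FinSat 𝒞 B → Nonempty (B'.carrier ≃⋆ₐ[ℂ] B.carrier) →
      FinSat 𝒞 B'
  | sum {B₁ B₂ B : CStarAlg} : FinSat 𝒞 B₁ → FinSat 𝒞 B₂ →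
      Nonempty (B.carrier ≃⋆ₐ[ℂ] (B₁.carrier × B₂.carrier)) → FinSat 𝒞 B
  | matrix {B B' : CStarAlg} (k : ℕ) : FinSat 𝒞 B →
      Nonempty (B'.carrier ≃⋆ₐ[ℂ] Matrix (Fin (k + 1)) (Fin (k + 1)) B.carrier) →
      FinSat 𝒞 B'
  | corner {B B' : CStarAlg} (p : B.carrier) : FinSat 𝒞 B → p ≠ 0 → p * p = p →
      star p = p →
      (∃ ι : B'.carrier →⋆ₙₐ[ℂ] B.carrier, Function.Injective ι ∧ ι 1 = p ∧
        Set.range ι = {x : B.carrier | p * x * p = x}) →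
      FinSat 𝒞 B'

/-- `A` is a *unital local `𝒞`-algebra*. -/
def IsUnitalLocalAlg (𝒞 : CStarAlg → Prop) (A : Type*) [NormedRing A] [StarRing A]
    [NormedAlgebra ℂ A] : Prop :=
  ∀ (S : Finset A) (ε : ℝ), 0 < ε →
    ∃ B : CStarAlg, FinSat 𝒞 B ∧
      ∃ φ : B.carrier →⋆ₐ[ℂ] A, ∀ a ∈ S, ∃ b : B.carrier, ‖a - φ b‖ < ε

/-- The class of separable unital C*-algebras with decomposition rank at most `n`. -/
def drClass (n : ℕ) : CStarAlg → Prop :=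
  fun B => TopologicalSpace.SeparableSpace B.carrier ∧ DecompositionRankLE n B.carrier

/-- The class of separable unital C*-algebras with nuclear dimension at most `n`. -/
def nucClass (n : ℕ) : CStarAlg → Prop :=
  fun B => TopologicalSpace.SeparableSpace B.carrier ∧ NuclearDimensionLE n B.carrier

/-- The class of separable unital C*-algebras with finite nuclear dimension. -/
def lnucClass : CStarAlg → Prop :=
  fun B => TopologicalSpace.SeparableSpace B.carrier ∧ ∃ n : ℕ, NuclearDimensionLE n B.carrier

/-- A separable unital C*-algebra has *locally finite nuclear dimension* if it is a
unital local `C_lnuc`-algebra. -/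
def HasLocallyFiniteNuclearDimension (A : Type*) [NormedRing A] [StarRing A]
    [NormedAlgebra ℂ A] : Prop :=
  IsUnitalLocalAlg lnucClass A
/-! ### Group actions and the Rokhlin property -/

/-- `α : G → (A →⋆ₐ[ℂ] A)` is an action of the group `G` on `A` by *-automorphisms. -/
def IsGroupAction {G A : Type*} [Group G] [CStarAlgebra A] (α : G → (A →⋆ₐ[ℂ] A)) : Prop :=
  (∀ a : A, α 1 a = a) ∧ ∀ (g h : G) (a : A), α g (α h a) = α (g * h) a

/-- The fixed point algebra `A^α` of an action, as a star subalgebra of `A`. -/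
def fixedPointAlgebra {G A : Type*} [Group G] [CStarAlgebra A] (α : G → (A →⋆ₐ[ℂ] A)) :
    StarSubalgebra ℂ A where
  carrier := {a : A | ∀ g : G, α g a = a}
  mul_mem' := fun {a} {b} ha hb g => by rw [map_mul, ha g, hb g]
  add_mem' := fun {a} {b} ha hb g => by rw [map_add, ha g, hb g]
  algebraMap_mem' := fun c g => by rw [AlgHomClass.commutes]
  star_mem' := fun {a} ha g => by rw [map_star, ha g]

/-- The Rokhlin property for a finite group action, expressed in terms of representing
sequences for projections in `A_∞ = (ℓ^∞(ℕ,A)/c₀(ℕ,A)) ∩ A'`. -/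
def ActionHasRokhlin {G A : Type*} [Group G] [Fintype G] [CStarAlgebra A]
    (α : G → (A →⋆ₐ[ℂ] A)) : Prop :=
  ∃ e : G → ℕ → A,
    (∀ g, ∃ M : ℝ, ∀ k, ‖e g k‖ ≤ M) ∧
    (∀ g, Tendsto (fun k => ‖e g k * e g k - e g k‖) atTop (𝓝 0)) ∧
    (∀ g, Tendsto (fun k => ‖star (e g k) - e g k‖) atTop (𝓝 0)) ∧
    (∀ g (a : A), Tendsto (fun k => ‖e g k * a - a * e g k‖) atTop (𝓝 0)) ∧
    Tendsto (fun k => ‖(∑ g : G, e g k) - 1‖) atTop (𝓝 0) ∧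
    (∀ g h, Tendsto (fun k => ‖α g (e h k) - e (g * h) k‖) atTop (𝓝 0))

/-! ### Inclusions of unital C*-algebras, conditional expectations, Watatani index -/

variable {P A : Type*}

/-- `E : A →ₗ[ℂ] P` is a conditional expectation onto the subalgebra `P` (included in `A`
via the injective unital *-homomorphism `ι`). -/
structure IsCondExpect [CStarAlgebra P] [CStarAlgebra A] (ι : P →⋆ₐ[ℂ] A)
    (E : A →ₗ[ℂ] P) : Prop where
  restricts : ∀ p : P, E (ι p) = p
  pos : ∀ x : A, IsPosElem (E (star x * x))
  bimodule : ∀ (p q : P) (x : A), E (ι p * x * ι q) = p * E x * q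

/-- `{(u i, v i)}` is a quasi-basis for the conditional expectation `E`; the existence of a
quasi-basis says precisely that `E` is of index-finite type. -/
def IsQuasiBasis [CStarAlgebra P] [CStarAlgebra A] (ι : P →⋆ₐ[ℂ] A) (E : A →ₗ[ℂ] P)
    {m : ℕ} (u v : Fin m → A) : Prop :=
  ∀ a : A, (a = ∑ i, u i * ι (E (v i * a))) ∧ (a = ∑ i, ι (E (a * u i)) * v i)

/-- The Rokhlin property for a conditional expectation of index-finite type with index
`ind = ∑ u i * v i` : there is a projection `e` in `A_∞ = (ℓ^∞(ℕ,A)/c₀(ℕ,A)) ∩ A'`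
(given by a representing sequence) with `E^∞(e) = (Index E)⁻¹ · 1` such that `x ↦ x e`
is injective on `A`. -/
def CondExpectHasRokhlin [CStarAlgebra P] [CStarAlgebra A] (ι : P →⋆ₐ[ℂ] A)
    (E : A →ₗ[ℂ] P) (ind : A) : Prop :=
  ∃ e : ℕ → A,
    (∃ M : ℝ, ∀ k, ‖e k‖ ≤ M) ∧
    Tendsto (fun k => ‖e k * e k - e k‖) atTop (𝓝 0) ∧
    Tendsto (fun k => ‖star (e k) - e k‖) atTop (𝓝 0) ∧
    (∀ a : A, Tendsto (fun k => ‖e k * a - a * e k‖) atTop (𝓝 0)) ∧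
    (∃ w : A, w * ind = 1 ∧ ind * w = 1 ∧
      Tendsto (fun k => ‖ι (E (e k)) - w‖) atTop (𝓝 0)) ∧
    (∀ x : A, Tendsto (fun k => ‖x * e k‖) atTop (𝓝 0) → x = 0)

/-! ### Cuntz comparison, dimension functions, strict comparison, almost divisibility -/

/-- Cuntz subequivalence for positive matrices over a C*-algebra (the topology on matrices
over a C*-algebra is the norm topology, which agrees with the product topology). -/
def CuntzSub {R : Type*} [NonUnitalNonAssocSemiring R] [Star R] [TopologicalSpace R]
    {m k : Type*} [Fintype m] [Fintype k] (a : Matrix m m R) (b : Matrix k k R) : Prop :=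
  ∃ v : ℕ → Matrix m k R, Tendsto (fun j => v j * b * (v j).conjTranspose) atTop (𝓝 a)

/-- `matNthRoot a j` is the (unique, if it exists) positive `j`-th root `a^{1/j}` of a
positive matrix `a` over a C*-algebra. -/
def matNthRoot {R : Type*} [Ring R] [StarRing R] {m : Type*} [Fintype m] [DecidableEq m]
    (a : Matrix m m R) (j : ℕ) : Matrix m m R :=
  open scoped Classical in
  if h : ∃ b : Matrix m m R, IsPosElem b ∧ b ^ j = a then h.choose else 0

/-- The standard extension `τ ⊗ Tr` of a functional `τ` to matrices. -/
def traceExt {R : Type*} [Ring R] [Module ℂ R] {m : Type*} [Fintype m]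
    (τ : R →ₗ[ℂ] ℂ) (x : Matrix m m R) : ℂ :=
  ∑ i, τ (x i i)

/-- The dimension function `d_τ(a) = lim_{n → ∞} τ(a^{1/n})` associated to a tracial
state `τ` (the limit exists, so it agrees with the `limsup` used here). -/
def dimFun {R : Type*} [Ring R] [StarRing R] [Module ℂ R] {m : Type*} [Fintype m]
    [DecidableEq m] (τ : R →ₗ[ℂ] ℂ) (a : Matrix m m R) : ℝ :=
  Filter.limsup (fun j : ℕ => (traceExt τ (matNthRoot a (j + 1))).re) atTop

/-- A unital C*-algebra `R` has *strict comparison* (of positive elements, with respect to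
tracial states) if `d_τ(a) < d_τ(b)` for all tracial states `τ` implies `a ≾ b`. -/
def HasStrictComparison (R : Type*) [Ring R] [StarRing R] [Module ℂ R]
    [TopologicalSpace R] : Prop :=
  ∀ (m k : ℕ) (a : Matrix (Fin m) (Fin m) R) (b : Matrix (Fin k) (Fin k) R),
    IsPosElem a → IsPosElem b →
    (∀ τ : R →ₗ[ℂ] ℂ, IsTracialState τ → dimFun τ a < dimFun τ b) →
    CuntzSub a b

/-- The Cuntz semigroup `W(R)` is *almost divisible*: for every positive contraction `a`
over `R` and every `k ≠ 0` there is `x = ⟨c⟩ ∈ W(R)` with `k ⬝ x ≤ ⟨a⟩ ≤ (k+1) ⬝ x`. -/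
def AlmostDivisible (R : Type*) [Ring R] [StarRing R] [TopologicalSpace R] : Prop :=
  ∀ (m : ℕ) (a : Matrix (Fin m) (Fin m) R),
    IsPosElem a → IsPosElem ((1 : Matrix (Fin m) (Fin m) R) - a) →
    ∀ k : ℕ, k ≠ 0 →
      ∃ (l : ℕ) (c : Matrix (Fin l) (Fin l) R), IsPosElem c ∧
        CuntzSub (Matrix.blockDiagonal fun _ : Fin k => c) a ∧
        CuntzSub a (Matrix.blockDiagonal fun _ : Fin (k + 1) => c)

/-- A unital C*-algebra is *pure* if it has strict comparison and almost divisible Cuntz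
semigroup. -/
def IsPure (R : Type*) [Ring R] [StarRing R] [Module ℂ R] [TopologicalSpace R] : Prop :=
  HasStrictComparison R ∧ AlmostDivisible R

/-- The order on projections over `R` is determined by traces. -/
def ProjOrderDeterminedByTraces (R : Type*) [Ring R] [StarRing R] [Module ℂ R] : Prop :=
  ∀ (k l : ℕ) (p : Matrix (Fin k) (Fin k) R) (q : Matrix (Fin l) (Fin l) R),
    p * p = p → star p = p → q * q = q → star q = q →
    (∀ τ : R →ₗ[ℂ] ℂ, IsTracialState τ → (traceExt τ p).re < (traceExt τ q).re) →
    ∃ v : Matrix (Fin l) (Fin k) R,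
      v.conjTranspose * v = p ∧ IsPosElem (q - v * v.conjTranspose)

/-- A unital C*-algebra has stable rank one if its invertible elements are dense. -/
def HasStableRankOne (R : Type*) [Ring R] [TopologicalSpace R] : Prop :=
  Dense {x : R | IsUnit x}

/-- A unital C*-algebra is simple if it has no nontrivial closed two-sided ideals. -/
def IsSimpleCStarAlgebra (A : Type*) [CStarAlgebra A] : Prop :=
  ∀ I : TwoSidedIdeal A, IsClosed (I : Set A) → I = ⊥ ∨ I = ⊤
/-! ### Corners `pRp` by a projection `p` -/

section CornerSection

variable {R : Type*} [Ring R] [StarRing R] [Algebra ℂ R] [StarModule ℂ R]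

/-- The corner `p R p` of a unital C*-algebra `R` by a projection `p`, as a unital
`*`-algebra with unit `p`. -/
def Corner (p : R) (_hp : p * p = p) (_hsp : star p = p) : Type _ :=
  {x : R // p * x * p = x}

namespace Corner

variable {p : R} {hp : p * p = p} {hsp : star p = p}

theorem mem_mul_left (hp : p * p = p) {x : R} (hx : p * x * p = x) : p * x = x := by
  conv_lhs => rw [← hx]
  simp only [← mul_assoc]
  rw [hp, hx]

theorem mem_mul_right (hp : p * p = p) {x : R} (hx : p * x * p = x) : x * p = x := by
  conv_lhs => rw [← hx]
  rw [mul_assoc, mul_assoc, hp, ← mul_assoc, hx]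

instance : Add (Corner p hp hsp) :=
  ⟨fun x y => ⟨x.1 + y.1, by rw [mul_add, add_mul, x.2, y.2]⟩⟩

instance : Zero (Corner p hp hsp) :=
  ⟨⟨0, by rw [mul_zero, zero_mul]⟩⟩

instance : Neg (Corner p hp hsp) :=
  ⟨fun x => ⟨-x.1, by rw [mul_neg, neg_mul, x.2]⟩⟩

instance : Mul (Corner p hp hsp) :=
  ⟨fun x y => ⟨x.1 * y.1, by
    rw [← mul_assoc p x.1 y.1, mem_mul_left hp x.2, mul_assoc x.1 y.1 p,
      mem_mul_right hp y.2]⟩⟩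

instance : One (Corner p hp hsp) :=
  ⟨⟨p, by rw [hp, hp]⟩⟩

instance : SMul ℂ (Corner p hp hsp) :=
  ⟨fun c x => ⟨c • x.1, by rw [mul_smul_comm, smul_mul_assoc, x.2]⟩⟩

instance : Star (Corner p hp hsp) :=
  ⟨fun x => ⟨star x.1, by
    conv_rhs => rw [← x.2]
    rw [star_mul, star_mul, hsp, ← mul_assoc]⟩⟩

@[simp] theorem val_add (x y : Corner p hp hsp) : (x + y).1 = x.1 + y.1 := rfl
@[simp] theorem val_mul (x y : Corner p hp hsp) : (x * y).1 = x.1 * y.1 := rfl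
@[simp] theorem val_zero : (0 : Corner p hp hsp).1 = 0 := rfl
@[simp] theorem val_one : (1 : Corner p hp hsp).1 = p := rfl
@[simp] theorem val_neg (x : Corner p hp hsp) : (-x).1 = -x.1 := rfl
@[simp] theorem val_smul (c : ℂ) (x : Corner p hp hsp) : (c • x).1 = c • x.1 := rfl
@[simp] theorem val_star (x : Corner p hp hsp) : (star x).1 = star x.1 := rfl

instance instRing : Ring (Corner p hp hsp) where
  add_assoc x y z := Subtype.ext <| by simp [add_assoc]
  zero_add x := Subtype.ext <| by simp
  add_zero x := Subtype.ext <| by simp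
  add_comm x y := Subtype.ext <| by simp [add_comm]
  neg_add_cancel x := Subtype.ext <| by simp
  nsmul := nsmulRec
  zsmul := zsmulRec
  mul_assoc x y z := Subtype.ext <| by simp [mul_assoc]
  one_mul x := Subtype.ext <| by simpa using mem_mul_left hp x.2
  mul_one x := Subtype.ext <| by simpa using mem_mul_right hp x.2
  left_distrib x y z := Subtype.ext <| by simp [left_distrib]
  right_distrib x y z := Subtype.ext <| by simp [right_distrib]
  zero_mul x := Subtype.ext <| by simp
  mul_zero x := Subtype.ext <| by simp

instance instStarRing : StarRing (Corner p hp hsp) where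
  star_involutive x := Subtype.ext <| by simp
  star_mul x y := Subtype.ext <| by simp
  star_add x y := Subtype.ext <| by simp

instance instModule : Module ℂ (Corner p hp hsp) where
  one_smul x := Subtype.ext <| by simp
  mul_smul c d x := Subtype.ext <| by simp [mul_smul]
  smul_zero c := Subtype.ext <| by simp
  smul_add c x y := Subtype.ext <| by simp
  add_smul c d x := Subtype.ext <| by simp [add_smul]
  zero_smul x := Subtype.ext <| by simp

instance instTop [TopologicalSpace R] : TopologicalSpace (Corner p hp hsp) :=
  instTopologicalSpaceSubtype

end Corner

end CornerSection

/-! ### Sequence algebras: `A^∞ = ℓ^∞(ℕ, A)/c₀(ℕ, A)` via representing sequences -/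

/-- A sequence in a normed space is null (i.e. lies in `c₀(ℕ, A)`). -/
def IsNullSeq {A : Type*} [Norm A] (x : ℕ → A) : Prop :=
  Tendsto (fun n => ‖x n‖) atTop (𝓝 0)

/-- A sequence in a normed space is bounded (i.e. lies in `ℓ^∞(ℕ, A)`). -/
def IsBddSeq {A : Type*} [Norm A] (x : ℕ → A) : Prop :=
  ∃ M : ℝ, ∀ n, ‖x n‖ ≤ M

/-- A linear map `β : A →ₗ[ℂ] ℓ^∞(ℕ, P)` represents a unital *-homomorphism
`A → P^∞ = ℓ^∞(ℕ, P)/c₀(ℕ, P)` : it takes values in bounded sequences and is unital,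
multiplicative and star-preserving modulo `c₀(ℕ, P)`. -/
structure RepresentsHomToSeqAlg {A P : Type*} [CStarAlgebra A] [CStarAlgebra P]
    (β : A →ₗ[ℂ] (ℕ → P)) : Prop where
  bdd : ∀ x : A, IsBddSeq (β x)
  unital : IsNullSeq (β 1 - 1)
  mul : ∀ x y : A, IsNullSeq (β (x * y) - β x * β y)
  star : ∀ x : A, IsNullSeq (β (star x) - star (β x))

/-- A Banach limit: a linear functional on (bounded) complex sequences which is unital,
shift-invariant, positive and bounded. -/
structure IsBanachLimit (L : (ℕ → ℂ) →ₗ[ℂ] ℂ) : Prop where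
  unital : L 1 = 1
  shift : ∀ x : ℕ → ℂ, IsBddSeq x → L (fun n => x (n + 1)) = L x
  pos : ∀ x : ℕ → ℂ, IsBddSeq x → (∀ n, 0 ≤ x n) → 0 ≤ L x
  norm_le : ∀ (x : ℕ → ℂ) (M : ℝ), (∀ n, ‖x n‖ ≤ M) → ‖L x‖ ≤ M

/-- A C*-algebra is *exact* iff it is nuclearly embeddable (Kirchberg): it admits a faithful
representation `π : A → B(H)` which approximately factors through matrix algebras by
completely positive contractions in the point-norm topology. -/
def IsExactCStar (A : Type*) [CStarAlgebra A] : Prop :=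
  ∃ (H : Type) (_ : NormedAddCommGroup H) (_ : InnerProductSpace ℂ H) (_ : CompleteSpace H)
    (π : A →⋆ₐ[ℂ] (H →L[ℂ] H)), Function.Injective π ∧
      ∀ (S : Finset A) (ε : ℝ), 0 < ε →
        ∃ (k : ℕ) (ψ : A →ₗ[ℂ] Matrix (Fin k) (Fin k) ℂ)
          (φ : Matrix (Fin k) (Fin k) ℂ →ₗ[ℂ] (H →L[ℂ] H)),
          IsCompletelyPositive ψ ∧ IsCompletelyPositive φ ∧
          (∀ a : A, ‖ψ a‖ ≤ ‖a‖) ∧ (∀ x, ‖φ x‖ ≤ ‖x‖) ∧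
          ∀ a ∈ S, ‖φ (ψ a) - π a‖ < ε

section NucLocalProof
set_option linter.unusedSectionVars false
set_option linter.style.haveILetI false
set_option linter.unusedSimpArgs false
set_option linter.unusedVariables false
open scoped ComplexOrder Matrix.Norms.L2Operator
open Filter Topology

namespace NucLocal

section Basic

lemma pos_iff {A : Type*} [CStarAlgebra A] [PartialOrder A] [StarOrderedRing A] {a : A} :
    IsPosElem a ↔ 0 ≤ a :=
  CStarAlgebra.nonneg_iff_eq_star_mul_self.symm

lemma pos_zero {R : Type*} [NonUnitalSemiring R] [StarRing R] : IsPosElem (0 : R) :=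
  ⟨0, by simp⟩

lemma pos_star_mul {R : Type*} [Mul R] [Star R] (y : R) : IsPosElem (star y * y) := ⟨y, rfl⟩

lemma pos_conj {R : Type*} [Semigroup R] [StarMul R] {a : R} (h : IsPosElem a) (c : R) :
    IsPosElem (star c * a * c) := by
  obtain ⟨y, rfl⟩ := h
  exact ⟨y * c, by simp [mul_assoc]⟩

lemma pos_star {R : Type*} [Semigroup R] [StarMul R] {a : R} (h : IsPosElem a) : star a = a := by
  obtain ⟨y, rfl⟩ := h
  simp

lemma pos_add {A : Type*} [CStarAlgebra A] {a b : A} (ha : IsPosElem a) (hb : IsPosElem b) :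
    IsPosElem (a + b) := by
  letI := CStarAlgebra.spectralOrder A
  haveI := CStarAlgebra.spectralOrderedRing A
  rw [pos_iff] at *
  exact add_nonneg ha hb

lemma pos_sum {A ι : Type*} [CStarAlgebra A] (s : Finset ι) {f : ι → A}
    (h : ∀ i ∈ s, IsPosElem (f i)) : IsPosElem (∑ i ∈ s, f i) := by
  letI := CStarAlgebra.spectralOrder A
  haveI := CStarAlgebra.spectralOrderedRing A
  simp only [pos_iff] at *
  exact Finset.sum_nonneg h

lemma mpos_add {A κ : Type*} [CStarAlgebra A] [Fintype κ] {x y : Matrix κ κ A}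
    (hx : IsPosElem x) (hy : IsPosElem y) : IsPosElem (x + y) := by
  classical
  letI := CStarAlgebra.spectralOrder A
  haveI := CStarAlgebra.spectralOrderedRing A
  exact pos_add (A := CStarMatrix κ κ A) hx hy

lemma mpos_sum {A κ ι : Type*} [CStarAlgebra A] [Fintype κ] (s : Finset ι)
    {f : ι → Matrix κ κ A}
    (h : ∀ i ∈ s, IsPosElem (f i)) : IsPosElem (∑ i ∈ s, f i) := by
  classical
  induction s using Finset.induction_on with
  | empty => simpa using pos_zero
  | insert a s ha ih =>
    rw [Finset.sum_insert ha]
    exact mpos_add (h _ (by simp)) (ih fun i hi => h i (by simp [hi]))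

end Basic

section CP

variable {A B C : Type*} [Ring A] [StarRing A] [Module ℂ A] [Ring B] [StarRing B] [Module ℂ B]
  [Ring C] [StarRing C] [Module ℂ C]

lemma pos_reindex {κ κ' : Type*} [Fintype κ] [Fintype κ'] (e : κ ≃ κ') {x : Matrix κ κ A}
    (h : IsPosElem x) : IsPosElem (x.submatrix e.symm e.symm) := by
  obtain ⟨y, rfl⟩ := h
  refine ⟨y.submatrix e.symm e.symm, ?_⟩
  ext i j
  simp only [Matrix.submatrix_apply, Matrix.mul_apply, Matrix.star_apply]
  exact (Equiv.sum_comp e.symm (fun k => star (y k (e.symm i)) * y k (e.symm j))).symm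

lemma cp_fintype {f : A →ₗ[ℂ] B} (hf : IsCompletelyPositive f) {κ : Type*} [Fintype κ]
    {x : Matrix κ κ A} (h : IsPosElem x) : IsPosElem (x.map f) := by
  have h1 := hf _ _ (pos_reindex (Fintype.equivFin κ) h)
  have h2 := pos_reindex (Fintype.equivFin κ).symm h1
  convert h2 using 1
  ext i j
  simp

lemma cp_pos {f : A →ₗ[ℂ] B} (hf : IsCompletelyPositive f) {a : A} (h : IsPosElem a) :
    IsPosElem (f a) := by
  obtain ⟨y, rfl⟩ := h
  have h1 := hf 1 (star (Matrix.of fun _ _ => y) * (Matrix.of fun _ _ => y)) ⟨_, rfl⟩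
  obtain ⟨z, hz⟩ := h1
  refine ⟨z 0 0, ?_⟩
  have := congrFun (congrFun hz 0) 0
  simpa [Matrix.mul_apply, Matrix.star_apply] using this

/-- two-positivity -/
lemma cp_two {f : A →ₗ[ℂ] B} (hf : IsCompletelyPositive f) (a b : A) :
    ∃ u v : Fin 2 → B, f (star a * a) = ∑ k, star (u k) * u k ∧
      f (star a * b) = ∑ k, star (u k) * v k ∧ f (star b * a) = ∑ k, star (v k) * u k ∧
      f (star b * b) = ∑ k, star (v k) * v k := by
  obtain ⟨z, hz⟩ := hf 2 (star !![a, b; 0, 0] * !![a, b; 0, 0]) ⟨_, rfl⟩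
  have h := fun i j => congrFun (congrFun hz i) j
  refine ⟨fun k => z k 0, fun k => z k 1, ?_, ?_, ?_, ?_⟩
  · simpa [Matrix.mul_apply, Matrix.star_apply, Fin.sum_univ_two] using h 0 0
  · simpa [Matrix.mul_apply, Matrix.star_apply, Fin.sum_univ_two] using h 0 1
  · simpa [Matrix.mul_apply, Matrix.star_apply, Fin.sum_univ_two] using h 1 0
  · simpa [Matrix.mul_apply, Matrix.star_apply, Fin.sum_univ_two] using h 1 1

lemma cp_star {f : A →ₗ[ℂ] B} (hf : IsCompletelyPositive f) (a : A) :
    f (star a) = star (f a) := by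
  obtain ⟨u, v, -, h2, h3, -⟩ := cp_two hf 1 a
  simp only [star_one, one_mul, mul_one] at h2 h3
  rw [h2, h3]; simp

lemma cp_comp {g : B →ₗ[ℂ] C} {f : A →ₗ[ℂ] B} (hg : IsCompletelyPositive g)
    (hf : IsCompletelyPositive f) : IsCompletelyPositive (g ∘ₗ f) := by
  intro k x hx
  have := hg k _ (hf k x hx)
  rwa [Matrix.map_map] at this

lemma cp_of_hom (f : A →ₗ[ℂ] B) (hm : ∀ x y, f (x * y) = f x * f y)
    (hs : ∀ x, f (star x) = star (f x)) : IsCompletelyPositive f := by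
  rintro k x ⟨y, rfl⟩
  refine ⟨y.map f, ?_⟩
  ext i j
  simp [Matrix.mul_apply, Matrix.star_apply, hm, hs]

end CP

section CP2
variable {A B : Type*} [Ring A] [StarRing A] [Module ℂ A] [Ring B] [StarRing B] [Algebra ℂ B]

/-- compression of a linear map -/
def conjMap (f : A →ₗ[ℂ] B) (c : B) : A →ₗ[ℂ] B :=
  (LinearMap.mulRight ℂ c) ∘ₗ (LinearMap.mulLeft ℂ (star c)) ∘ₗ f

@[simp] lemma conjMap_apply (f : A →ₗ[ℂ] B) (c : B) (a : A) :
    conjMap f c a = star c * f a * c := by simp [conjMap]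

lemma cp_conj {f : A →ₗ[ℂ] B} (hf : IsCompletelyPositive f) (c : B) :
    IsCompletelyPositive (conjMap f c) := by
  intro k x hx
  obtain ⟨z, hz⟩ := hf k x hx
  refine ⟨Matrix.of fun a b => z a b * c, ?_⟩
  ext i j
  have := congrFun (congrFun hz i) j
  simp only [Matrix.map_apply] at this
  simp only [Matrix.map_apply, conjMap_apply, this]
  simp [Matrix.mul_apply, Matrix.star_apply, Finset.mul_sum, Finset.sum_mul,
    mul_assoc]

end CP2

section CP3
variable {A B : Type*} [Ring A] [StarRing A] [Module ℂ A] [CStarAlgebra B]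

lemma cp_sum {ι : Type*} (s : Finset ι) {f : ι → A →ₗ[ℂ] B}
    (hf : ∀ i ∈ s, IsCompletelyPositive (f i)) : IsCompletelyPositive (∑ i ∈ s, f i) := by
  intro k x hx
  have := mpos_sum s (f := fun i => x.map (f i)) (fun i hi => hf i hi k x hx)
  convert this using 1
  ext i j
  simp [Matrix.sum_apply]

end CP3
end NucLocal

namespace NucLocal

section Ord

variable {A : Type*} [CStarAlgebra A] [PartialOrder A] [StarOrderedRing A]

lemma cs_one {κ : Type*} [Fintype κ] (z w : κ → A) (hz : ∑ k, star (z k) * z k ≤ 1) :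
    star (∑ k, star (z k) * w k) * (∑ k, star (z k) * w k) ≤ ∑ k, star (w k) * w k := by
  set X := ∑ k, star (z k) * w k with hX
  have h0 : 0 ≤ ∑ k, star (w k - z k * X) * (w k - z k * X) :=
    Finset.sum_nonneg fun k _ => star_mul_self_nonneg _
  have hXs : star X = ∑ k, star (w k) * z k := by simp [hX]
  have h1 : ∑ k, star (w k - z k * X) * (w k - z k * X) =
      ∑ k, star (w k) * w k - star X * X - star X * X
        + star X * (∑ k, star (z k) * z k) * X := by
    have e1 : star X * X = ∑ k, star (w k) * (z k * X) := by
      conv_lhs => rw [hXs]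
      rw [Finset.sum_mul]; simp [mul_assoc]
    have e2 : star X * X = ∑ k, star X * (star (z k) * w k) := by
      conv_lhs => rw [hX]
      rw [← hX, Finset.mul_sum]
    conv_rhs => enter [1, 2]; rw [e2]
    conv_rhs => enter [1, 1, 2]; rw [e1]
    have e3 : star X * (∑ k, star (z k) * z k) * X = ∑ k, star X * (star (z k) * z k) * X := by
      clear_value X
      rw [Finset.mul_sum, Finset.sum_mul]
    rw [e3, ← Finset.sum_sub_distrib, ← Finset.sum_sub_distrib, ← Finset.sum_add_distrib]
    refine Finset.sum_congr rfl fun k _ => ?_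
    simp only [star_sub, star_mul]
    noncomm_ring
  have h2 : star X * (∑ k, star (z k) * z k) * X ≤ star X * 1 * X :=
    star_left_conjugate_le_conjugate hz X
  rw [h1] at h0
  rw [mul_one] at h2
  have h3 := add_le_add h0 h2
  rw [← sub_nonneg] at h3 ⊢
  refine h3.trans_eq ?_
  abel

lemma norm_sq_le_of {a b : A} (h : star a * a ≤ b) : ‖a‖ ^ 2 ≤ ‖b‖ := by
  have := CStarAlgebra.norm_le_norm_of_nonneg_of_le (star_mul_self_nonneg a) h
  rwa [CStarRing.norm_star_mul_self, ← sq] at this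

lemma kadison {D : Type*} [Ring D] [StarRing D] [Module ℂ D] {f : D →ₗ[ℂ] A}
    (hf : IsCompletelyPositive f) (h1 : f 1 ≤ 1) (a : D) :
    star (f a) * f a ≤ f (star a * a) := by
  obtain ⟨u, v, e1, e2, -, e3⟩ := cp_two hf 1 a
  simp only [star_one, one_mul] at e1 e2
  rw [e1] at h1
  rw [e2, e3]
  exact cs_one u v h1

lemma cp_mono {D : Type*} [CStarAlgebra D] [PartialOrder D] [StarOrderedRing D] {f : D →ₗ[ℂ] A}
    (hf : IsCompletelyPositive f) {a b : D} (h : a ≤ b) : f a ≤ f b := by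
  have := cp_pos hf (pos_iff.2 (sub_nonneg.2 h))
  rw [pos_iff, map_sub] at this
  exact sub_nonneg.1 this

lemma cp_norm_le {D : Type*} [CStarAlgebra D] {f : D →ₗ[ℂ] A}
    (hf : IsCompletelyPositive f) (h1 : f 1 ≤ 1) (a : D) : ‖f a‖ ≤ ‖a‖ := by
  letI := CStarAlgebra.spectralOrder D
  haveI := CStarAlgebra.spectralOrderedRing D
  have h2 := kadison hf h1 a
  have h3 : star a * a ≤ algebraMap ℝ D (‖a‖ ^ 2) := CStarAlgebra.star_mul_le_algebraMap_norm_sq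
  have h4 := cp_mono hf h3
  have e : f (algebraMap ℝ D (‖a‖ ^ 2)) = (‖a‖ ^ 2 : ℝ) • f 1 := by
    rw [Algebra.algebraMap_eq_smul_one]
    have := f.map_smul ((‖a‖ ^ 2 : ℝ) : ℂ) (1 : D)
    simpa only [Complex.coe_smul] using this
  have h5 : (‖a‖ ^ 2 : ℝ) • f 1 ≤ (‖a‖ ^ 2 : ℝ) • (1 : A) :=
    smul_le_smul_of_nonneg_left h1 (by positivity)
  have h6 := norm_sq_le_of ((h2.trans h4).trans (e.trans_le h5))
  by_cases hA : Subsingleton A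
  · have : f a = 0 := Subsingleton.elim _ _
    simp [this]
  · haveI := not_subsingleton_iff_nontrivial.1 hA
    rw [norm_smul, norm_one, mul_one, Real.norm_of_nonneg (by positivity)] at h6
    exact (sq_le_sq₀ (norm_nonneg _) (norm_nonneg _)).1 h6

lemma cp_kill {D : Type*} [Ring D] [StarRing D] [Module ℂ D] {f : D →ₗ[ℂ] A}
    (hf : IsCompletelyPositive f) {x : D} {c : A} (h : f (star x * x) * c = 0) : f x * c = 0 := by
  obtain ⟨u, v, -, e2, -, e3⟩ := cp_two hf 1 x
  simp only [star_one, one_mul] at e2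
  have h0 : ∑ k, star (v k * c) * (v k * c) = 0 := by
    rw [e3, Finset.sum_mul] at h
    have := congrArg (star c * ·) h
    simpa [Finset.mul_sum, mul_assoc, mul_add] using this
  rw [Finset.sum_eq_zero_iff_of_nonneg (fun k _ => star_mul_self_nonneg _)] at h0
  rw [e2, Finset.sum_mul]
  refine Finset.sum_eq_zero fun k _ => ?_
  have := h0 k (by simp)
  rw [CStarRing.star_mul_self_eq_zero_iff] at this
  rw [mul_assoc, this, mul_zero]

end Ord

/-- order zero -/
def OZ {D A : Type*} [Mul D] [Zero D] [Mul A] [Zero A] (f : D → A) : Prop :=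
  ∀ x y, x * y = 0 → y * x = 0 → f x * f y = 0

section OZ1
variable {A : Type*} [CStarAlgebra A] {D : Type*} [Ring D] [StarRing D] [Module ℂ D]
  {f : D →ₗ[ℂ] A}

lemma oz_mul_zero (hf : IsCompletelyPositive f) (h0 : OZ f) {x y : D} (h : x * y = 0) :
    f x * f y = 0 := by
  letI := CStarAlgebra.spectralOrder A
  haveI := CStarAlgebra.spectralOrderedRing A
  have h1 : f (star x * x) * f (y * star y) = 0 := by
    apply h0
    · calc star x * x * (y * star y) = star x * (x * y) * star y := by simp [mul_assoc]
        _ = 0 := by simp [h]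
    · calc y * star y * (star x * x) = y * star (x * y) * x := by simp [mul_assoc]
        _ = 0 := by simp [h]
  have h2 := cp_kill hf h1
  have h3 : f (star (star y) * star y) * star (f x) = 0 := by
    have := congrArg star h2
    rw [star_mul, ← cp_star hf, star_mul, star_star, star_zero] at this
    simpa using this
  have h4 := cp_kill hf h3
  have := congrArg star h4
  rw [star_mul, star_star, ← cp_star hf, star_star, star_zero] at this
  exact this

lemma oz_idem (hf : IsCompletelyPositive f) (h0 : OZ f) {e : D} (he : e * e = e) (x y : D) :
    f (x * e) * f y = f x * f (e * y) := by
  have h1 : f (x * e) * f (y - e * y) = 0 := oz_mul_zero hf h0 (by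
    rw [mul_sub, mul_assoc x e (e * y), ← mul_assoc e e y, he, ← mul_assoc, sub_self])
  have h2 : f (x - x * e) * f (e * y) = 0 := oz_mul_zero hf h0 (by
    rw [sub_mul, mul_assoc x e (e * y), ← mul_assoc e e y, he, sub_self])
  rw [map_sub, mul_sub, sub_eq_zero] at h1
  rw [map_sub, sub_mul, sub_eq_zero] at h2
  rw [h1, h2]

end OZ1

/-- finite-dimensional C*-algebra with general index types -/
abbrev FB (ι : Type) (m : ι → Type) : Type := ∀ i : ι, Matrix (m i) (m i) ℂ

section OZ2
variable {A : Type*} [CStarAlgebra A] {ι : Type} {m : ι → Type} [Fintype ι] [DecidableEq ι]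
  [∀ i, Fintype (m i)] [∀ i, DecidableEq (m i)] {f : FB ι m →ₗ[ℂ] A}

lemma fb_span (P : FB ι m → Prop) (hadd : ∀ x y, P x → P y → P (x + y))
    (h0 : P 0) (hsmul : ∀ (c : ℂ) x, P x → P (c • x)) (hid : ∀ e, e * e = e → P e) (x : FB ι m) :
    P x := by
  have hE : ∀ (i : ι) (k l : m i), P (Pi.single i (Matrix.single k l 1)) := by
    intro i k l
    by_cases h : k = l
    · subst h
      apply hid
      rw [← Pi.single_mul]
      simp
    · have h1 : P (Pi.single i (Matrix.single k k 1 + Matrix.single k l 1)) := by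
        apply hid
        rw [← Pi.single_mul]
        congr 1
        simp [mul_add, add_mul, Ne.symm h]
      have h2 : P ((-1 : ℂ) • Pi.single i (Matrix.single k k 1)) := by
        apply hsmul
        apply hid
        rw [← Pi.single_mul]
        simp
      have := hadd _ _ h1 h2
      convert this using 1
      rw [Pi.single_add]; simp
  have hs : ∀ {κ : Type} (s : Finset κ) (g : κ → FB ι m), (∀ k ∈ s, P (g k)) → P (∑ k ∈ s, g k) := by
    classical
    intro κ s g
    induction s using Finset.induction_on with
    | empty => intro _; simpa using h0
    | insert a s ha ih =>
      intro h
      rw [Finset.sum_insert ha]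
      exact hadd _ _ (h _ (by simp)) (ih fun i hi => h i (by simp [hi]))
  rw [← Finset.univ_sum_single x]
  refine hs _ _ fun i _ => ?_
  have e : (Pi.single i (x i) : FB ι m) =
      ∑ k, ∑ l, x i k l • Pi.single i (Matrix.single k l 1) := by
    conv_lhs => rw [Matrix.matrix_eq_sum_single (x i)]
    have h3 : ∀ y : Matrix (m i) (m i) ℂ, (Pi.single i y : FB ι m) =
      LinearMap.single ℂ (fun i => Matrix (m i) (m i) ℂ) i y := fun y => rfl
    simp only [h3, map_sum, ← map_smul]
    simp
  rw [e]
  exact hs _ _ fun k _ => hs _ _ fun l _ => hsmul _ _ (hE _ _ _)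

lemma oz_mid (hf : IsCompletelyPositive f) (h0 : OZ f) (c x y : FB ι m) :
    f (x * c) * f y = f x * f (c * y) := by
  revert x y
  refine fb_span (fun c => ∀ x y, f (x * c) * f y = f x * f (c * y)) ?_ ?_ ?_ ?_ c
  · intro a b ha hb x y
    simp only [mul_add, add_mul, map_add, ha x y, hb x y]
  · intro x y; simp
  · intro c a ha x y
    simp [ha x y]
  · intro e he x y
    exact oz_idem hf h0 he x y

lemma oz_mul (hf : IsCompletelyPositive f) (h0 : OZ f) (x y : FB ι m) :
    f x * f y = f 1 * f (x * y) := by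
  simpa using oz_mid hf h0 x 1 y

lemma oz_comm (hf : IsCompletelyPositive f) (h0 : OZ f) (x : FB ι m) :
    f 1 * f x = f x * f 1 := by
  simpa using (oz_mid hf h0 x 1 1).symm

end OZ2
end NucLocal

namespace NucLocal

/-- technical reformulation of finite nuclear dimension -/
def Good (n : ℕ) (A : Type*) [CStarAlgebra A] : Prop :=
  ∀ (S : Finset A) (ε : ℝ), 0 < ε → ∃ (ι : Type) (_ : Fintype ι) (_ : DecidableEq ι)
    (m : ι → Type) (_ : ∀ i, Fintype (m i)) (_ : ∀ i, DecidableEq (m i))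
    (φ : Fin (n + 1) → FB ι m →ₗ[ℂ] A) (d : Fin (n + 1) → FB ι m)
    (x : Fin (n + 1) → A → FB ι m),
    (∀ j, IsCompletelyPositive (φ j)) ∧ (∀ j, OZ (φ j)) ∧ (∀ j, IsPosElem (1 - φ j 1)) ∧
    (∀ j, IsPosElem (d j)) ∧ (∀ j, IsPosElem (1 - d j)) ∧
    ∀ a ∈ S,
      (∀ j i, ‖φ j (Pi.single i (x j a i)) - φ j (Pi.single i (d j i)) * a‖ ≤ ε) ∧
      (∀ j i, ‖φ j (Pi.single i (x j a i)) - a * φ j (Pi.single i (d j i))‖ ≤ ε) ∧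
      ‖∑ j, φ j (x j a) - a‖ ≤ ε

lemma pos_one_sub {A : Type*} [CStarAlgebra A] {a : A} (ha : IsPosElem a) (h : ‖a‖ ≤ 1) :
    IsPosElem (1 - a) := by
  letI := CStarAlgebra.spectralOrder A
  haveI := CStarAlgebra.spectralOrderedRing A
  rw [pos_iff] at *
  exact sub_nonneg.2 ((CStarAlgebra.norm_le_one_iff_of_nonneg a ha).1 h)

lemma norm_le_one_of_pos {A : Type*} [CStarAlgebra A] {a : A} (ha : IsPosElem a)
    (h : IsPosElem (1 - a)) : ‖a‖ ≤ 1 := by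
  letI := CStarAlgebra.spectralOrder A
  haveI := CStarAlgebra.spectralOrderedRing A
  rw [pos_iff] at *
  exact (CStarAlgebra.norm_le_one_iff_of_nonneg a ha).2 (sub_nonneg.1 h)

lemma norm_one_le' (A : Type*) [CStarAlgebra A] : ‖(1 : A)‖ ≤ 1 := by
  by_cases hA : Subsingleton A
  · have : (1 : A) = 0 := Subsingleton.elim _ _
    simp [this]
  · haveI := not_subsingleton_iff_nontrivial.1 hA
    simp

section MD
variable {A : Type*} [CStarAlgebra A] [PartialOrder A] [StarOrderedRing A]

lemma mult_dom {ι : Type*} [Fintype ι] (T : ι → A →ₗ[ℂ] A) (hT : ∀ i, IsCompletelyPositive (T i))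
    (h1 : ∀ i, T i 1 ≤ 1) (a : A) {ε : ℝ}
    (e1 : ‖∑ i, T i 1 - 1‖ ≤ ε) (e2 : ‖∑ i, T i a - a‖ ≤ ε)
    (e3 : ‖∑ i, T i (star a) - star a‖ ≤ ε) (e4 : ‖∑ i, T i (star a * a) - star a * a‖ ≤ ε)
    (i : ι) : ‖T i 1 * a - T i a‖ ^ 2 ≤ ε * (‖a‖ + 1) ^ 2 := by
  classical
  have key : ∀ i, ∃ Q : A, star (T i 1 * a - T i a) * (T i 1 * a - T i a) ≤ Q ∧ 0 ≤ Q ∧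
      Q = star a * T i 1 * a - star a * T i a - T i (star a) * a + T i (star a * a) := by
    intro i
    obtain ⟨u, v, h2, h3, h4, h5⟩ := cp_two (hT i) 1 a
    simp only [star_one, one_mul, mul_one] at h2 h3 h4
    refine ⟨∑ k, star (u k * a - v k) * (u k * a - v k), ?_,
      Finset.sum_nonneg fun k _ => star_mul_self_nonneg _, ?_⟩
    · have := cs_one u (fun k => u k * a - v k) (h2 ▸ h1 i)
      have e : ∑ k, star (u k) * (u k * a - v k) = T i 1 * a - T i a := by
        rw [h2, h3, Finset.sum_mul, ← Finset.sum_sub_distrib]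
        exact Finset.sum_congr rfl fun k _ => by noncomm_ring
      rwa [e] at this
    · rw [h2, h3, h4, h5]
      simp only [Fin.sum_univ_two, star_sub, star_mul]
      noncomm_ring
  choose Q hQ1 hQ0 hQ using key
  have hs : ∑ i, Q i = star a * (∑ i, T i 1 - 1) * a - star a * (∑ i, T i a - a)
      - (∑ i, T i (star a) - star a) * a + (∑ i, T i (star a * a) - star a * a) := by
    simp only [hQ, Finset.sum_add_distrib, Finset.sum_sub_distrib, ← Finset.mul_sum,
      ← Finset.sum_mul]
    noncomm_ring
  have hn : ‖∑ i, Q i‖ ≤ ε * (‖a‖ + 1) ^ 2 := by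
    rw [hs]
    have b1 : ‖star a * (∑ i, T i 1 - 1) * a‖ ≤ ‖a‖ * ε * ‖a‖ := by
      refine (norm_mul_le _ _).trans ?_
      gcongr
      refine (norm_mul_le _ _).trans ?_
      rw [norm_star]; gcongr
    have b2 : ‖star a * (∑ i, T i a - a)‖ ≤ ‖a‖ * ε := by
      refine (norm_mul_le _ _).trans ?_
      rw [norm_star]; gcongr
    have b3 : ‖(∑ i, T i (star a) - star a) * a‖ ≤ ε * ‖a‖ := by
      refine (norm_mul_le _ _).trans ?_
      gcongr
    refine (norm_add_le _ _).trans ?_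
    refine (add_le_add ((norm_sub_le _ _).trans (add_le_add ((norm_sub_le _ _).trans
      (add_le_add b1 b2)) b3)) e4).trans_eq ?_
    ring
  have hle : Q i ≤ ∑ i, Q i := Finset.single_le_sum (fun k _ => hQ0 k) (Finset.mem_univ i)
  refine (norm_sq_le_of ((hQ1 i).trans hle)).trans hn

end MD

section Lem1
variable {ι : Type} {m : ι → Type} [Fintype ι] [DecidableEq ι]
  [∀ i, Fintype (m i)] [∀ i, DecidableEq (m i)]

/-- cut down to a set of blocks -/
def cut (p : ι → Prop) [DecidablePred p] : FB ι m →ₗ[ℂ] FB ι m where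
  toFun x i := if p i then x i else 0
  map_add' x y := by ext i; by_cases h : p i <;> simp [h]
  map_smul' c x := by ext i; by_cases h : p i <;> simp [h]

lemma cut_mul (p : ι → Prop) [DecidablePred p] (x y : FB ι m) :
    cut p (x * y) = cut p x * cut p y := by
  ext1 i; by_cases h : p i <;> simp [cut, h]

lemma cut_star (p : ι → Prop) [DecidablePred p] (x : FB ι m) :
    cut p (star x) = star (cut p x) := by
  ext1 i; by_cases h : p i <;> simp [cut, h]

lemma cut_cp (p : ι → Prop) [DecidablePred p] :
    IsCompletelyPositive (cut p : FB ι m →ₗ[ℂ] FB ι m) :=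
  cp_of_hom _ (cut_mul p) (cut_star p)

lemma cut_norm (p : ι → Prop) [DecidablePred p] (x : FB ι m) : ‖cut p x‖ ≤ ‖x‖ := by
  rw [pi_norm_le_iff_of_nonneg (norm_nonneg _)]
  intro i
  by_cases h : p i
  · simpa [cut, h] using norm_le_pi_norm x i
  · simp [cut, h]

lemma cut_single (p : ι → Prop) [DecidablePred p] (i : ι) (x : Matrix (m i) (m i) ℂ) :
    cut p (Pi.single i x : FB ι m) = if p i then Pi.single i x else 0 := by
  ext1 k
  by_cases hk : k = i
  · subst hk; by_cases h : p k <;> simp [cut, h]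
  · by_cases h : p i <;> by_cases h' : p k <;> simp [cut, h, h', hk]

lemma cut_eq_single (i : ι) (x : FB ι m) : cut (fun k => k = i) x = Pi.single i (x i) := by
  ext1 k
  by_cases hk : k = i
  · subst hk; simp [cut]
  · simp [cut, hk]

/-- the extended single map -/
def sing (i : ι) : FB ι m →ₗ[ℂ] FB ι m := cut (fun k => k = i)

lemma sing_apply (i : ι) (x : FB ι m) : sing i x = Pi.single i (x i) := cut_eq_single i x

lemma sum_sing (x : FB ι m) : ∑ i, sing i x = x := by
  simp only [sing_apply]; exact Finset.univ_sum_single x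

end Lem1
end NucLocal

namespace NucLocal

lemma nuc_data {n : ℕ} {A : Type*} [CStarAlgebra A] (hA : NuclearDimensionLE n A)
    (S : Finset A) (ε : ℝ) (hε : 0 < ε) : ∃ (ι : Type) (_ : Fintype ι) (_ : DecidableEq ι)
    (m : ι → Type) (_ : ∀ i, Fintype (m i)) (_ : ∀ i, DecidableEq (m i))
    (ψ : A →ₗ[ℂ] FB ι m)
    (φ : Fin (n + 1) → FB ι m →ₗ[ℂ] A),
    IsCompletelyPositive ψ ∧ IsPosElem (1 - ψ 1) ∧
    (∀ j, IsCompletelyPositive (φ j)) ∧ (∀ j, OZ (φ j)) ∧ (∀ j, IsPosElem (1 - φ j 1)) ∧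
    ∀ a ∈ S,
      (∀ j i, ‖φ j (Pi.single i (ψ a i)) - φ j (Pi.single i (ψ 1 i)) * a‖ ≤ ε) ∧
      (∀ j i, ‖φ j (Pi.single i (ψ a i)) - a * φ j (Pi.single i (ψ 1 i))‖ ≤ ε) ∧
      ‖∑ j, φ j (ψ a) - a‖ ≤ ε := by
  classical
  letI := CStarAlgebra.spectralOrder A
  haveI := CStarAlgebra.spectralOrderedRing A
  set M : ℝ := ∑ a ∈ S, ‖a‖ with hM
  have hM0 : 0 ≤ M := Finset.sum_nonneg fun a _ => norm_nonneg a
  have hMa : ∀ a ∈ S, ‖a‖ ≤ M := fun a ha =>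
    Finset.single_le_sum (f := fun a : A => ‖a‖) (fun a _ => norm_nonneg a) ha
  set ε' : ℝ := min ε ((ε / (M + 1)) ^ 2) with hε'
  have hε'0 : 0 < ε' := lt_min hε (by positivity)
  have hε'2 : ε' * (M + 1) ^ 2 ≤ ε ^ 2 := by
    calc ε' * (M + 1) ^ 2 ≤ (ε / (M + 1)) ^ 2 * (M + 1) ^ 2 := by
          gcongr; exact min_le_right _ _
      _ = ε ^ 2 := by field_simp
  set S' : Finset A := {1} ∪ S ∪ S.image star ∪ S.image (fun a => star a * a) ∪
    S.image (fun a => a * star a) with hS'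
  obtain ⟨s, r, J, ψ, φ, hψ, hφ, hψn, hφj, happ⟩ := hA S' ε' hε'0
  have hd : IsPosElem (ψ 1) := cp_pos hψ ⟨1, by simp⟩
  have hd1 : IsPosElem (1 - ψ 1) := pos_one_sub hd ((hψn 1).trans (norm_one_le' A))
  let P : Fin (n + 1) → FDBlock s r →ₗ[ℂ] FDBlock s r := fun j => cut (fun i => J i = j)
  have hPmem : ∀ j x, P j x ∈ blockSupp J j := by
    intro j x i hi
    simp [P, cut, hi]
  have hφ1 : ∀ j, φ (P j 1) ≤ 1 := by
    intro j
    have hp : IsPosElem (φ (P j 1)) := cp_pos hφ (cp_pos (cut_cp _) ⟨1, by simp⟩)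
    rw [pos_iff] at hp
    rw [← CStarAlgebra.norm_le_one_iff_of_nonneg _ hp]
    exact ((hφj j).1 _ (hPmem j 1)).trans ((cut_norm _ _).trans (norm_one_le' _))
  have hsum : ∀ x, ∑ j, φ (P j x) = φ x := by
    intro x
    rw [← map_sum]
    congr 1
    ext1 i
    simp [P, cut, Finset.sum_apply]
  let T : Fin s → A →ₗ[ℂ] A := fun i => φ ∘ₗ sing i ∘ₗ ψ
  have hT : ∀ i, IsCompletelyPositive (T i) := fun i => cp_comp hφ (cp_comp (cut_cp _) hψ)
  have hTa : ∀ i a, T i a = φ (Pi.single i (ψ a i)) := fun i a => by simp [T, sing_apply]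
  have hT1 : ∀ i, T i 1 ≤ 1 := by
    intro i
    refine le_trans ?_ (hφ1 (J i))
    have : IsPosElem (P (J i) 1 - Pi.single i (ψ 1 i)) := by
      obtain ⟨y, hy⟩ := hd1
      refine ⟨cut (fun k => J k = J i) (1 - Pi.single i 1) + Pi.single i (y i), ?_⟩
      have hy' := congrFun hy i
      ext1 k
      by_cases hk : k = i
      · subst hk
        simpa [P, cut] using hy'
      · by_cases hJ : J k = J i <;> simp [P, cut, hk, hJ]
    have := cp_pos hφ this
    rw [pos_iff, map_sub, sub_nonneg] at this
    rwa [hTa]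
  have hTs : ∀ a, ∑ i, T i a = φ (ψ a) := by
    intro a
    simp only [T, LinearMap.comp_apply, ← map_sum, sum_sing]
  have happ' : ∀ a ∈ S', ‖∑ i, T i a - a‖ ≤ ε' := fun a ha => by
    rw [hTs]; exact (happ a ha).le
  have hmem : ∀ a ∈ S, (1 : A) ∈ S' ∧ a ∈ S' ∧ star a ∈ S' ∧ star a * a ∈ S' ∧ a * star a ∈ S' := by
    intro a ha
    refine ⟨by simp [hS'], by simp [hS', ha], ?_, ?_, ?_⟩ <;> simp only [hS', Finset.mem_union]
    · exact Or.inl (Or.inl (Or.inr (Finset.mem_image_of_mem _ ha)))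
    · exact Or.inl (Or.inr (Finset.mem_image_of_mem _ ha))
    · exact Or.inr (Finset.mem_image_of_mem (fun a => a * star a) ha)
  have k1 : ∀ a ∈ S, ∀ i, ‖T i a - T i 1 * a‖ ≤ ε := by
    intro a ha i
    obtain ⟨m1, m2, m3, m4, m5⟩ := hmem a ha
    have := mult_dom T hT hT1 a (happ' _ m1) (happ' _ m2) (happ' _ m3) (happ' _ m4) i
    rw [norm_sub_rev]
    refine (sq_le_sq₀ (norm_nonneg _) hε.le).1 (this.trans (le_trans ?_ hε'2))
    have := hMa a ha
    gcongr
  have k2 : ∀ a ∈ S, ∀ i, ‖T i a - a * T i 1‖ ≤ ε := by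
    intro a ha i
    obtain ⟨m1, m2, m3, m4, m5⟩ := hmem a ha
    have := mult_dom T hT hT1 (star a) (happ' _ m1) (happ' _ m3)
      (by simpa using happ' _ m2) (by simpa using happ' _ m5) i
    have e : ‖T i a - a * T i 1‖ = ‖T i 1 * star a - T i (star a)‖ := by
      rw [← norm_star, star_sub, star_mul, ← cp_star (hT i), ← cp_star (hT i), star_one,
        norm_sub_rev]
    rw [e]
    refine (sq_le_sq₀ (norm_nonneg _) hε.le).1 (this.trans (le_trans ?_ hε'2))
    have := hMa a ha
    rw [norm_star]
    gcongr
  refine ⟨Fin s, inferInstance, inferInstance, fun i => Fin (r i), inferInstance, inferInstance,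
    ψ, fun j => φ ∘ₗ P j, hψ, hd1, fun j => cp_comp hφ (cut_cp _), ?_, ?_, ?_⟩
  · intro j x y hxy hyx
    refine ((hφj j).2 _ (hPmem j x) _ (hPmem j y) ?_ ?_).1
    · rw [← cut_mul, hxy, map_zero]
    · rw [← cut_mul, hyx, map_zero]
  · intro j
    rw [pos_iff, sub_nonneg]
    exact hφ1 j
  · intro a ha
    have hP : ∀ j i (x : Matrix (Fin (r i)) (Fin (r i)) ℂ), P j (Pi.single i x) =
      if J i = j then Pi.single i x else 0 := fun j i x => cut_single _ _ _
    refine ⟨fun j i => ?_, fun j i => ?_, ?_⟩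
    · simp only [LinearMap.comp_apply, hP]
      by_cases hJ : J i = j
      · simpa only [if_pos hJ, ← hTa] using k1 a ha i
      · simpa [hJ] using hε.le
    · simp only [LinearMap.comp_apply, hP]
      by_cases hJ : J i = j
      · simpa only [if_pos hJ, ← hTa] using k2 a ha i
      · simpa [hJ] using hε.le
    · simp only [LinearMap.comp_apply, hsum]
      exact ((happ a (hmem a ha).2.1).le).trans (min_le_left _ _)

theorem good_of_nuc {n : ℕ} {A : Type*} [CStarAlgebra A] (hA : NuclearDimensionLE n A) :
    Good n A := by
  intro S ε hε
  obtain ⟨ι, i1, i2, m, i3, i4, ψ, φ, hψ, hd, h1, h2, h3, h4⟩ := nuc_data hA S ε hε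
  exact ⟨ι, i1, i2, m, i3, i4, φ, fun _ => ψ 1, fun _ => ψ, h1, h2, h3,
    fun _ => cp_pos hψ ⟨1, by simp⟩, fun _ => hd, h4⟩
end NucLocal

namespace NucLocal

lemma cp_norm_le' {A D : Type*} [CStarAlgebra A] [CStarAlgebra D] {f : D →ₗ[ℂ] A}
    (hf : IsCompletelyPositive f) (h1 : IsPosElem (1 - f 1)) (a : D) : ‖f a‖ ≤ ‖a‖ := by
  letI := CStarAlgebra.spectralOrder A
  haveI := CStarAlgebra.spectralOrderedRing A
  rw [pos_iff, sub_nonneg] at h1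
  exact cp_norm_le hf h1 a

lemma norm_single_le {ι : Type} {m : ι → Type} [Fintype ι] [DecidableEq ι]
    [∀ i, Fintype (m i)] [∀ i, DecidableEq (m i)] (i : ι) (x : FB ι m) :
    ‖(Pi.single i (x i) : FB ι m)‖ ≤ ‖x‖ := by
  rw [← cut_eq_single]; exact cut_norm _ _

theorem good_local {n : ℕ} {A : Type*} [CStarAlgebra A]
    (h : ∀ (S : Finset A) (ε : ℝ), 0 < ε → ∃ (B : Type) (_ : CStarAlgebra B) (_ : Good n B)
      (q : B →⋆ₐ[ℂ] A), ∀ a ∈ S, ∃ b, ‖a - q b‖ < ε) : Good n A := by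
  classical
  intro S ε hε
  obtain ⟨B, _, hB, q, hq⟩ := h S (ε / 2) (by linarith)
  have hq' : ∀ a : A, ∃ b, a ∈ S → ‖a - q b‖ < ε / 2 := by
    intro a
    by_cases ha : a ∈ S
    · obtain ⟨b, hb⟩ := hq a ha
      exact ⟨b, fun _ => hb⟩
    · exact ⟨0, fun h => absurd h ha⟩
  choose b hb using hq'
  obtain ⟨ι, i1, i2, m, i3, i4, φ, d, x, h1, h2, h3, h4, h5, h6⟩ :=
    hB (S.image b) (ε / 2) (by linarith)
  have hqn : ∀ y, ‖q y‖ ≤ ‖y‖ := fun y => NonUnitalStarAlgHom.norm_apply_le q y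
  let Q : B →ₗ[ℂ] A := q.toAlgHom.toLinearMap
  have hQ : ∀ y, Q y = q y := fun y => rfl
  have hQcp : IsCompletelyPositive Q := cp_of_hom Q (fun x y => by simp [hQ]) (fun x => by
    simp only [hQ]; exact map_star q x)
  refine ⟨ι, i1, i2, m, i3, i4, fun j => Q ∘ₗ φ j, d, fun j a => x j (b a),
    fun j => cp_comp hQcp (h1 j), ?_, ?_, h4, h5, ?_⟩
  · intro j u v huv hvu
    simp only [LinearMap.comp_apply, hQ, ← map_mul, h2 j u v huv hvu, map_zero]
  · intro j
    have := cp_pos hQcp (h3 j)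
    simpa [hQ] using this
  · intro a ha
    obtain ⟨k1, k2, k3⟩ := h6 (b a) (Finset.mem_image_of_mem _ ha)
    have hba := (hb a ha).le
    have hdn : ∀ j i, ‖φ j (Pi.single i (d j i))‖ ≤ 1 := fun j i =>
      (cp_norm_le' (h1 j) (h3 j) _).trans ((norm_single_le i _).trans
        (norm_le_one_of_pos (h4 j) (h5 j)))
    refine ⟨fun j i => ?_, fun j i => ?_, ?_⟩
    · simp only [LinearMap.comp_apply, hQ]
      have e : q (φ j (Pi.single i (x j (b a) i))) - q (φ j (Pi.single i (d j i))) * a =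
        q (φ j (Pi.single i (x j (b a) i)) - φ j (Pi.single i (d j i)) * b a)
        - q (φ j (Pi.single i (d j i))) * (a - q (b a)) := by
        rw [map_sub, map_mul]; noncomm_ring
      rw [e]
      refine (norm_sub_le _ _).trans ?_
      have := norm_mul_le (q (φ j (Pi.single i (d j i)))) (a - q (b a))
      have h7 : ‖q (φ j (Pi.single i (d j i)))‖ * ‖a - q (b a)‖ ≤ 1 * (ε / 2) := by
        gcongr
        exact (hqn _).trans (hdn j i)
      have := (hqn _).trans (k1 j i)
      linarith
    · simp only [LinearMap.comp_apply, hQ]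
      have e : q (φ j (Pi.single i (x j (b a) i))) - a * q (φ j (Pi.single i (d j i))) =
        q (φ j (Pi.single i (x j (b a) i)) - b a * φ j (Pi.single i (d j i)))
        - (a - q (b a)) * q (φ j (Pi.single i (d j i))) := by
        rw [map_sub, map_mul]; noncomm_ring
      rw [e]
      refine (norm_sub_le _ _).trans ?_
      have := norm_mul_le (a - q (b a)) (q (φ j (Pi.single i (d j i))))
      have h7 : ‖a - q (b a)‖ * ‖q (φ j (Pi.single i (d j i)))‖ ≤ (ε / 2) * 1 := by
        gcongr
        exact (hqn _).trans (hdn j i)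
      have := (hqn _).trans (k2 j i)
      linarith
    · simp only [LinearMap.comp_apply, hQ]
      have e : ∑ j, q (φ j (x j (b a))) - a = q (∑ j, φ j (x j (b a)) - b a) - (a - q (b a)) := by
        rw [map_sub, map_sum]; noncomm_ring
      rw [e]
      refine (norm_sub_le _ _).trans ?_
      have := (hqn _).trans k3
      linarith

theorem good_iso {n : ℕ} {A : Type*} {B : Type} [CStarAlgebra A] [CStarAlgebra B] (hB : Good n B)
    (q : B ≃⋆ₐ[ℂ] A) : Good n A := by
  refine good_local fun S ε hε => ⟨B, inferInstance, hB, (q : B →⋆ₐ[ℂ] A), fun a _ =>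
    ⟨q.symm a, by simpa using hε⟩⟩

section Sum
variable {A₁ A₂ : Type*} [CStarAlgebra A₁] [CStarAlgebra A₂]

lemma pos_prod {R R' : Type*} [Mul R] [Star R] [Mul R'] [Star R'] {a : R} {b : R'}
    (ha : IsPosElem a) (hb : IsPosElem b) : IsPosElem (a, b) := by
  obtain ⟨y, rfl⟩ := ha
  obtain ⟨z, rfl⟩ := hb
  exact ⟨(y, z), rfl⟩

lemma cp_prod {D : Type*} [Ring D] [StarRing D] [Module ℂ D] {f : D →ₗ[ℂ] A₁} {g : D →ₗ[ℂ] A₂}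
    (hf : IsCompletelyPositive f) (hg : IsCompletelyPositive g) :
    IsCompletelyPositive (f.prod g) := by
  intro k x hx
  obtain ⟨y, hy⟩ := hf k x hx
  obtain ⟨z, hz⟩ := hg k x hx
  refine ⟨Matrix.of fun i j => (y i j, z i j), ?_⟩
  ext i j
  · have := congrFun (congrFun hy i) j
    simpa [Matrix.mul_apply, Matrix.star_apply, Prod.fst_sum] using this
  · have := congrFun (congrFun hz i) j
    simpa [Matrix.mul_apply, Matrix.star_apply, Prod.snd_sum] using this

theorem good_prod {n : ℕ} (hA₁ : Good n A₁) (hA₂ : Good n A₂) : Good n (A₁ × A₂) := by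
  classical
  intro S ε hε
  obtain ⟨ι, i1, i2, m, i3, i4, φ, d, x, h1, h2, h3, h4, h5, h6⟩ :=
    hA₁ (S.image Prod.fst) ε hε
  obtain ⟨ι', i1', i2', m', i3', i4', φ', d', x', h1', h2', h3', h4', h5', h6'⟩ :=
    hA₂ (S.image Prod.snd) ε hε
  let M : ι ⊕ ι' → Type := Sum.elim m m'
  letI I3 : ∀ i, Fintype (M i) := fun i => Sum.rec (motive := fun i => Fintype (M i)) i3 i3' i
  letI I4 : ∀ i, DecidableEq (M i) := fun i =>
    Sum.rec (motive := fun i => DecidableEq (M i)) i4 i4' i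
  let pl : FB (ι ⊕ ι') M →ₗ[ℂ] FB ι m :=
    { toFun := fun y i => y (Sum.inl i), map_add' := fun _ _ => rfl, map_smul' := fun _ _ => rfl }
  let pr : FB (ι ⊕ ι') M →ₗ[ℂ] FB ι' m' :=
    { toFun := fun y i => y (Sum.inr i), map_add' := fun _ _ => rfl, map_smul' := fun _ _ => rfl }
  let pair : FB ι m → FB ι' m' → FB (ι ⊕ ι') M := fun u v i =>
    Sum.rec (motive := fun i => Matrix (M i) (M i) ℂ) u v i
  have plm : ∀ u v, pl (u * v) = pl u * pl v := fun u v => rfl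
  have prm : ∀ u v, pr (u * v) = pr u * pr v := fun u v => rfl
  have pll : ∀ i u v, pl (Pi.single (Sum.inl i) (pair u v (Sum.inl i))) = Pi.single i (u i) := by
    intro i u v
    funext k
    change (Pi.single (Sum.inl i) (pair u v (Sum.inl i)) : FB (ι ⊕ ι') M) (Sum.inl k) = _
    by_cases hk : k = i
    · subst hk; rw [Pi.single_eq_same, Pi.single_eq_same]
    · rw [Pi.single_eq_of_ne hk, Pi.single_eq_of_ne (by simpa using hk)]; rfl
  have prr : ∀ i u v, pr (Pi.single (Sum.inr i) (pair u v (Sum.inr i))) = Pi.single i (v i) := by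
    intro i u v
    funext k
    change (Pi.single (Sum.inr i) (pair u v (Sum.inr i)) : FB (ι ⊕ ι') M) (Sum.inr k) = _
    by_cases hk : k = i
    · subst hk; rw [Pi.single_eq_same, Pi.single_eq_same]
    · rw [Pi.single_eq_of_ne hk, Pi.single_eq_of_ne (by simpa using hk)]; rfl
  have plr : ∀ i u v, pl (Pi.single (Sum.inr i) (pair u v (Sum.inr i))) = 0 := by
    intro i u v
    funext k
    change (Pi.single (Sum.inr i) (pair u v (Sum.inr i)) : FB (ι ⊕ ι') M) (Sum.inl k) = _
    rw [Pi.single_eq_of_ne (by simp)]; rfl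
  have prl : ∀ i u v, pr (Pi.single (Sum.inl i) (pair u v (Sum.inl i))) = 0 := by
    intro i u v
    funext k
    change (Pi.single (Sum.inl i) (pair u v (Sum.inl i)) : FB (ι ⊕ ι') M) (Sum.inr k) = _
    rw [Pi.single_eq_of_ne (by simp)]; rfl
  have pos_pair : ∀ u v, IsPosElem u → IsPosElem v → IsPosElem (pair u v) := by
    rintro u v ⟨y, rfl⟩ ⟨z, rfl⟩
    refine ⟨pair y z, ?_⟩
    funext i
    rcases i with i | i <;> rfl
  refine ⟨ι ⊕ ι', inferInstance, inferInstance, M, I3, I4,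
    fun j => (φ j ∘ₗ pl).prod (φ' j ∘ₗ pr), fun j => pair (d j) (d' j),
    fun j a => pair (x j a.1) (x' j a.2), ?_, ?_, ?_, ?_, ?_, ?_⟩
  · intro j
    exact cp_prod (cp_comp (h1 j) (cp_of_hom _ plm fun u => rfl))
      (cp_comp (h1' j) (cp_of_hom _ prm fun u => rfl))
  · intro j u v huv hvu
    ext
    · simp only [LinearMap.prod_apply, Function.prod, LinearMap.comp_apply, Prod.fst_mul, Prod.fst_zero]
      apply h2 j
      · rw [← plm, huv, map_zero]
      · rw [← plm, hvu, map_zero]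
    · simp only [LinearMap.prod_apply, Function.prod, LinearMap.comp_apply, Prod.snd_mul, Prod.snd_zero]
      apply h2' j
      · rw [← prm, huv, map_zero]
      · rw [← prm, hvu, map_zero]
  · intro j
    exact pos_prod (h3 j) (h3' j)
  · intro j; exact pos_pair _ _ (h4 j) (h4' j)
  · intro j
    have := pos_pair _ _ (h5 j) (h5' j)
    convert this using 1
    funext i
    rcases i with i | i <;> rfl
  · intro a ha
    obtain ⟨k1, k2, k3⟩ := h6 a.1 (Finset.mem_image_of_mem _ ha)
    obtain ⟨k1', k2', k3'⟩ := h6' a.2 (Finset.mem_image_of_mem _ ha)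
    refine ⟨?_, ?_, ?_⟩
    · intro j i
      rcases i with i | i
      · rw [Prod.norm_def]
        refine max_le ?_ ?_
        · change ‖φ j (pl (Pi.single _ _)) - φ j (pl (Pi.single _ _)) * a.1‖ ≤ ε; rw [pll i (x j a.1) (x' j a.2), pll i (d j) (d' j)]
          exact k1 j i
        · change ‖φ' j (pr (Pi.single _ _)) - φ' j (pr (Pi.single _ _)) * a.2‖ ≤ ε; rw [prl i (x j a.1) (x' j a.2), prl i (d j) (d' j)]
          simpa using hε.le
      · rw [Prod.norm_def]
        refine max_le ?_ ?_
        · change ‖φ j (pl (Pi.single _ _)) - φ j (pl (Pi.single _ _)) * a.1‖ ≤ ε; rw [plr i (x j a.1) (x' j a.2), plr i (d j) (d' j)]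
          simpa using hε.le
        · change ‖φ' j (pr (Pi.single _ _)) - φ' j (pr (Pi.single _ _)) * a.2‖ ≤ ε; rw [prr i (x j a.1) (x' j a.2), prr i (d j) (d' j)]
          exact k1' j i
    · intro j i
      rcases i with i | i
      · rw [Prod.norm_def]
        refine max_le ?_ ?_
        · change ‖φ j (pl (Pi.single _ _)) - a.1 * φ j (pl (Pi.single _ _))‖ ≤ ε; rw [pll i (x j a.1) (x' j a.2), pll i (d j) (d' j)]
          exact k2 j i
        · change ‖φ' j (pr (Pi.single _ _)) - a.2 * φ' j (pr (Pi.single _ _))‖ ≤ ε; rw [prl i (x j a.1) (x' j a.2), prl i (d j) (d' j)]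
          simpa using hε.le
      · rw [Prod.norm_def]
        refine max_le ?_ ?_
        · change ‖φ j (pl (Pi.single _ _)) - a.1 * φ j (pl (Pi.single _ _))‖ ≤ ε; rw [plr i (x j a.1) (x' j a.2), plr i (d j) (d' j)]
          simpa using hε.le
        · change ‖φ' j (pr (Pi.single _ _)) - a.2 * φ' j (pr (Pi.single _ _))‖ ≤ ε; rw [prr i (x j a.1) (x' j a.2), prr i (d j) (d' j)]
          exact k2' j i
    · rw [Prod.norm_def]
      simp only [LinearMap.prod_apply, Function.prod, LinearMap.comp_apply, Prod.fst_sub, Prod.snd_sub,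
        Prod.fst_sum, Prod.snd_sum]
      exact max_le k3 k3'

end Sum
end NucLocal

namespace NucLocal

section MatrixClosure
open CStarMatrix WithCStarModule in
lemma cmat_norm_le {A κ : Type*} [Fintype κ] [CStarAlgebra A] [PartialOrder A] [StarOrderedRing A]
    (M : CStarMatrix κ κ A) : ‖M‖ ≤ ∑ j, ∑ i, ‖M i j‖ := by
  rw [norm_def]
  refine (toCLM M).opNorm_le_bound (by positivity) fun v => ?_
  simp only [toCLM_apply_eq_sum, Finset.sum_mul]
  apply pi_norm_le_sum_norm _ |>.trans
  gcongr with i _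
  apply norm_sum_le _ _ |>.trans
  gcongr with j _
  apply norm_mul_le _ _ |>.trans
  rw [mul_comm]
  gcongr
  exact norm_apply_le_norm v j

lemma cmat_norm_le_of {A κ : Type*} [Fintype κ] [CStarAlgebra A] [PartialOrder A]
    [StarOrderedRing A] (M : CStarMatrix κ κ A) {ε : ℝ} (hε : 0 < ε)
    (h : ∀ i j, ‖M i j‖ ≤ ε / ((Fintype.card κ : ℝ) ^ 2 + 1)) : ‖M‖ ≤ ε := by
  refine (cmat_norm_le M).trans ?_
  calc ∑ j, ∑ i, ‖M i j‖ ≤ ∑ j : κ, ∑ i : κ, ε / ((Fintype.card κ : ℝ) ^ 2 + 1) :=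
        Finset.sum_le_sum fun j _ => Finset.sum_le_sum fun i _ => h i j
    _ = (Fintype.card κ : ℝ) ^ 2 * (ε / ((Fintype.card κ : ℝ) ^ 2 + 1)) := by
        simp; ring
    _ ≤ ε := by
        rw [← mul_div_assoc, div_le_iff₀ (by positivity)]
        nlinarith

variable {ι κ : Type} {m : ι → Type} [Fintype ι] [DecidableEq ι] [∀ i, Fintype (m i)]
  [∀ i, DecidableEq (m i)] [Fintype κ] [DecidableEq κ]

def slice (s t : κ) : FB ι (fun i => m i × κ) →ₗ[ℂ] FB ι m where
  toFun X := fun i => Matrix.of fun p q => X i (p, s) (q, t)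
  map_add' _ _ := rfl
  map_smul' _ _ := rfl

lemma slice_apply (s t : κ) (X : FB ι (fun i => m i × κ)) (i) (p q) :
    slice s t X i p q = X i (p, s) (q, t) := rfl

lemma slice_mul (s t : κ) (X Y : FB ι (fun i => m i × κ)) :
    slice s t (X * Y) = ∑ w, slice s w X * slice w t Y := by
  funext i
  ext p q
  simp only [slice_apply, Pi.mul_apply, Matrix.mul_apply, Finset.sum_apply, Matrix.sum_apply,
    Fintype.sum_prod_type]
  rw [Finset.sum_comm]

lemma slice_star (s t : κ) (X : FB ι (fun i => m i × κ)) :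
    slice s t (star X) = star (slice t s X) := rfl

lemma slice_one (s t : κ) :
    slice s t (1 : FB ι (fun i => m i × κ)) = if s = t then 1 else 0 := by
  funext i
  ext p q
  by_cases h : s = t <;> by_cases h' : p = q <;> simp [slice_apply, Matrix.one_apply, h, h']

def amp (d : FB ι m) : FB ι (fun i => m i × κ) :=
  fun i => Matrix.of fun p q => if p.2 = q.2 then d i p.1 q.1 else 0

lemma slice_ext {X Y : FB ι (fun i => m i × κ)} (h : ∀ s t, slice s t X = slice s t Y) : X = Y := by
  funext i
  ext ⟨p, s⟩ ⟨q, t⟩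
  exact congrFun (congrFun (congrFun (h s t) i) p) q

lemma slice_amp (s t : κ) (d : FB ι m) : slice s t (amp d) = if s = t then d else 0 := by
  funext i
  ext p q
  by_cases h : s = t <;> simp [slice_apply, amp, h]

lemma pos_amp {d : FB ι m} (h : IsPosElem d) : IsPosElem (amp d : FB ι (fun i => m i × κ)) := by
  obtain ⟨y, rfl⟩ := h
  refine ⟨amp y, slice_ext fun s t => ?_⟩
  rw [slice_mul]
  simp only [slice_star, slice_amp]
  by_cases h : s = t
  · subst h; simp [Finset.sum_ite_eq', apply_ite star, ite_mul]
  · simp [apply_ite star, ite_mul, h, Ne.symm h]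

lemma slice_single (s t : κ) (i : ι) (X : FB ι (fun i => m i × κ)) :
    slice s t (Pi.single i (X i)) = Pi.single i (slice s t X i) := by
  funext k
  ext p q
  by_cases h : k = i
  · subst h; simp [slice_apply]
  · simp [slice_apply, Pi.single_eq_of_ne h]

variable {B : Type*} [CStarAlgebra B]

lemma csum_apply {κ' : Type*} {r : Finset κ'} (f : κ' → CStarMatrix κ κ B) (s t : κ) :
    (∑ a ∈ r, f a) s t = ∑ a ∈ r, f a s t := by
  classical
  induction r using Finset.induction_on with
  | empty => simp
  | insert a r ha ih => rw [Finset.sum_insert ha, Finset.sum_insert ha, CStarMatrix.add_apply, ih]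

def matMap (φ : FB ι m →ₗ[ℂ] B) : FB ι (fun i => m i × κ) →ₗ[ℂ] CStarMatrix κ κ B where
  toFun X := CStarMatrix.ofMatrix (Matrix.of fun s t => φ (slice s t X))
  map_add' X Y := by ext s t; simp
  map_smul' c X := by ext s t; simp

lemma matMap_apply (φ : FB ι m →ₗ[ℂ] B) (X : FB ι (fun i => m i × κ)) (s t : κ) :
    matMap φ X s t = φ (slice s t X) := rfl

lemma matMap_cp {φ : FB ι m →ₗ[ℂ] B} (h : IsCompletelyPositive φ) :
    IsCompletelyPositive (matMap (κ := κ) φ) := by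
  rintro k x ⟨y, rfl⟩
  obtain ⟨W, hW⟩ := cp_fintype h (κ := Fin k × κ)
    (pos_star_mul (Matrix.of fun a b : Fin k × κ => slice a.2 b.2 (y a.1 b.1)))
  refine ⟨Matrix.of fun r q => CStarMatrix.ofMatrix (Matrix.of fun w t => W (r, w) (q, t)), ?_⟩
  ext1 p q
  refine CStarMatrix.ext fun s t => ?_
  have := congrFun (congrFun hW (p, s)) (q, t)
  simp only [Matrix.map_apply, Matrix.mul_apply, Matrix.star_apply, Fintype.sum_prod_type,
    Matrix.of_apply] at this ⊢
  rw [csum_apply, matMap_apply, map_sum]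
  simp only [slice_mul, slice_star]
  rw [this]
  rfl

lemma matMap_oz {φ : FB ι m →ₗ[ℂ] B} (h : IsCompletelyPositive φ) (h0 : OZ φ) :
    OZ (matMap (κ := κ) φ) := by
  intro u v huv hvu
  refine CStarMatrix.ext fun s t => ?_
  rw [CStarMatrix.mul_apply]
  simp only [matMap_apply]
  rw [Finset.sum_congr rfl fun w _ => oz_mul h h0 _ _, ← Finset.mul_sum, ← map_sum, ← slice_mul, huv]
  simp

theorem good_matrix [PartialOrder B] [StarOrderedRing B] {n : ℕ} (hB : Good n B) :
    Good n (CStarMatrix κ κ B) := by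
  classical
  intro S ε hε
  set ε' := ε / ((Fintype.card κ : ℝ) ^ 2 + 1) with hε'
  have hε0 : 0 < ε' := by positivity
  obtain ⟨ι, i1, i2, m, i3, i4, φ, d, x, h1, h2, h3, h4, h5, h6⟩ :=
    hB (S.biUnion fun a => Finset.univ.image fun st : κ × κ => a st.1 st.2) ε' hε0
  have h7 : ∀ a ∈ S, ∀ s t, a s t ∈ (S.biUnion fun a => Finset.univ.image
      fun st : κ × κ => a st.1 st.2) := by
    intro a ha s t
    simp only [Finset.mem_biUnion, Finset.mem_image]
    exact ⟨a, ha, (s, t), Finset.mem_univ _, rfl⟩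
  let x' : Fin (n + 1) → CStarMatrix κ κ B → FB ι (fun i => m i × κ) := fun j a i =>
    Matrix.of fun p q => x j (a p.2 q.2) i p.1 q.1
  have hx' : ∀ j a s t, slice s t (x' j a) = x j (a s t) := fun j a s t => rfl
  refine ⟨ι, i1, i2, fun i => m i × κ, inferInstance, inferInstance, fun j => matMap (φ j),
    fun j => amp (d j), x', fun j => matMap_cp (h1 j), fun j => matMap_oz (h1 j) (h2 j), ?_,
    fun j => pos_amp (h4 j), ?_, ?_⟩
  · intro j
    obtain ⟨y, hy⟩ := h3 j
    refine ⟨CStarMatrix.ofMatrix (Matrix.diagonal fun _ => y), ?_⟩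
    refine CStarMatrix.ext fun s t => ?_
    rw [CStarMatrix.mul_apply, CStarMatrix.sub_apply, matMap_apply, slice_one, CStarMatrix.one_apply]
    by_cases h : s = t
    · subst h
      simp [CStarMatrix.star_apply, Matrix.diagonal_apply, hy, apply_ite star, ite_mul]
    · simp [CStarMatrix.star_apply, Matrix.diagonal_apply, h, Ne.symm h, apply_ite star, ite_mul]
  · intro j
    have := pos_amp (κ := κ) (h5 j)
    convert this using 1
    refine slice_ext fun s t => ?_
    rw [map_sub, slice_one, slice_amp, slice_amp]
    split_ifs <;> simp
  · intro a ha
    refine ⟨fun j i => ?_, fun j i => ?_, ?_⟩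
    · refine cmat_norm_le_of _ hε fun s t => ?_
      rw [CStarMatrix.sub_apply, CStarMatrix.mul_apply]
      simp only [matMap_apply, slice_single, hx', slice_amp]
      rw [Finset.sum_eq_single s (by intro b _ hb; simp [Ne.symm hb]) (by simp)]
      simpa using (h6 _ (h7 a ha s t)).1 j i
    · refine cmat_norm_le_of _ hε fun s t => ?_
      rw [CStarMatrix.sub_apply, CStarMatrix.mul_apply]
      simp only [matMap_apply, slice_single, hx', slice_amp]
      rw [Finset.sum_eq_single t (by intro b _ hb; simp [hb]) (by simp)]
      simpa using (h6 _ (h7 a ha s t)).2.1 j i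
    · refine cmat_norm_le_of _ hε fun s t => ?_
      rw [CStarMatrix.sub_apply, csum_apply]
      simp only [matMap_apply, hx']
      exact (h6 _ (h7 a ha s t)).2.2

end MatrixClosure

end NucLocal

namespace NucLocal

section State
variable {A : Type*} [CStarAlgebra A]

lemma norm_one_add [PartialOrder A] [StarOrderedRing A] [Nontrivial A] {H : A} (hH : 0 ≤ H) :
    ‖1 + H‖ = 1 + ‖H‖ := by
  apply le_antisymm
  · exact (norm_add_le _ _).trans (by simp)
  · have h0 : (0 : A) ≤ 1 + H := add_nonneg zero_le_one hH
    have h1 : 1 ≤ ‖1 + H‖ := by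
      have := CStarAlgebra.norm_le_norm_of_nonneg_of_le (zero_le_one (α := A))
        (le_add_of_nonneg_right hH)
      simpa using this
    have h2 : 1 + H ≤ algebraMap ℝ A ‖1 + H‖ :=
      (CStarAlgebra.norm_le_iff_le_algebraMap (1 + H) (norm_nonneg _) h0).1 le_rfl
    have h3 : ‖H‖ ≤ ‖1 + H‖ - 1 := by
      rw [CStarAlgebra.norm_le_iff_le_algebraMap H (by linarith) hH, map_sub, map_one]
      exact le_sub_iff_add_le'.2 h2
    linarith

lemma exists_state {H : A} (hH : IsPosElem H) (h0 : H ≠ 0) :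
    ∃ ω : A →ₗ[ℂ] ℂ, (∀ a, 0 ≤ ω (star a * a)) ∧ ω 1 = 1 ∧
      (∀ y, ω (H * y) = ‖H‖ * ω y) ∧ ∀ y, ω (y * H) = ‖H‖ * ω y := by
  letI := CStarAlgebra.spectralOrder A
  haveI := CStarAlgebra.spectralOrderedRing A
  haveI : Nontrivial A := ⟨H, 0, h0⟩
  rw [pos_iff] at hH
  have hn := norm_one_add hH
  obtain ⟨g, g1, g2⟩ := exists_dual_vector ℂ (1 + H) (by rw [hn]; positivity)
  have gle : ∀ a, ‖g a‖ ≤ ‖a‖ := fun a => by simpa [g1] using g.le_opNorm a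
  have e1 : (g 1).re + (g H).re = 1 + ‖H‖ := by
    have := congrArg Complex.re g2
    rw [map_add, hn] at this
    simpa using this
  have b1 : ‖g 1‖ ≤ 1 := by simpa using gle 1
  have r1 : (g 1).re = 1 := by
    have := (Complex.re_le_norm (g 1)).trans b1
    have := (Complex.re_le_norm (g H)).trans (gle H)
    linarith
  have g11 : g 1 = 1 := by
    have h := Complex.sq_norm (g 1)
    rw [Complex.normSq_apply, r1] at h
    have h3 : ‖g 1‖ ^ 2 ≤ 1 := by nlinarith [norm_nonneg (g 1)]
    have h2 : (g 1).im = 0 := by nlinarith [sq_nonneg (g 1).im]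
    exact Complex.ext (by simpa using r1) (by simpa using h2)
  have gH : g H = ‖H‖ := by
    have g2' : g (1 + H) = ((1 + ‖H‖ : ℝ) : ℂ) := by rw [g2, hn]; rfl
    rw [map_add, g11] at g2'
    have : g H = ((1 + ‖H‖ : ℝ) : ℂ) - 1 := by rw [← g2']; ring
    rw [this]; push_cast; ring
  have him : ∀ a : A, IsSelfAdjoint a → (g a).im = 0 := by
    intro a ha
    by_contra hne
    have key : ∀ t : ℝ, ((g a).im + t) ^ 2 ≤ ‖a‖ ^ 2 + t ^ 2 := by
      intro t
      have h1 : ‖a + (t * Complex.I : ℂ) • (1 : A)‖ ^ 2 ≤ ‖a‖ ^ 2 + t ^ 2 := by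
        rw [sq, ← CStarRing.norm_star_mul_self]
        have : star (a + (t * Complex.I : ℂ) • (1 : A)) * (a + (t * Complex.I : ℂ) • (1 : A))
            = a * a + ((t ^ 2 : ℝ) : ℂ) • (1 : A) := by
          have hst : star (t * Complex.I : ℂ) = - (t * Complex.I) := by simp
          simp only [star_add, star_smul, star_one, ha.star_eq, hst, add_mul, mul_add,
            smul_mul_assoc, mul_smul_comm, one_mul, mul_one, smul_smul, neg_smul, neg_mul, smul_add, smul_neg]
          have : ((t ^ 2 : ℝ) : ℂ) = - ((t * Complex.I) * (t * Complex.I) : ℂ) := by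
            push_cast; ring_nf; simp
          rw [this, neg_smul]
          abel
        rw [this]
        refine (norm_add_le _ _).trans ?_
        gcongr
        · rw [sq]; exact norm_mul_le _ _
        · rw [norm_smul]; simp
      have h2 := gle (a + (t * Complex.I : ℂ) • (1 : A))
      rw [map_add, map_smul, g11] at h2
      have h3 := (Complex.abs_im_le_norm (g a + (t * Complex.I : ℂ) • (1 : ℂ))).trans h2
      have h4 : (g a + (t * Complex.I : ℂ) • (1 : ℂ)).im = (g a).im + t := by simp
      rw [h4] at h3
      have := pow_le_pow_left₀ (abs_nonneg _) h3 2
      rw [sq_abs] at this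
      linarith
    have := key ((‖a‖ ^ 2 + 1) / (2 * (g a).im))
    have h5 : 2 * (g a).im * ((‖a‖ ^ 2 + 1) / (2 * (g a).im)) = ‖a‖ ^ 2 + 1 := by
      field_simp
    nlinarith [sq_nonneg (g a).im]
  have hpos : ∀ a : A, 0 ≤ a → 0 ≤ g a := by
    intro a ha
    have h1 : 0 ≤ algebraMap ℝ A ‖a‖ - a := sub_nonneg.2
      ((CStarAlgebra.norm_le_iff_le_algebraMap a (norm_nonneg _) ha).1 le_rfl)
    have h2 : ‖algebraMap ℝ A ‖a‖ - a‖ ≤ ‖a‖ :=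
      (CStarAlgebra.norm_le_iff_le_algebraMap _ (norm_nonneg _) h1).2 (sub_le_self _ ha)
    have h3 : algebraMap ℝ A ‖a‖ = ((‖a‖ : ℝ) : ℂ) • (1 : A) := by
      rw [Algebra.algebraMap_eq_smul_one]; exact (Complex.coe_smul _ _).symm
    have h4 := (gle _).trans h2
    rw [h3, map_sub, map_smul, g11] at h4
    have h5 := (Complex.re_le_norm _).trans h4
    simp at h5
    rw [Complex.nonneg_iff]
    exact ⟨h5, (him a (IsSelfAdjoint.of_nonneg ha)).symm⟩
  have hps : ∀ a, 0 ≤ g (star a * a) := fun a => hpos _ (star_mul_self_nonneg a)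
  have hstar : ∀ a, g (star a) = star (g a) := by
    intro a
    have h1 : (g (star a + a)).im = 0 := him _ (IsSelfAdjoint.star_add_self a)
    have h2 : (g (Complex.I • (star a - a))).im = 0 := him _ (by
      rw [IsSelfAdjoint, star_smul, star_sub, star_star]; simp [smul_sub]; abel)
    rw [map_add] at h1
    rw [map_smul, map_sub] at h2
    simp at h1 h2
    refine Complex.ext ?_ ?_
    · simp; linarith
    · simp; linarith
  have hHs : star H = H := (IsSelfAdjoint.of_nonneg hH).star_eq
  have kill : ∀ b y, g (star b * b) = 0 → g (star b * y) = 0 := by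
    intro b y hb
    by_contra hne
    set w := g (star b * y) with hw
    have key : ∀ s : ℝ, 2 * s * ‖w‖ ^ 2 ≤ (g (star y * y)).re := by
      intro s
      have h1 := hps (y - ((s : ℂ) * w) • b)
      have h2 : g (star (y - ((s : ℂ) * w) • b) * (y - ((s : ℂ) * w) • b)) =
          g (star y * y) - ((s : ℂ) * w) * star w - star ((s : ℂ) * w) * w := by
        have h3 : g (star y * b) = star w := by rw [hw, ← hstar]; simp
        simp only [star_sub, star_smul, sub_mul, mul_sub, smul_mul_assoc, mul_smul_comm, map_sub,
          map_smul, hb, ← hw, h3]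
        simp
        ring
      rw [h2] at h1
      have h3 := (Complex.nonneg_iff.1 h1).1
      have h4 : ‖w‖ ^ 2 = w.re * w.re + w.im * w.im := by
        rw [Complex.sq_norm, Complex.normSq_apply]
      simp at h3
      rw [h4]; nlinarith
    have h5 : 0 < ‖w‖ ^ 2 := by have := norm_pos_iff.2 hne; positivity
    have := key (((g (star y * y)).re + 1) / (2 * ‖w‖ ^ 2))
    have h6 : 2 * (((g (star y * y)).re + 1) / (2 * ‖w‖ ^ 2)) * ‖w‖ ^ 2 = (g (star y * y)).re + 1 := by
      field_simp
    linarith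
  have hb0 : g (star (H - (‖H‖ : ℂ) • 1) * (H - (‖H‖ : ℂ) • 1)) = 0 := by
    apply le_antisymm _ (hps _)
    have h1 : star H * H ≤ algebraMap ℝ A (‖H‖ ^ 2) := CStarAlgebra.star_mul_le_algebraMap_norm_sq
    have h2 := hpos _ (sub_nonneg.2 h1)
    have h3 : algebraMap ℝ A (‖H‖ ^ 2) = (((‖H‖ ^ 2 : ℝ) : ℂ)) • (1 : A) := by
      rw [Algebra.algebraMap_eq_smul_one]; exact (Complex.coe_smul _ _).symm
    rw [h3, map_sub, map_smul, g11, hHs] at h2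
    have h4 : g (star (H - (‖H‖ : ℂ) • 1) * (H - (‖H‖ : ℂ) • 1)) = g (H * H) - (((‖H‖ ^ 2 : ℝ) : ℂ)) := by
      simp only [star_sub, star_smul, star_one, hHs, sub_mul, mul_sub, smul_mul_assoc,
        mul_smul_comm, map_sub, map_smul, one_mul, mul_one, g11, gH]
      simp
      ring
    rw [h4]
    simpa using h2
  have left : ∀ y, g (H * y) = ‖H‖ * g y := by
    intro y
    have := kill _ y hb0
    simp only [star_sub, star_smul, star_one, hHs, sub_mul, smul_mul_assoc, map_sub, map_smul,
      one_mul] at this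
    simpa [sub_eq_zero] using this
  refine ⟨g.toLinearMap, hps, g11, left, fun y => ?_⟩
  have h1 := left (star y)
  have h2 := congrArg star h1
  change g (y * H) = ‖H‖ * g y
  rw [← hstar] at h2
  simp only [star_mul, star_star, hHs, hstar] at h2
  rw [h2]
  simp [mul_comm]

end State

end NucLocal

namespace NucLocal

section BlockExp
variable {A : Type*} [CStarAlgebra A]

open scoped MatrixOrder in
lemma gram_pos {κ : Type*} [Fintype κ] (ω : A →ₗ[ℂ] ℂ) (hω : ∀ a, 0 ≤ ω (star a * a))
    (z : κ → A) : IsPosElem (Matrix.of fun α β => ω (star (z α) * z β)) := by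
  classical
  have h : (Matrix.of fun α β => ω (star (z α) * z β)).PosSemidef := by
    rw [Matrix.posSemidef_iff_dotProduct_mulVec]
    have hq : ∀ v : κ → ℂ, star v ⬝ᵥ ((Matrix.of fun α β => ω (star (z α) * z β)).mulVec v) =
        ω (star (∑ α, v α • z α) * ∑ α, v α • z α) := by
      intro v
      simp only [dotProduct, Matrix.mulVec, star_sum, star_smul, Finset.sum_mul, Finset.mul_sum,
        map_sum, smul_mul_assoc, mul_smul_comm, map_smul, Matrix.of_apply, Pi.star_apply, smul_eq_mul]
      rw [Finset.sum_comm]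
      refine Finset.sum_congr rfl fun a _ => Finset.sum_congr rfl fun b _ => ?_
      ring
    refine ⟨?_, fun v => ?_⟩
    · have hst : ∀ a, ω (star a) = star (ω a) := by
        intro a
        have h1 := (Complex.nonneg_iff.1 (hω (1 + a))).2
        have h2 := (Complex.nonneg_iff.1 (hω (1 + Complex.I • a))).2
        have h3 := (Complex.nonneg_iff.1 (hω a)).2
        have h4 := (Complex.nonneg_iff.1 (hω 1)).2
        simp only [star_add, star_one, star_smul, add_mul, mul_add, one_mul, mul_one, map_add,
          smul_mul_assoc, mul_smul_comm, map_smul] at h1 h2 h3 h4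
        simp at h1 h2 h4
        refine Complex.ext ?_ ?_
        · simp; linarith
        · simp; linarith
      ext a b
      simp only [Matrix.conjTranspose_apply, Matrix.of_apply]
      rw [← hst]; simp
    · rw [hq]; exact hω _
  obtain ⟨y, hy⟩ := CStarAlgebra.nonneg_iff_eq_star_mul_self.1 h.nonneg
  exact ⟨y, hy⟩

variable {m : Type*} [Fintype m] [DecidableEq m]

lemma block_exp (F : Matrix m m ℂ →ₗ[ℂ] A) (hs : ∀ x, F (star x) = star (F x))
    (hl : ∀ x y, F x * F y = F 1 * F (x * y)) (hr : ∀ x y, F x * F y = F (x * y) * F 1)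
    (hH : IsPosElem (F 1)) (h0 : F 1 ≠ 0) :
    ∃ E : A →ₗ[ℂ] Matrix m m ℂ, IsCompletelyPositive E ∧ E 1 = 1 ∧
      (∀ x a, E (F x * a) = (‖F 1‖ : ℂ) • (x * E a)) ∧
      ∀ x a, E (a * F x) = (‖F 1‖ : ℂ) • (E a * x) := by
  obtain ⟨ω, w1, w2, w3, w4⟩ := exists_state hH h0
  set c : ℂ := (‖F 1‖ : ℂ) with hc
  have hc0 : c ≠ 0 := by rw [hc]; simpa using h0
  let e : m → m → Matrix m m ℂ := fun k u => Matrix.single k u 1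
  let E : A →ₗ[ℂ] Matrix m m ℂ :=
    { toFun := fun a => Matrix.of fun u v => (c ^ 2)⁻¹ * ∑ k, ω (F (e k u) * a * F (e v k))
      map_add' := fun a b => by
        ext u v; simp [mul_add, add_mul, Finset.sum_add_distrib]
      map_smul' := fun r a => by
        ext u v; simp [Finset.mul_sum]; refine Finset.sum_congr rfl fun k _ => by ring }
  have hE : ∀ a u v, E a u v = (c ^ 2)⁻¹ * ∑ k, ω (F (e k u) * a * F (e v k)) := fun _ _ _ => rfl
  have hes : ∀ k u, star (e k u) = e u k := fun k u => by
    simp [e, Matrix.star_eq_conjTranspose]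
  refine ⟨E, ?_, ?_, ?_, ?_⟩
  · rintro n x ⟨y, rfl⟩
    have h1 : IsPosElem (((c ^ 2)⁻¹ : ℂ) • ∑ r : Fin n, ∑ k : m, Matrix.of fun α β : Fin n × m =>
        ω (star (y r α.1 * F (e α.2 k)) * (y r β.1 * F (e β.2 k)))) := by
      obtain ⟨z, hz⟩ := mpos_sum Finset.univ (f := fun r : Fin n => ∑ k : m,
        Matrix.of fun α β : Fin n × m =>
        ω (star (y r α.1 * F (e α.2 k)) * (y r β.1 * F (e β.2 k)))) (fun r _ =>
          mpos_sum _ fun k _ => gram_pos ω w1 fun α : Fin n × m => y r α.1 * F (e α.2 k))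
      refine ⟨(c⁻¹) • z, ?_⟩
      rw [hz, star_smul, smul_mul_assoc, mul_smul_comm, smul_smul]
      congr 1
      rw [hc, sq, mul_inv]
      simp
    obtain ⟨z, hz⟩ := h1
    refine ⟨Matrix.of fun r q => Matrix.of fun w t => z (r, w) (q, t), ?_⟩
    ext p q u v
    have := congrFun (congrFun hz (p, u)) (q, v)
    simp only [Matrix.map_apply, Matrix.mul_apply, Matrix.star_apply, Fintype.sum_prod_type,
      Matrix.of_apply, Matrix.smul_apply, Matrix.sum_apply] at this ⊢
    rw [← this, hE, smul_eq_mul, Finset.sum_comm]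
    congr 1
    refine Finset.sum_congr rfl fun k _ => ?_
    rw [Finset.mul_sum, Finset.sum_mul, map_sum]
    refine Finset.sum_congr rfl fun r _ => ?_
    rw [star_mul, ← hs, hes]
    simp only [mul_assoc]
  · ext u v
    rw [hE]
    have e0 : ∀ k, ω (F (e k u) * 1 * F (e v k)) = c * ω (F (e k u * e v k)) := fun k => by
      rw [mul_one, hl, w3]
    simp only [e0]
    by_cases h : u = v
    · subst h
      simp only [e, Matrix.single_mul_single_same, mul_one]
      rw [← Finset.mul_sum, ← map_sum, ← map_sum]
      have : ∑ k : m, Matrix.single k k (1 : ℂ) = 1 := by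
        ext a b
        simp only [Matrix.sum_apply, Matrix.single_apply, Matrix.one_apply]
        by_cases hab : a = b
        · subst hab; simp
        · simp [hab]
      rw [this, Matrix.one_apply_eq]
      have := w3 1
      rw [mul_one, w2, mul_one] at this
      rw [this]
      field_simp
    · simp [e, Matrix.single_mul_single_of_ne _ _ _ _ h, h]
  · intro x a
    ext u v
    rw [hE, Matrix.smul_apply, Matrix.mul_apply]
    have key : ∀ k, ω (F (e k u) * (F x * a) * F (e v k)) =
        c * ∑ l, x u l * ω (F (e k l) * a * F (e v k)) := by
      intro k
      have h1 : e k u * x = ∑ l, x u l • e k l := by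
        ext a b
        simp only [Matrix.sum_apply, Matrix.smul_apply, e]
        by_cases h : k = a
        · subst h; simp [Matrix.single_apply]
        · simp [Matrix.mul_apply, Matrix.single_apply, h]
      rw [← mul_assoc, hl, h1, mul_assoc, mul_assoc, w3, map_sum, Finset.sum_mul, map_sum]
      congr 1
      refine Finset.sum_congr rfl fun l _ => ?_
      rw [map_smul, smul_mul_assoc, map_smul, mul_assoc, smul_eq_mul]
    simp only [key, hE, smul_eq_mul]
    simp only [Finset.mul_sum]
    rw [Finset.sum_comm]
    refine Finset.sum_congr rfl fun l _ => Finset.sum_congr rfl fun k _ => ?_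
    ring
  · intro x a
    ext u v
    rw [hE, Matrix.smul_apply, Matrix.mul_apply]
    have key : ∀ k, ω (F (e k u) * (a * F x) * F (e v k)) =
        c * ∑ l, x l v * ω (F (e k u) * a * F (e l k)) := by
      intro k
      have h1 : x * e v k = ∑ l, x l v • e l k := by
        ext a b
        simp only [Matrix.sum_apply, Matrix.smul_apply, e]
        by_cases h : k = b
        · subst h; simp [Matrix.single_apply]
        · simp [Matrix.mul_apply, Matrix.single_apply, h]
      rw [mul_assoc, mul_assoc a, hr, h1, ← mul_assoc, ← mul_assoc, w4, map_sum, Finset.mul_sum,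
        map_sum]
      congr 1
      refine Finset.sum_congr rfl fun l _ => ?_
      rw [map_smul, mul_smul_comm, map_smul, smul_eq_mul]
    simp only [key, hE, smul_eq_mul]
    simp only [Finset.mul_sum, Finset.sum_mul]
    rw [Finset.sum_comm]
    refine Finset.sum_congr rfl fun l _ => Finset.sum_congr rfl fun k _ => ?_
    ring

end BlockExp

end NucLocal

namespace NucLocal

section CommSqrt
open Polynomial

lemma comm_poly (q : ℝ[X]) : ∃ C : ℝ, 0 ≤ C ∧ ∀ (M : Type) [CStarAlgebra M] (d T : M), ‖d‖ ≤ 1 →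
    ‖T * aeval d q - aeval d q * T‖ ≤ C * ‖T * d - d * T‖ := by
  induction q using Polynomial.induction_on' with
  | add p q hp hq =>
    obtain ⟨C1, c1, h1⟩ := hp
    obtain ⟨C2, c2, h2⟩ := hq
    refine ⟨C1 + C2, by positivity, fun M _ d T hd => ?_⟩
    have e : T * aeval d (p + q) - aeval d (p + q) * T =
      (T * aeval d p - aeval d p * T) + (T * aeval d q - aeval d q * T) := by
      rw [map_add]; noncomm_ring
    rw [e, add_mul]
    exact (norm_add_le _ _).trans (add_le_add (h1 M d T hd) (h2 M d T hd))
  | monomial n a =>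
    have hp : ∀ n : ℕ, ∀ (M : Type) [CStarAlgebra M] (d T : M), ‖d‖ ≤ 1 →
        ‖T * d ^ n - d ^ n * T‖ ≤ n * ‖T * d - d * T‖ := by
      intro n
      induction n with
      | zero => intro M _ d T hd; simp
      | succ n ih =>
        intro M _ d T hd
        have e : T * d ^ (n + 1) - d ^ (n + 1) * T =
          (T * d ^ n - d ^ n * T) * d + d ^ n * (T * d - d * T) := by
          rw [pow_succ]; noncomm_ring
        rw [e]
        refine (norm_add_le _ _).trans ?_
        have hdn : ‖d ^ n‖ ≤ 1 := by
          rcases n.eq_zero_or_pos with h | h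
          · subst h; simpa using norm_one_le' M
          · exact (norm_pow_le' d h).trans (pow_le_one₀ (norm_nonneg _) hd)
        have h1 := norm_mul_le (T * d ^ n - d ^ n * T) d
        have h2 := norm_mul_le (d ^ n) (T * d - d * T)
        have h3 := ih M d T hd
        have h4 : ‖T * d ^ n - d ^ n * T‖ * ‖d‖ ≤ ‖T * d ^ n - d ^ n * T‖ * 1 := by gcongr
        have h5 : ‖d ^ n‖ * ‖T * d - d * T‖ ≤ 1 * ‖T * d - d * T‖ := by gcongr
        push_cast
        linarith
    refine ⟨|a| * n, by positivity, fun M _ d T hd => ?_⟩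
    rw [aeval_monomial]
    have e : T * (algebraMap ℝ M a * d ^ n) - algebraMap ℝ M a * d ^ n * T =
        a • (T * d ^ n - d ^ n * T) := by
      rw [← Algebra.smul_def, mul_smul_comm, smul_mul_assoc, smul_sub]
    rw [e, norm_smul, mul_assoc]
    exact mul_le_mul_of_nonneg_left (hp n M d T hd) (norm_nonneg _)

lemma comm_sqrt (K η : ℝ) (hK : 0 ≤ K) (hη : 0 < η) : ∃ γ : ℝ, 0 < γ ∧
    ∀ (M : Type) [CStarAlgebra M] (d : M), IsPosElem d → IsPosElem (1 - d) →
    ∃ s : M, star s = s ∧ s * s = d ∧ ‖s‖ ≤ 1 ∧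
      ∀ T : M, ‖T‖ ≤ K → ‖T * d - d * T‖ ≤ γ → ‖T * s - s * T‖ ≤ η := by
  obtain ⟨q, hq⟩ := exists_polynomial_near_of_continuousOn 0 1 Real.sqrt
    Real.continuous_sqrt.continuousOn (η / (4 * (K + 1))) (by positivity)
  obtain ⟨C, hC, hCq⟩ := comm_poly q
  refine ⟨η / (2 * (C + 1)), by positivity, fun M _ d hd hd1 => ?_⟩
  have hn := norm_le_one_of_pos hd hd1
  letI := CStarAlgebra.spectralOrder M
  haveI := CStarAlgebra.spectralOrderedRing M
  rw [pos_iff] at hd hd1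
  have hsa : IsSelfAdjoint d := IsSelfAdjoint.of_nonneg hd
  have hsp : ∀ x ∈ spectrum ℝ d, x ∈ Set.Icc (0 : ℝ) 1 := by
    intro x hx
    refine ⟨spectrum_nonneg_of_nonneg hd hx, ?_⟩
    by_cases hM : Subsingleton M
    · simp [spectrum.of_subsingleton] at hx
    haveI := not_subsingleton_iff_nontrivial.1 hM
    have := spectrum.norm_le_norm_of_mem hx
    rw [Real.norm_eq_abs] at this
    exact (le_abs_self x).trans (this.trans hn)
  set s := cfc Real.sqrt d with hs
  have hcont : ContinuousOn Real.sqrt (spectrum ℝ d) := Real.continuous_sqrt.continuousOn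
  have hss : s * s = d := by
    rw [hs, ← cfc_mul Real.sqrt Real.sqrt d]
    conv_rhs => rw [← cfc_id ℝ d]
    exact cfc_congr fun x hx => Real.mul_self_sqrt (hsp x hx).1
  refine ⟨s, (cfc_predicate Real.sqrt d : IsSelfAdjoint s).star_eq, hss, ?_, ?_⟩
  · refine norm_cfc_le zero_le_one fun x hx => ?_
    rw [Real.norm_of_nonneg (Real.sqrt_nonneg x)]
    exact Real.sqrt_le_one.2 (hsp x hx).2
  · intro T hT hTd
    have hsq : ‖s - aeval d q‖ ≤ η / (4 * (K + 1)) := by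
      rw [hs, ← cfc_polynomial q d, ← cfc_sub Real.sqrt q.eval d]
      refine norm_cfc_le (by positivity) fun x hx => ?_
      rw [Real.norm_eq_abs, abs_sub_comm]
      exact (hq x (hsp x hx)).le
    have e : T * s - s * T = (T * (s - aeval d q) - (s - aeval d q) * T) +
      (T * aeval d q - aeval d q * T) := by noncomm_ring
    rw [e]
    have h1 := (norm_add_le (T * (s - aeval d q) - (s - aeval d q) * T)
      (T * aeval d q - aeval d q * T))
    have h2 := norm_sub_le (T * (s - aeval d q)) ((s - aeval d q) * T)
    have h3 := norm_mul_le T (s - aeval d q)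
    have h4 := norm_mul_le (s - aeval d q) T
    have h5 : ‖T‖ * ‖s - aeval d q‖ ≤ K * (η / (4 * (K + 1))) := by gcongr
    have h6 := (hCq M d T hn).trans (mul_le_mul_of_nonneg_left hTd hC)
    have h7 : K * (η / (4 * (K + 1))) ≤ η / 4 := by
      rw [← mul_div_assoc, div_le_div_iff₀ (by positivity) (by positivity)]; nlinarith
    have h8 : C * (η / (2 * (C + 1))) ≤ η / 2 := by
      rw [← mul_div_assoc, div_le_div_iff₀ (by positivity) (by positivity)]; nlinarith
    have h9 : ‖s - aeval d q‖ * ‖T‖ = ‖T‖ * ‖s - aeval d q‖ := mul_comm _ _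
    linarith

end CommSqrt

lemma norm_orth_sum {A ι : Type*} [CStarAlgebra A] (S : Finset ι) (z : ι → A) {C : ℝ} (hC : 0 ≤ C)
    (h1 : ∀ i k, i ≠ k → star (z i) * z k = 0) (h2 : ∀ i k, i ≠ k → z i * star (z k) = 0)
    (h : ∀ i ∈ S, ‖z i‖ ≤ C) : ‖∑ i ∈ S, z i‖ ≤ C := by
  classical
  have e : star (∑ i ∈ S, z i) * ∑ i ∈ S, z i = ∑ i ∈ S, star (z i) * z i := by
    rw [star_sum, Finset.sum_mul_sum]
    refine Finset.sum_congr rfl fun i hi => ?_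
    rw [Finset.sum_eq_single i (fun k _ hk => h1 i k hk.symm) (fun h => absurd hi h)]
  have hs := IsSelfAdjoint.nnnorm_sum_eq_sup (f := fun i => star (z i) * z i) S
    (fun i _ => IsSelfAdjoint.star_mul_self _) (by
      intro i k hik
      change star (z i) * z i * (star (z k) * z k) = 0
      rw [mul_assoc, ← mul_assoc (z i), h2 i k hik]; simp)
  have h3 : ‖∑ i ∈ S, z i‖ ^ 2 ≤ C ^ 2 := by
    rw [sq, ← CStarRing.norm_star_mul_self, e, ← coe_nnnorm, hs]
    have : (S.sup fun i => ‖star (z i) * z i‖₊) ≤ Real.toNNReal (C ^ 2) := by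
      refine Finset.sup_le fun i hi => ?_
      rw [← NNReal.coe_le_coe, coe_nnnorm, CStarRing.norm_star_mul_self,
        Real.coe_toNNReal _ (by positivity), sq]
      have := h i hi
      gcongr
    have h4 := NNReal.coe_le_coe.2 this
    rwa [Real.coe_toNNReal _ (by positivity)] at h4
  exact (sq_le_sq₀ (norm_nonneg _) hC).1 h3

end NucLocal

namespace NucLocal

lemma nuc_of_types {n : ℕ} {A : Type*} [CStarAlgebra A] (h : ∀ (S : Finset A) (ε : ℝ), 0 < ε →
    ∃ (κ : Type) (_ : Fintype κ) (_ : DecidableEq κ) (m : κ → Type) (_ : ∀ i, Fintype (m i))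
      (_ : ∀ i, DecidableEq (m i)) (J : κ → Fin (n + 1)) (ψ : A →ₗ[ℂ] FB κ m)
      (φ : FB κ m →ₗ[ℂ] A), IsCompletelyPositive ψ ∧ IsCompletelyPositive φ ∧
      IsPosElem (1 - ψ 1) ∧
      (∀ j x, (∀ i, J i ≠ j → x i = 0) → ‖φ x‖ ≤ ‖x‖) ∧
      (∀ j x y, (∀ i, J i ≠ j → x i = 0) → (∀ i, J i ≠ j → y i = 0) → x * y = 0 → y * x = 0 →
        φ x * φ y = 0) ∧ ∀ a ∈ S, ‖φ (ψ a) - a‖ < ε) : NuclearDimensionLE n A := by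
  intro S ε hε
  obtain ⟨κ, i1, i2, m, i3, i4, J, ψ, φ, h1, h2, h3, h4, h5, h6⟩ := h S ε hε
  let e := Fintype.equivFin κ
  let r : Fin (Fintype.card κ) → ℕ := fun k => Fintype.card (m (e.symm k))
  let Sg : FB κ m ≃ₐ[ℂ] FDBlock (Fintype.card κ) r :=
    (AlgEquiv.piCongrLeft' ℂ (fun i => Matrix (m i) (m i) ℂ) e).trans
      (AlgEquiv.piCongrRight fun k => Matrix.reindexAlgEquiv ℂ ℂ (Fintype.equivFin (m (e.symm k))))
  have happ : ∀ x k, Sg x k = Matrix.reindexAlgEquiv ℂ ℂ (Fintype.equivFin (m (e.symm k)))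
      (x (e.symm k)) := fun x k => rfl
  have hst : ∀ x, Sg (star x) = star (Sg x) := fun x => rfl
  have hst' : ∀ x, Sg.symm (star x) = star (Sg.symm x) := by
    intro x
    apply Sg.injective
    rw [hst]; simp
  have c1 : IsCompletelyPositive Sg.toLinearMap := cp_of_hom _ (fun x y => by simp) hst
  have c2 : IsCompletelyPositive Sg.symm.toLinearMap := cp_of_hom _ (fun x y => by simp) hst'
  have hsupp : ∀ j x, x ∈ blockSupp (r := r) (fun k => J (e.symm k)) j →
      ∀ i, J i ≠ j → Sg.symm x i = 0 := by
    intro j x hx i hi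
    obtain ⟨y, rfl⟩ := Sg.surjective x
    rw [AlgEquiv.symm_apply_apply]
    obtain ⟨k, rfl⟩ := e.symm.surjective i
    have h7 := hx k hi
    rw [happ] at h7
    exact (map_eq_zero_iff _ (AlgEquiv.injective _)).1 h7
  have hn : ∀ x, ‖Sg.symm x‖ ≤ ‖x‖ := fun x => cp_norm_le' c2 (by simpa using pos_zero) x
  refine ⟨Fintype.card κ, r, fun k => J (e.symm k), Sg.toLinearMap ∘ₗ ψ,
    φ ∘ₗ Sg.symm.toLinearMap, cp_comp c1 h1, cp_comp h2 c2, ?_, ?_, ?_⟩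
  · refine cp_norm_le' (cp_comp c1 h1) ?_
    have := cp_pos c1 h3
    simpa using this
  · intro j
    refine ⟨fun x hx => (h4 j _ (hsupp j x hx)).trans (hn x), fun x hx y hy hxy hyx => ?_⟩
    have e1 : Sg.symm x * Sg.symm y = 0 := by rw [← map_mul, hxy, map_zero]
    have e2 : Sg.symm y * Sg.symm x = 0 := by rw [← map_mul, hyx, map_zero]
    exact ⟨h5 j _ _ (hsupp j x hx) (hsupp j y hy) e1 e2, h5 j _ _ (hsupp j y hy) (hsupp j x hx) e2 e1⟩
  · intro a ha
    simpa using h6 a ha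

lemma pos_pi {ι : Type*} {R : ι → Type*} [∀ i, Mul (R i)] [∀ i, Star (R i)] {a : ∀ i, R i}
    (h : ∀ i, IsPosElem (a i)) : IsPosElem a := by
  choose y hy using h
  exact ⟨y, funext hy⟩

lemma cp_pi {D : Type*} [Ring D] [StarRing D] [Module ℂ D] {κ : Type} {m : κ → Type} [Fintype κ]
    [DecidableEq κ] [∀ i, Fintype (m i)] [∀ i, DecidableEq (m i)]
    (f : ∀ i, D →ₗ[ℂ] Matrix (m i) (m i) ℂ)
    (hf : ∀ i, IsCompletelyPositive (f i)) :
    IsCompletelyPositive (LinearMap.pi f : D →ₗ[ℂ] FB κ m) := by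
  intro k x hx
  have h := fun i => hf i k x hx
  choose y hy using h
  refine ⟨Matrix.of fun a b i => y i a b, ?_⟩
  refine Matrix.ext fun a b => funext fun i => ?_
  have := congrFun (congrFun (hy i) a) b
  simp only [Matrix.mul_apply, Matrix.map_apply, Finset.sum_apply, Matrix.star_apply,
    Matrix.of_apply] at this ⊢
  exact this

lemma block_exp' {A : Type*} [CStarAlgebra A] {ι : Type} {m : ι → Type} [Fintype ι] [DecidableEq ι]
    [∀ i, Fintype (m i)] [∀ i, DecidableEq (m i)] {φ : FB ι m →ₗ[ℂ] A}
    (hφ : IsCompletelyPositive φ) (h0 : OZ φ) (i : ι) {δ : ℝ} (hδ : 0 < δ) :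
    ∃ E : A →ₗ[ℂ] Matrix (m i) (m i) ℂ, IsCompletelyPositive E ∧ IsPosElem (1 - E 1) ∧
      ((∀ a, E a = 0) ∧ ‖φ (Pi.single i 1)‖ < δ ∨ ∃ c : ℝ, δ ≤ c ∧ E 1 = 1 ∧
        (∀ x a, E (φ (Pi.single i x) * a) = (c : ℂ) • (x * E a)) ∧
        ∀ x a, E (a * φ (Pi.single i x)) = (c : ℂ) • (E a * x)) := by
  by_cases hc : ‖φ (Pi.single i 1)‖ < δ
  · refine ⟨0, fun k x _ => ⟨0, ?_⟩, ⟨1, by simp⟩, Or.inl ⟨fun a => rfl, hc⟩⟩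
    ext; simp
  · push Not at hc
    let F : Matrix (m i) (m i) ℂ →ₗ[ℂ] A := φ ∘ₗ LinearMap.single ℂ (fun i => Matrix (m i) (m i) ℂ) i
    have hF : ∀ x, F x = φ (Pi.single i x) := fun x => rfl
    have hm : ∀ x y : Matrix (m i) (m i) ℂ, (Pi.single i x * Pi.single i y : FB ι m) =
        Pi.single i (x * y) := fun x y => by
      funext k
      by_cases hk : k = i
      · subst hk; simp
      · simp [Pi.single_eq_of_ne hk]
    obtain ⟨E, e1, e2, e3, e4⟩ := block_exp F (fun x => by
        rw [hF, hF, ← cp_star hφ]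
        congr 1
        funext k
        by_cases hk : k = i
        · subst hk; simp
        · simp [Pi.single_eq_of_ne hk]) (fun x y => by
        have := oz_mid hφ h0 (Pi.single i x) (Pi.single i 1) (Pi.single i y)
        simpa only [hF, hm, one_mul] using this) (fun x y => by
        have := oz_mid hφ h0 (Pi.single i y) (Pi.single i x) (Pi.single i 1)
        simpa only [hF, hm, mul_one] using this.symm) (cp_pos hφ ⟨Pi.single i 1, by
          funext k
          by_cases hk : k = i
          · subst hk; simp
          · simp [Pi.single_eq_of_ne hk]⟩) (by
          rw [← norm_pos_iff]; exact hδ.trans_le hc)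
    exact ⟨E, e1, by rw [e2]; simpa using pos_zero, Or.inr ⟨_, hc, e2, e3, e4⟩⟩


theorem nuc_of_good {n : ℕ} {A : Type*} [CStarAlgebra A] (hA : Good n A) :
    NuclearDimensionLE n A := by
  classical
  refine nuc_of_types fun S ε hε => ?_
  obtain ⟨K, hK0, hK⟩ : ∃ K : ℝ, 0 ≤ K ∧ ∀ a ∈ S, ‖a‖ ≤ K :=
    ⟨∑ a ∈ S, ‖a‖, Finset.sum_nonneg fun _ _ => norm_nonneg _, fun a ha =>
      Finset.single_le_sum (f := fun a => ‖a‖) (fun _ _ => norm_nonneg _) ha⟩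
  set t : ℝ := ε / (4 * (n + 1)) with ht
  have ht0 : 0 < t := by positivity
  set δ : ℝ := t / (K + 1) with hδ
  have hδ0 : 0 < δ := by positivity
  have hδK : δ * K ≤ t := by
    rw [hδ, div_mul_eq_mul_div, div_le_iff₀ (by positivity)]; nlinarith
  obtain ⟨γ, hγ, hsq⟩ := comm_sqrt K t hK0 ht0
  obtain ⟨ε0, he0, he1, he2, he3⟩ : ∃ ε0 : ℝ, 0 < ε0 ∧ ε0 ≤ t ∧ ε0 ≤ t * δ ∧ ε0 ≤ γ / 2 * δ :=
    ⟨min t (min (t * δ) (γ / 2 * δ)), by positivity, min_le_left _ _,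
      (min_le_right _ _).trans (min_le_left _ _), (min_le_right _ _).trans (min_le_right _ _)⟩
  obtain ⟨ι, i1, i2, m, i3, i4, φ, d, x, h1, h2, h3, h4, h5, h6⟩ := hA S ε0 he0
  have hd : ∀ j i, IsPosElem (d j i) ∧ IsPosElem (1 - d j i) := by
    intro j i
    obtain ⟨y, hy⟩ := h4 j
    obtain ⟨z, hz⟩ := h5 j
    exact ⟨⟨y i, congrFun hy i⟩, ⟨z i, congrFun hz i⟩⟩
  have hs := fun j i => hsq (Matrix (m i) (m i) ℂ) (d j i) (hd j i).1 (hd j i).2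
  choose s s1 s2 s3 s4 using hs
  have hE := fun j i => block_exp' (h1 j) (h2 j) i hδ0
  choose E e1 e2 e3 using hE
  have hEn : ∀ j i a, ‖E j i a‖ ≤ ‖a‖ := fun j i a => cp_norm_le' (e1 j i) (e2 j i) a
  let P : Fin (n + 1) → FB (Fin (n + 1) × ι) (fun k => m k.2) →ₗ[ℂ] FB ι m := fun j =>
    { toFun := fun x i => x (j, i), map_add' := fun _ _ => rfl, map_smul' := fun _ _ => rfl }
  have hPm : ∀ j x y, P j (x * y) = P j x * P j y := fun _ _ _ => rfl
  have hPc : ∀ j, IsCompletelyPositive (P j) := fun j => cp_of_hom _ (hPm j) fun _ => rfl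
  have hPn : ∀ j x, ‖P j x‖ ≤ ‖x‖ := fun j x => cp_norm_le' (hPc j) (by
    have : P j 1 = 1 := rfl
    rw [this]; simpa using pos_zero) x
  let ψ : A →ₗ[ℂ] FB (Fin (n + 1) × ι) (fun k => m k.2) :=
    LinearMap.pi fun k => conjMap (E k.1 k.2) (s k.1 k.2)
  have hψ : ∀ a j i, P j (ψ a) i = s j i * E j i a * s j i := by
    intro a j i
    change conjMap (E j i) (s j i) a = _
    rw [conjMap_apply, s1]
  let Φ : FB (Fin (n + 1) × ι) (fun k => m k.2) →ₗ[ℂ] A := ∑ j, φ j ∘ₗ P j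
  have hΦ : ∀ x, Φ x = ∑ j, φ j (P j x) := fun x => by simp [Φ]
  have hΦj : ∀ j x, (∀ k : Fin (n + 1) × ι, k.1 ≠ j → x k = 0) → Φ x = φ j (P j x) := by
    intro j x hx
    rw [hΦ, Finset.sum_eq_single j _ (by simp)]
    intro j' _ hj
    have : P j' x = 0 := funext fun i => hx (j', i) hj
    rw [this, map_zero]
  refine ⟨Fin (n + 1) × ι, inferInstance, inferInstance, fun k => m k.2, inferInstance,
    inferInstance, Prod.fst, ψ, Φ, cp_pi _ fun k => cp_conj (e1 _ _) _,
    cp_sum _ fun j _ => cp_comp (h1 j) (hPc j), ?_, ?_, ?_, ?_⟩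
  · refine pos_pi fun k => ?_
    have hk : (1 - ψ 1) k = 1 - s k.1 k.2 * E k.1 k.2 1 * s k.1 k.2 := by
      rw [← hψ]; rfl
    rw [hk]
    refine pos_one_sub ?_ ?_
    · have := pos_conj (cp_pos (a := 1) (e1 k.1 k.2) ⟨1, by simp⟩) (s k.1 k.2)
      rwa [s1] at this
    · refine (norm_mul_le _ _).trans ?_
      have h7 := norm_mul_le (s k.1 k.2) (E k.1 k.2 1)
      have h8 := (hEn k.1 k.2 1).trans (norm_one_le' A)
      have h9 := s3 k.1 k.2
      refine mul_le_one₀ (h7.trans (mul_le_one₀ h9 (norm_nonneg _) h8)) (norm_nonneg _) h9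
  · intro j x hx
    rw [hΦj j x hx]
    exact (cp_norm_le' (h1 j) (h3 j) _).trans (hPn j x)
  · intro j x y hx hy hxy hyx
    rw [hΦj j x hx, hΦj j y hy]
    refine h2 j _ _ ?_ ?_
    · rw [← hPm, hxy, map_zero]
    · rw [← hPm, hyx, map_zero]
  · intro a ha
    obtain ⟨k1, k2, k3⟩ := h6 a ha
    have hz : ∀ j i, ‖φ j (Pi.single i ((P j (ψ a) - x j a) i))‖ ≤ 2 * t := by
      intro j i
      have hc := fun y => cp_norm_le' (h1 j) (h3 j) y
      rcases e3 j i with ⟨b1, b2⟩ | ⟨c, b1, b2, b3, b4⟩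
      · have g1 : (P j (ψ a) - x j a) i = - x j a i := by
          rw [Pi.sub_apply, hψ, b1]; simp
        rw [g1, Pi.single_neg, map_neg, norm_neg]
        have g2 : ‖φ j (Pi.single i (d j i))‖ ≤ δ := by
          refine le_trans ?_ b2.le
          letI := CStarAlgebra.spectralOrder A
          haveI := CStarAlgebra.spectralOrderedRing A
          have q1 : IsPosElem (Pi.single i (d j i) : FB ι m) := pos_pi fun k => by
            by_cases hk : k = i
            · subst hk; simpa using (hd j k).1
            · rw [Pi.single_eq_of_ne hk]; exact pos_zero
          have q2 : IsPosElem (Pi.single i 1 - Pi.single i (d j i) : FB ι m) := pos_pi fun k => by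
            by_cases hk : k = i
            · subst hk; simpa using (hd j k).2
            · simpa [Pi.single_eq_of_ne hk] using pos_zero
          have q3 := cp_pos (h1 j) q1
          have q4 := cp_pos (h1 j) q2
          rw [map_sub] at q4
          rw [pos_iff] at q3 q4
          exact CStarAlgebra.norm_le_norm_of_nonneg_of_le q3 (sub_nonneg.1 q4)
        have g3 : φ j (Pi.single i (x j a i)) = (φ j (Pi.single i (x j a i)) -
          φ j (Pi.single i (d j i)) * a) + φ j (Pi.single i (d j i)) * a := by abel
        rw [g3]
        refine (norm_add_le _ _).trans ?_
        have g4 := norm_mul_le (φ j (Pi.single i (d j i))) a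
        have g5 : ‖φ j (Pi.single i (d j i))‖ * ‖a‖ ≤ δ * K := by
          have := hK a ha
          gcongr
        have := k1 j i
        linarith
      · refine (hc _).trans ?_
        rw [Pi.norm_single, Pi.sub_apply, hψ]
        set T := E j i a with hT
        have hc0 : 0 < c := hδ0.trans_le b1
        have g0 : ∀ y : Matrix (m i) (m i) ℂ, ‖(c : ℂ) • y‖ ≤ ε0 → ‖y‖ ≤ t ∧ ‖y‖ ≤ γ / 2 := by
          intro y hy
          rw [norm_smul, Complex.norm_real, Real.norm_of_nonneg hc0.le] at hy
          have : δ * ‖y‖ ≤ ε0 := le_trans (by gcongr) hy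
          constructor
          · exact le_of_mul_le_mul_left (by linarith) hδ0
          · exact le_of_mul_le_mul_left (by linarith) hδ0
        have g1 := (hEn j i _).trans (k1 j i)
        have g2 := (hEn j i _).trans (k2 j i)
        have g3 := b3 (x j a i) 1
        rw [mul_one, b2, mul_one] at g3
        rw [map_sub, b3, ← hT, g3, ← smul_sub] at g1
        rw [map_sub, b4, ← hT, g3, ← smul_sub] at g2
        obtain ⟨g4, g5⟩ := g0 _ g1
        obtain ⟨-, g6⟩ := g0 _ g2
        have g7 : ‖T * d j i - d j i * T‖ ≤ γ := by
          have : T * d j i - d j i * T = (x j a i - d j i * T) - (x j a i - T * d j i) := by abel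
          rw [this]
          refine (norm_sub_le _ _).trans (by linarith)
        have g8 := s4 j i T ((hEn j i a).trans (hK a ha)) g7
        have g9 : s j i * T * s j i - x j a i = s j i * (T * s j i - s j i * T)
            - (x j a i - d j i * T) := by
          rw [← s2 j i]; noncomm_ring
        rw [g9]
        refine (norm_sub_le _ _).trans ?_
        have g10 := norm_mul_le (s j i) (T * s j i - s j i * T)
        have g11 : ‖s j i‖ * ‖T * s j i - s j i * T‖ ≤ 1 * t := by
          have := s3 j i
          gcongr
        linarith
    have hj : ∀ j, ‖φ j (P j (ψ a)) - φ j (x j a)‖ ≤ 2 * t := by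
      intro j
      have q1 : φ j (P j (ψ a)) - φ j (x j a) =
          ∑ i, φ j (Pi.single i ((P j (ψ a) - x j a) i)) := by
        rw [← map_sub, ← map_sum, Finset.univ_sum_single]
      have q0 : ∀ (y : FB ι m) i, star (Pi.single i (y i) : FB ι m) = Pi.single i (star (y i)) := by
        intro y i
        funext k
        by_cases hk : k = i
        · subst hk; simp
        · simp [Pi.single_eq_of_ne hk]
      have q2 : ∀ (y z : FB ι m) i k, i ≠ k →
          (Pi.single i (y i) * Pi.single k (z k) : FB ι m) = 0 := by
        intro y z i k hik
        funext l
        by_cases hl : l = i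
        · subst hl; rw [Pi.mul_apply, Pi.single_eq_of_ne hik, mul_zero]; rfl
        · rw [Pi.mul_apply, Pi.single_eq_of_ne hl, zero_mul]; rfl
      rw [q1]
      refine norm_orth_sum _ _ (by linarith) ?_ ?_ fun i _ => hz j i
      · intro i k hik
        rw [← cp_star (h1 j), q0]
        exact oz_mul_zero (h1 j) (h2 j) (q2 (star (P j (ψ a) - x j a)) _ i k hik)
      · intro i k hik
        rw [← cp_star (h1 j), q0]
        exact oz_mul_zero (h1 j) (h2 j) (q2 _ (star (P j (ψ a) - x j a)) i k hik)
    have q3 : Φ (ψ a) - a = ∑ j, (φ j (P j (ψ a)) - φ j (x j a)) + (∑ j, φ j (x j a) - a) := by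
      rw [hΦ, Finset.sum_sub_distrib]; abel
    rw [q3]
    have q4 : ‖∑ j, (φ j (P j (ψ a)) - φ j (x j a))‖ ≤ (n + 1) * (2 * t) := by
      refine (norm_sum_le_of_le _ fun j _ => hj j).trans ?_
      simp
    have q5 := norm_add_le (∑ j, (φ j (P j (ψ a)) - φ j (x j a))) (∑ j, φ j (x j a) - a)
    have q6 : (n + 1) * t * 4 = ε := by rw [ht]; field_simp
    have q7 : (0 : ℝ) ≤ n * t := by positivity
    nlinarith

end NucLocal

namespace NucLocal

lemma proj_norm_le {B : Type*} [CStarAlgebra B] {q : B} (h1 : q * q = q) (h2 : star q = q) :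
    ‖q‖ ≤ 1 := by
  have := CStarRing.norm_star_mul_self (x := q)
  rw [h2, h1] at this
  by_contra h
  push Not at h
  nlinarith

lemma sp_bound {B : Type*} [CStarAlgebra B] [PartialOrder B] [StarOrderedRing B] {h : B} (h0 : 0 ≤ h)
    {x : ℝ} (hx : x ∈ spectrum ℝ h) : 0 ≤ x ∧ x ≤ ‖h‖ := by
  refine ⟨spectrum_nonneg_of_nonneg h0 hx, ?_⟩
  by_cases hM : Subsingleton B
  · simp [spectrum.of_subsingleton] at hx
  haveI := not_subsingleton_iff_nontrivial.1 hM
  have := spectrum.norm_le_norm_of_mem hx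
  rw [Real.norm_eq_abs] at this
  exact (le_abs_self x).trans this

lemma exists_R {B : Type*} [CStarAlgebra B] {y : B} (hy : IsPosElem y) :
    ∃ R : B, star R = R ∧ R * R * (1 + y) = 1 ∧ ‖R - 1‖ ≤ ‖y‖ ∧ ∀ b, y * b = b * y → R * b = b * R := by
  letI := CStarAlgebra.spectralOrder B
  haveI := CStarAlgebra.spectralOrderedRing B
  rw [pos_iff] at hy
  have hsa : IsSelfAdjoint y := IsSelfAdjoint.of_nonneg hy
  have hsp : ∀ x ∈ spectrum ℝ y, 0 ≤ x ∧ x ≤ ‖y‖ := fun x hx => sp_bound hy hx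
  have hc : ContinuousOn (fun x : ℝ => (√(1 + x))⁻¹) (spectrum ℝ y) := by
    apply ContinuousOn.inv₀
    · fun_prop
    · intro x hx
      have := (hsp x hx).1
      positivity
  refine ⟨cfc (fun x : ℝ => (√(1 + x))⁻¹) y, ?_, ?_, ?_, ?_⟩
  · exact (cfc_predicate (R := ℝ) _ y : IsSelfAdjoint _)
  · rw [← cfc_mul _ _ y hc hc]
    have e : (1 : B) + y = cfc (fun x : ℝ => 1 + x) y := by
      rw [cfc_add (R := ℝ) y (fun _ => 1) (fun x => x) (by fun_prop) (by fun_prop), cfc_const_one ℝ y, cfc_id' ℝ y]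
    rw [e, ← cfc_mul (fun x : ℝ => (√(1 + x))⁻¹ * (√(1 + x))⁻¹) (fun x => 1 + x) y (hc.mul hc) (by fun_prop), ← cfc_const_one ℝ y]
    apply cfc_congr
    intro x hx
    have := (hsp x hx).1
    have h2 : √(1 + x) * √(1 + x) = 1 + x := Real.mul_self_sqrt (by positivity)
    have : 0 < √(1 + x) := by positivity
    simp only
    generalize √(1 + x) = s at *
    rw [← h2]; field_simp
  · have e : cfc (fun x : ℝ => (√(1 + x))⁻¹) y - 1 = cfc (fun x : ℝ => (√(1 + x))⁻¹ - 1) y := by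
      rw [cfc_sub _ _ y hc (by fun_prop), cfc_const_one ℝ y]
    rw [e]
    apply norm_cfc_le (norm_nonneg _)
    intro x hx
    obtain ⟨hx0, hx1⟩ := hsp x hx
    refine le_trans ?_ hx1
    have h2 : √(1 + x) * √(1 + x) = 1 + x := Real.mul_self_sqrt (by positivity)
    have h1 : 1 ≤ √(1 + x) := by rw [Real.one_le_sqrt]; linarith
    rw [Real.norm_eq_abs, abs_le]
    have h3 : (√(1 + x))⁻¹ ≤ 1 := inv_le_one_of_one_le₀ h1
    have h4 : (√(1 + x))⁻¹ * √(1 + x) = 1 := inv_mul_cancel₀ (by positivity)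
    have h5 : 0 < (√(1 + x))⁻¹ := by positivity
    constructor <;> nlinarith
  · intro b hb
    exact (Commute.cfc_real (show Commute y b from hb) _)

lemma unitary_Q {B : Type*} [CStarAlgebra B] {p e f : B} {κ : ℝ} (hp : p * p = p) (hps : star p = p)
    (hfe : f * e = e) (hk : ‖(1 - p) * f‖ ≤ κ) (hk1 : κ ≤ 1 / 4) :
    ∃ Q : B, star Q * Q = 1 ∧ (1 - p) * (Q * e) = 0 ∧ ‖Q - 1‖ ≤ 12 * κ := by
  have hk0 : 0 ≤ κ := (norm_nonneg _).trans hk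
  set t := (1 - p) * f with ht
  obtain ⟨u, hu⟩ := isUnit_one_sub_of_norm_lt_one (x := t) (by linarith)
  set v : B := ((u⁻¹ : Bˣ) : B) with hv
  have hvW : v * (1 - t) = 1 := by rw [← hu]; exact u.inv_mul
  have hv1 : v = 1 + v * t := by
    rw [mul_sub, mul_one] at hvW; rw [← hvW]; abel
  have hvn : ‖v‖ ≤ 2 := by
    have h1 : ‖v‖ ≤ ‖(1 : B)‖ + ‖v * t‖ := by
      conv_lhs => rw [hv1]
      exact norm_add_le _ _
    have h2 := norm_mul_le v t
    have h3 := norm_one_le' B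
    have h4 : ‖v‖ * ‖t‖ ≤ ‖v‖ * (1 / 4) := by gcongr; linarith
    nlinarith [norm_nonneg v]
  have hvt : ‖v * t‖ ≤ 2 * κ := (norm_mul_le _ _).trans (by gcongr)
  set q := 1 - p with hq
  have hqq : q * q = q := by rw [hq]; simp [mul_sub, sub_mul, hp]
  have hqs : star q = q := by rw [hq]; simp [hps]
  have hqp : q * p = 0 := by rw [hq]; simp [sub_mul, hp]
  have hpq : p * q = 0 := by rw [hq]; simp [mul_sub, hp]
  have hqn := proj_norm_le hqq hqs
  have hpn := proj_norm_le hp hps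
  set n := q * v * p with hn
  have hn' : n = q * (v * t) * p := by
    rw [hn]; conv_lhs => rw [hv1]
    rw [mul_add, mul_one, add_mul, hqp, zero_add]
  have hnn : ‖n‖ ≤ 2 * κ := by
    rw [hn']
    calc ‖q * (v * t) * p‖ ≤ ‖q‖ * ‖v * t‖ * ‖p‖ := norm_mul₃_le
      _ ≤ 1 * (2 * κ) * 1 := by gcongr
      _ = 2 * κ := by ring
  have hpn0 : p * n = 0 := by rw [hn, ← mul_assoc, ← mul_assoc, hpq]; simp
  have hnp : n * p = n := by rw [hn, mul_assoc, hp]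
  have hqn' : q * n = n := by rw [hn, ← mul_assoc, ← mul_assoc, hqq]
  have hsp : p * star n = star n := by rw [← hps, ← star_mul, hnp]
  have hsp0 : star n * p = 0 := by
    have := congrArg star hpn0
    rwa [star_mul, hps, star_zero] at this
  have hqsn : q * star n = 0 := by rw [hq, sub_mul, one_mul, hsp, sub_self]
  have hnn0 : n * n = 0 := by
    calc n * n = (n * p) * n := by rw [hnp]
      _ = 0 := by rw [mul_assoc, hpn0, mul_zero]
  have hss0 : star n * star n = 0 := by rw [← star_mul, hnn0, star_zero]
  have hne : n * e = q * e := by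
    have h1 : (1 - t) * e = p * e := by
      rw [ht, sub_mul, mul_assoc, hfe, hq, ← sub_mul]; congr 1; abel
    have h2 : v * (p * e) = e := by rw [← h1, ← mul_assoc, hvW, one_mul]
    rw [hn, mul_assoc, mul_assoc, h2]
  set K := n - star n with hK
  have hKs : star K = -K := by rw [hK]; simp
  have hKn : ‖K‖ ≤ 4 * κ := by
    have := norm_sub_le n (star n)
    rw [norm_star] at this
    linarith
  obtain ⟨R, hRs, hR1, hRn, hRc⟩ := exists_R (pos_star_mul K)
  have hy : star K * K = n * star n + star n * n := by
    rw [hKs, hK]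
    simp only [neg_mul, mul_sub, sub_mul, hnn0, hss0]; abel
  have hRK : R * K = K * R := hRc K (by rw [hKs]; noncomm_ring)
  have hRp : R * p = p * R := by
    apply hRc p
    rw [hy, add_mul, mul_add]
    congr 1
    · rw [mul_assoc, hsp0, ← mul_assoc p, hpn0]; simp
    · rw [mul_assoc, hnp, ← mul_assoc p, hsp]
  have hRq : q * R = R * q := by rw [hq, sub_mul, mul_sub, hRp]; simp
  refine ⟨R * (1 - K), ?_, ?_, ?_⟩
  · rw [star_mul, hRs, star_sub, star_one, hKs]
    have e1 : (1 - -K) * R = R * (1 - -K) := by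
      rw [sub_mul, mul_sub, mul_neg, neg_mul, hRK]; simp
    calc (1 - -K) * R * (R * (1 - K)) = R * (1 - -K) * (R * (1 - K)) := by rw [e1]
      _ = R * ((1 - -K) * R) * (1 - K) := by noncomm_ring
      _ = R * R * (1 + star K * K) := by rw [e1, hKs]; noncomm_ring
      _ = 1 := hR1
  · calc q * (R * (1 - K) * e) = (q * R) * ((1 - K) * e) := by noncomm_ring
      _ = R * (q * e - (q * n) * e + (q * star n) * e) := by rw [hRq, hK]; noncomm_ring
      _ = 0 := by rw [hqn', hqsn, hne]; simp
  · have e1 : R * (1 - K) - 1 = (R - 1) * (1 - K) - K := by noncomm_ring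
    have hyn : ‖star K * K‖ ≤ ‖K‖ := by
      rw [CStarRing.norm_star_mul_self]
      have : ‖K‖ ≤ 1 := by linarith
      nlinarith [norm_nonneg K]
    have h1K : ‖(1 : B) - K‖ ≤ 2 := by
      have := norm_sub_le (1 : B) K
      have h3 := norm_one_le' B
      linarith
    rw [e1]
    calc _ ≤ ‖(R - 1) * (1 - K)‖ + ‖K‖ := norm_sub_le _ _
      _ ≤ ‖R - 1‖ * ‖1 - K‖ + ‖K‖ := by gcongr; exact norm_mul_le _ _
      _ ≤ (4 * κ) * 2 + 4 * κ := by gcongr; linarith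
      _ = 12 * κ := by ring

end NucLocal

namespace NucLocal

lemma exists_ef {B : Type*} [CStarAlgebra B] {h : B} (hh : IsPosElem h) {τ : ℝ} (hτ : 0 < τ) :
    ∃ e w : B, ‖w‖ ≤ 1 / τ ∧ h * w * e = e ∧ star e = e ∧ ‖e‖ ≤ 1 ∧ ‖e - 1‖ ≤ 1 ∧ ‖(e - 1) * h‖ ≤ τ ∧
      ∀ b, h * b = b * h → e * b = b * e := by
  letI := CStarAlgebra.spectralOrder B
  haveI := CStarAlgebra.spectralOrderedRing B
  rw [pos_iff] at hh
  have hsa : IsSelfAdjoint h := IsSelfAdjoint.of_nonneg hh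
  have hsp : ∀ x ∈ spectrum ℝ h, 0 ≤ x ∧ x ≤ ‖h‖ := fun x hx => sp_bound hh hx
  set W : ℝ → ℝ := fun x => (max x τ)⁻¹ with hW
  set E : ℝ → ℝ := fun x => max (x - τ) 0 * (max x τ)⁻¹ with hE
  have hm : ∀ x : ℝ, 0 < max x τ := fun x => lt_max_of_lt_right hτ
  have hWc : Continuous W := by
    apply Continuous.inv₀
    · fun_prop
    · intro x; exact (hm x).ne'
  have hEc : Continuous E := by
    apply Continuous.mul
    · fun_prop
    · exact hWc
  have key : ∀ x, 0 ≤ x → 0 ≤ E x ∧ E x ≤ 1 ∧ (1 - E x) * x ≤ τ ∧ x * W x * E x = E x := by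
    intro x hx
    simp only [hE, hW]
    rcases le_total x τ with h1 | h1
    · rw [max_eq_right h1, max_eq_right (by linarith : x - τ ≤ 0)]
      simpa using h1
    · have hx0 : 0 < x := by linarith
      rw [max_eq_left h1, max_eq_left (by linarith : 0 ≤ x - τ)]
      have h2 : 0 ≤ x - τ := by linarith
      refine ⟨by positivity, ?_, ?_, ?_⟩
      · rw [← div_eq_mul_inv, div_le_one hx0]; linarith
      · apply le_of_eq; field_simp; ring
      · field_simp
  have e1 : cfc E h - 1 = cfc (fun x => E x - 1) h := by
    rw [cfc_sub E _ h (by fun_prop) (by fun_prop), cfc_const_one ℝ h]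
  refine ⟨cfc E h, cfc W h, ?_, ?_, ?_, ?_, ?_, ?_, ?_⟩
  · apply norm_cfc_le (by positivity)
    intro x hx
    rw [Real.norm_of_nonneg (inv_nonneg.2 (hm x).le), one_div]
    exact inv_anti₀ hτ (le_max_right _ _)
  · conv_lhs => rw [← cfc_id ℝ h]
    rw [cfc_id ℝ h]
    conv_lhs => enter [1, 1]; rw [← cfc_id' ℝ h]
    rw [← cfc_mul (fun x : ℝ => x) W h (by fun_prop) (by fun_prop),
      ← cfc_mul (fun x : ℝ => x * W x) E h (by fun_prop) (by fun_prop)]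
    apply cfc_congr
    intro x hx
    exact (key x (hsp x hx).1).2.2.2
  · exact (cfc_predicate (R := ℝ) _ h : IsSelfAdjoint _)
  · apply norm_cfc_le (by positivity)
    intro x hx
    have := key x (hsp x hx).1
    rw [Real.norm_of_nonneg this.1]; exact this.2.1
  · rw [e1]
    apply norm_cfc_le (by positivity)
    intro x hx
    have := key x (hsp x hx).1
    rw [Real.norm_eq_abs, abs_le]; constructor <;> linarith
  · rw [e1]
    conv_lhs => enter [1, 2]; rw [← cfc_id' ℝ h]
    rw [← cfc_mul (fun x : ℝ => E x - 1) (fun x => x) h (by fun_prop) (by fun_prop)]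
    apply norm_cfc_le (by positivity)
    intro x hx
    have h0 := (hsp x hx).1
    have := key x h0
    rw [Real.norm_eq_abs, abs_le]; constructor <;> nlinarith
  · intro b hb
    exact (Commute.cfc_real (show Commute h b from hb) _)

lemma corner_perturb (θ : ℝ) (hθ : 0 < θ) : ∃ κ₀ : ℝ, 0 < κ₀ ∧
    ∀ {B : Type} [CStarAlgebra B] {ι : Type} [Fintype ι] [DecidableEq ι] {m : ι → Type}
      [∀ i, Fintype (m i)] [∀ i, DecidableEq (m i)] {p : B} (hp : p * p = p) (hps : star p = p)
      (φ : FB ι m →ₗ[ℂ] B), IsCompletelyPositive φ → OZ φ → IsPosElem (1 - φ 1) →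
      ‖(1 - p) * φ 1‖ ≤ κ₀ → ∃ φ' : FB ι m →ₗ[ℂ] B, IsCompletelyPositive φ' ∧ OZ φ' ∧
        IsPosElem (1 - φ' 1) ∧ (∀ y, p * φ' y * p = φ' y) ∧ ∀ y, ‖φ' y - φ y‖ ≤ θ * ‖y‖ := by
  set τ : ℝ := (θ / 8) ^ 2 with hτ
  have hτ0 : 0 < τ := by positivity
  set κ : ℝ := min (1 / 4) (θ / 48) with hκ
  have hκ0 : 0 < κ := lt_min (by norm_num) (by positivity)
  refine ⟨κ * τ, by positivity, ?_⟩
  intro B _ ι _ _ m _ _ p hp hps φ hφ hoz h1 hsm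
  have hpos1 : IsPosElem (φ 1) := cp_pos hφ ⟨1, by simp⟩
  obtain ⟨e, w, hw, hfe, hes, hen, hen1, heh, hec⟩ := exists_ef hpos1 hτ0
  have hec' : ∀ y, e * φ y = φ y * e := fun y => hec _ (oz_comm hφ hoz y)
  obtain ⟨Q, hQ, hQe, hQn⟩ := unitary_Q (p := p) (e := e) (f := φ 1 * w) (κ := κ) hp hps hfe (by
    rw [← mul_assoc]
    calc _ ≤ ‖(1 - p) * φ 1‖ * ‖w‖ := norm_mul_le _ _
      _ ≤ (κ * τ) * (1 / τ) := by gcongr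
      _ = κ := by field_simp) (min_le_left _ _)
  have hQ1 : ‖Q‖ ≤ 1 := by
    have := CStarRing.norm_star_mul_self (x := Q)
    rw [hQ] at this
    have h3 := norm_one_le' B
    nlinarith [norm_nonneg Q]
  have hφn : ∀ y, ‖φ y‖ ≤ ‖y‖ := fun y => cp_norm_le' hφ h1 y
  have heφ : ∀ y, ‖(e - 1) * φ y‖ ≤ θ / 8 * ‖y‖ := by
    intro y
    have e1 : ((e - 1) * φ y) * star ((e - 1) * φ y) = ((e - 1) * φ 1) * φ (y * star y) * (e - 1) := by
      rw [star_mul, ← cp_star hφ, star_sub, hes, star_one]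
      calc _ = (e - 1) * (φ y * φ (star y)) * (e - 1) := by noncomm_ring
        _ = _ := by rw [oz_mul hφ hoz]; noncomm_ring
    have h2 := CStarRing.norm_self_mul_star (x := (e - 1) * φ y)
    rw [e1] at h2
    have h3 : ‖((e - 1) * φ 1) * φ (y * star y) * (e - 1)‖ ≤ τ * (‖y‖ * ‖y‖) * 1 := by
      calc _ ≤ ‖(e - 1) * φ 1‖ * ‖φ (y * star y)‖ * ‖e - 1‖ := norm_mul₃_le
        _ ≤ τ * (‖y‖ * ‖y‖) * 1 := by
          gcongr
          exact (hφn _).trans (CStarRing.norm_self_mul_star (x := y)).le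
    apply abs_le_of_sq_le_sq' _ (by positivity) |>.2
    rw [hτ] at h3
    nlinarith
  have hpQ : p * (Q * e) = Q * e := by
    rw [sub_mul, one_mul, sub_eq_zero] at hQe; exact hQe.symm
  have hval : ∀ y, conjMap φ (star (Q * e)) y = (Q * e) * φ y * star (Q * e) := by
    intro y; simp
  have hval' : ∀ y, conjMap φ (star (Q * e)) y = Q * (e * φ y * e) * star Q := by
    intro y; rw [hval, star_mul, hes]; noncomm_ring
  have hcp := cp_conj hφ (star (Q * e))
  refine ⟨conjMap φ (star (Q * e)), hcp, ?_, ?_, ?_, ?_⟩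
  · intro x y hxy hyx
    rw [hval', hval']
    calc _ = Q * (e * φ x * e) * (star Q * Q) * (e * φ y * e) * star Q := by noncomm_ring
      _ = Q * e * (φ x * e) * (e * φ y) * e * star Q := by rw [hQ]; noncomm_ring
      _ = Q * e * e * (φ x * φ y) * e * e * star Q := by
        rw [hec' y, ← hec' x]; noncomm_ring
      _ = 0 := by rw [hoz x y hxy hyx]; simp
  · apply pos_one_sub (cp_pos hcp ⟨1, by simp⟩)
    rw [hval']
    have a1 : ‖φ 1‖ ≤ 1 := norm_le_one_of_pos hpos1 h1
    calc _ ≤ ‖Q‖ * ‖e * φ 1 * e‖ * ‖star Q‖ := norm_mul₃_le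
      _ ≤ ‖Q‖ * (‖e‖ * ‖φ 1‖ * ‖e‖) * ‖star Q‖ := by gcongr; exact norm_mul₃_le
      _ ≤ 1 * (1 * 1 * 1) * 1 := by rw [norm_star]; gcongr
      _ = 1 := by norm_num
  · intro y
    rw [hval]
    have hpQ' : star (Q * e) * p = star (Q * e) := by
      conv_lhs => rw [← hps]
      rw [← star_mul, hpQ]
    calc _ = (p * (Q * e)) * φ y * (star (Q * e) * p) := by noncomm_ring
      _ = _ := by rw [hpQ, hpQ']
  · intro y
    rw [hval']
    have e1 : Q * (e * φ y * e) * star Q - φ y = (Q - 1) * (e * φ y * e) * star Q +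
        (e * φ y * e) * star (Q - 1) + (((e - 1) * φ y) * e + (e - 1) * φ y) := by
      have : (e - 1) * φ y = φ y * (e - 1) := by rw [sub_mul, mul_sub, hec' y]; simp
      nth_rewrite 2 [this]
      rw [star_sub, star_one]; noncomm_ring
    have hee : ‖e * φ y * e‖ ≤ ‖y‖ := by
      calc _ ≤ ‖e‖ * ‖φ y‖ * ‖e‖ := norm_mul₃_le
        _ ≤ 1 * ‖y‖ * 1 := by gcongr; exact hφn y
        _ = ‖y‖ := by ring
    have hκ2 : κ ≤ θ / 48 := min_le_right _ _
    rw [e1]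
    calc _ ≤ ‖(Q - 1) * (e * φ y * e) * star Q‖ + ‖(e * φ y * e) * star (Q - 1)‖ +
          (‖((e - 1) * φ y) * e‖ + ‖(e - 1) * φ y‖) := by
          refine (norm_add_le _ _).trans (add_le_add (norm_add_le _ _) (norm_add_le _ _))
      _ ≤ ‖Q - 1‖ * ‖e * φ y * e‖ * ‖star Q‖ + ‖e * φ y * e‖ * ‖star (Q - 1)‖ +
          (‖(e - 1) * φ y‖ * ‖e‖ + ‖(e - 1) * φ y‖) := by
          gcongr
          · exact norm_mul₃_le
          · exact norm_mul_le _ _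
          · exact norm_mul_le _ _
      _ ≤ (12 * κ) * ‖y‖ * 1 + ‖y‖ * (12 * κ) + ((θ / 8 * ‖y‖) * 1 + θ / 8 * ‖y‖) := by
          rw [norm_star, norm_star]
          gcongr
          · exact heφ y
          · exact heφ y
      _ ≤ θ * ‖y‖ := by nlinarith [norm_nonneg y]

end NucLocal

namespace NucLocal

lemma pos_diag {k : Type*} [Fintype k] [DecidableEq k] (r : k → ℝ) (hr : ∀ i, 0 ≤ r i) :
    IsPosElem (Matrix.diagonal (fun i => (r i : ℂ))) := by
  refine ⟨Matrix.diagonal (fun i => ((√(r i) : ℝ) : ℂ)), ?_⟩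
  rw [Matrix.star_eq_conjTranspose, Matrix.diagonal_conjTranspose, Matrix.diagonal_mul_diagonal]
  congr 1
  funext i
  simp only [Pi.star_apply, Complex.star_def, Complex.conj_ofReal, ← Complex.ofReal_mul,
    Real.mul_self_sqrt (hr i)]

lemma mat_cut {k : Type} [Fintype k] [DecidableEq k] (c : Matrix k k ℂ) (hc : IsPosElem c)
    {δ : ℝ} (hδ : 0 < δ) : ∃ (k' : Type) (_ : Fintype k') (_ : DecidableEq k') (V : Matrix k k' ℂ),
      V.conjTranspose * V = 1 ∧ IsPosElem (c - (δ : ℂ) • (V * V.conjTranspose)) ∧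
      ‖(1 - V * V.conjTranspose) * c‖ ≤ δ := by
  classical
  have hps : c.PosSemidef := by
    obtain ⟨y, rfl⟩ := hc
    exact Matrix.posSemidef_conjTranspose_mul_self y
  have hH := hps.isHermitian
  set lam := hH.eigenvalues with hlam
  have hl0 : ∀ i, 0 ≤ lam i := hps.eigenvalues_nonneg
  set U : Matrix k k ℂ := (hH.eigenvectorUnitary : Matrix k k ℂ) with hU
  have hUU : star U * U = 1 := Unitary.coe_star_mul_self hH.eigenvectorUnitary
  have hUU' : U * star U = 1 := Unitary.coe_mul_star_self hH.eigenvectorUnitary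
  have hcU : c = U * Matrix.diagonal (fun i => (lam i : ℂ)) * star U := by
    have := hH.spectral_theorem
    rw [Unitary.conjStarAlgAut_apply] at this
    exact this
  set χ : k → ℝ := fun i => if δ < lam i then 1 else 0 with hχ
  have hUn : ‖U‖ ≤ 1 := by
    have := CStarRing.norm_star_mul_self (x := U)
    rw [hUU] at this
    have h3 := norm_one_le' (Matrix k k ℂ)
    nlinarith [norm_nonneg U]
  refine ⟨{i : k // δ < lam i}, inferInstance, inferInstance, U.submatrix id Subtype.val, ?_, ?_⟩
  · rw [Matrix.conjTranspose_submatrix,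
      ← Matrix.submatrix_mul _ _ Subtype.val id Subtype.val Function.bijective_id,
      ← Matrix.star_eq_conjTranspose, hUU]
    exact Matrix.submatrix_one _ Subtype.val_injective
  have hg : U.submatrix id (Subtype.val : {i : k // δ < lam i} → k) *
      (U.submatrix id (Subtype.val : {i : k // δ < lam i} → k)).conjTranspose =
      U * Matrix.diagonal (fun i => (χ i : ℂ)) * star U := by
    ext a b
    rw [Matrix.mul_apply, Matrix.mul_apply]
    simp only [Matrix.submatrix_apply, Matrix.conjTranspose_apply, id, Matrix.mul_diagonal,
      Matrix.star_apply]
    have h1 := Finset.sum_subtype (p := fun i => δ < lam i) (F := inferInstance) (Finset.univ.filter fun i => δ < lam i)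
      (by simp) (fun j => U a j * star (U b j))
    refine h1.symm.trans ?_
    rw [Finset.sum_filter]
    refine Finset.sum_congr rfl fun j _ => ?_
    simp only [hχ]
    split_ifs <;> simp
  rw [hg]
  constructor
  · have e1 : c - (δ : ℂ) • (U * Matrix.diagonal (fun i => (χ i : ℂ)) * star U) =
        star (star U) * Matrix.diagonal (fun i => ((lam i - δ * χ i : ℝ) : ℂ)) * star U := by
      have e2 : Matrix.diagonal (fun i => ((lam i - δ * χ i : ℝ) : ℂ)) =
        Matrix.diagonal (fun i => (lam i : ℂ)) - (δ : ℂ) • Matrix.diagonal (fun i => (χ i : ℂ)) := by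
        rw [← Matrix.diagonal_smul, Matrix.diagonal_sub]
        congr 1; funext i; simp
      rw [e2, star_star]; conv_lhs => rw [hcU]
      rw [mul_sub, sub_mul, mul_smul_comm, smul_mul_assoc]
    rw [e1]
    apply pos_conj
    apply pos_diag
    intro i
    simp only [hχ]
    split_ifs with h
    · linarith
    · simpa using hl0 i
  · have e1 : (1 - U * Matrix.diagonal (fun i => (χ i : ℂ)) * star U) * c =
        U * Matrix.diagonal (fun i => (((1 - χ i) * lam i : ℝ) : ℂ)) * star U := by
      have e2 : Matrix.diagonal (fun i => (((1 - χ i) * lam i : ℝ) : ℂ)) =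
        (1 - Matrix.diagonal (fun i => (χ i : ℂ))) * Matrix.diagonal (fun i => (lam i : ℂ)) := by
        rw [← Matrix.diagonal_one, Matrix.diagonal_sub, Matrix.diagonal_mul_diagonal]
        congr 1; funext i; simp
      conv_lhs => rw [hcU]
      rw [e2]
      generalize Matrix.diagonal (fun i => (χ i : ℂ)) = X
      generalize Matrix.diagonal (fun i => (lam i : ℂ)) = Y
      calc _ = U * Y * star U - U * X * (star U * U) * Y * star U := by noncomm_ring
        _ = _ := by rw [hUU]; noncomm_ring
    rw [e1]
    calc _ ≤ ‖U‖ * ‖Matrix.diagonal (fun i => (((1 - χ i) * lam i : ℝ) : ℂ))‖ * ‖star U‖ := norm_mul₃_le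
      _ ≤ 1 * δ * 1 := by
        rw [norm_star, Matrix.l2_opNorm_diagonal]
        gcongr
        rw [pi_norm_le_iff_of_nonneg hδ.le]
        intro i
        rw [Complex.norm_real]
        simp only [hχ]
        split_ifs with h
        · simpa using hδ.le
        · push Not at h
          rw [sub_zero, one_mul, Real.norm_of_nonneg (hl0 i)]; exact h
      _ = δ := by ring

end NucLocal

namespace NucLocal

section Cut
variable {ι : Type} [Fintype ι] [DecidableEq ι] {m m' : ι → Type}
  [∀ i, Fintype (m i)] [∀ i, DecidableEq (m i)] [∀ i, Fintype (m' i)] [∀ i, DecidableEq (m' i)]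

/-- conjugation by a family of rectangular matrices -/
def adV (V : ∀ i, Matrix (m i) (m' i) ℂ) : FB ι m' →ₗ[ℂ] FB ι m where
  toFun y i := V i * y i * (V i).conjTranspose
  map_add' x y := by funext i; simp [Matrix.mul_add, Matrix.add_mul]
  map_smul' c y := by funext i; simp

lemma adV_apply (V : ∀ i, Matrix (m i) (m' i) ℂ) (y : FB ι m') (i : ι) :
    adV V y i = V i * y i * (V i).conjTranspose := rfl

lemma block_cut (c : FB ι m) (hc : IsPosElem c) (hc1 : IsPosElem (1 - c))
    {δ : ℝ} (hδ : 0 < δ) : ∃ (m' : ι → Type) (_ : ∀ i, Fintype (m' i)) (_ : ∀ i, DecidableEq (m' i))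
      (α : FB ι m' →ₗ[ℂ] FB ι m) (C : FB ι m → FB ι m') (g : FB ι m),
      IsCompletelyPositive α ∧ (∀ x y, α (x * y) = α x * α y) ∧ α 1 = g ∧ star g = g ∧ g * g = g ∧
      IsPosElem (c - (δ : ℂ) • g) ∧ ‖(1 - g) * c‖ ≤ δ ∧ (∀ x, α (C x) = g * x * g) ∧
      (∀ x, ‖C x‖ ≤ ‖x‖) ∧ IsPosElem (C c) ∧ IsPosElem (1 - C c) ∧
      (∀ y i, α (Pi.single i (y i)) = Pi.single i (α y i)) := by
  classical
  have hcp : ∀ i, IsPosElem (c i) := by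
    obtain ⟨y, rfl⟩ := hc
    exact fun i => ⟨y i, rfl⟩
  choose m' i1 i2 V hV hpos hn using fun i => mat_cut (c i) (hcp i) hδ
  have hVn : ∀ i, ‖V i‖ ≤ 1 := by
    intro i
    have := Matrix.l2_opNorm_conjTranspose_mul_self (V i)
    rw [hV i] at this
    have h3 := norm_one_le' (Matrix (m' i) (m' i) ℂ)
    nlinarith [norm_nonneg (V i)]
  have hmul : ∀ x y, adV V (x * y) = adV V x * adV V y := by
    intro x y
    funext i
    rw [Pi.mul_apply, adV_apply, adV_apply, adV_apply, Pi.mul_apply]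
    calc _ = V i * x i * (1 : Matrix (m' i) (m' i) ℂ) * y i * (V i).conjTranspose := by simp only [Matrix.mul_assoc, Matrix.one_mul]
      _ = _ := by rw [← hV i]; simp only [Matrix.mul_assoc]
  have hstar : ∀ x, adV V (star x) = star (adV V x) := by
    intro x
    funext i
    rw [Pi.star_apply, adV_apply, adV_apply, Pi.star_apply, Matrix.star_eq_conjTranspose,
      Matrix.star_eq_conjTranspose]
    simp [Matrix.conjTranspose_mul, Matrix.mul_assoc]
  have hg : ∀ i, adV V 1 i = V i * (V i).conjTranspose := by
    intro i; rw [adV_apply]; simp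
  have hpc : ∀ x : FB ι m, IsPosElem x →
      IsPosElem (fun i => (V i).conjTranspose * x i * V i : FB ι m') := by
    rintro x ⟨y, rfl⟩
    apply pos_pi
    intro i
    have : ((y i * V i).conjTranspose * (y i * V i)).PosSemidef :=
      Matrix.posSemidef_conjTranspose_mul_self _
    have h2 : (V i).conjTranspose * (star y * y) i * V i = (y i * V i).conjTranspose * (y i * V i) := by
      rw [Pi.mul_apply, Pi.star_apply, Matrix.star_eq_conjTranspose, Matrix.conjTranspose_mul]
      simp only [Matrix.mul_assoc]
    rw [h2]
    open scoped MatrixOrder in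
    exact CStarAlgebra.nonneg_iff_eq_star_mul_self.1 this.nonneg
  refine ⟨m', i1, i2, adV V, fun x i => (V i).conjTranspose * x i * V i, adV V 1,
    cp_of_hom _ hmul hstar, hmul, rfl, ?_, ?_, ?_, ?_, ?_, ?_, hpc c hc, ?_, ?_⟩
  · rw [← hstar, star_one]
  · rw [← hmul, one_mul]
  · apply pos_pi
    intro i
    have := hpos i
    rw [← hg] at this
    exact this
  · rw [pi_norm_le_iff_of_nonneg hδ.le]
    intro i
    have := hn i
    rw [← hg] at this
    exact this
  · intro x
    funext i
    rw [Pi.mul_apply, Pi.mul_apply, hg, adV_apply]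
    simp only [Matrix.mul_assoc]
  · intro x
    rw [pi_norm_le_iff_of_nonneg (norm_nonneg _)]
    intro i
    calc ‖(V i).conjTranspose * x i * V i‖ ≤ ‖(V i).conjTranspose * x i‖ * ‖V i‖ :=
          Matrix.l2_opNorm_mul _ _
      _ ≤ ‖(V i).conjTranspose‖ * ‖x i‖ * ‖V i‖ := by gcongr; exact Matrix.l2_opNorm_mul _ _
      _ ≤ 1 * ‖x‖ * 1 := by
        rw [Matrix.l2_opNorm_conjTranspose]
        gcongr
        · exact hVn i
        · exact norm_le_pi_norm x i
        · exact hVn i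
      _ = ‖x‖ := by ring
  · have := hpc _ hc1
    convert this using 1
    funext i
    rw [Pi.sub_apply, Pi.sub_apply, Pi.one_apply, Pi.one_apply, Matrix.mul_sub, Matrix.sub_mul,
      Matrix.mul_one, hV i]
  · intro y i
    funext l
    rw [adV_apply]
    by_cases h : l = i
    · subst h; simp [adV_apply]
    · simp [h]

end Cut
end NucLocal

namespace NucLocal

lemma psi_est {B D : Type*} [CStarAlgebra B] [CStarAlgebra D] {ψ : B →ₗ[ℂ] D}
    (hψ : IsCompletelyPositive ψ) (h1 : IsPosElem (1 - ψ 1)) {p a : B} {g : D} {s : ℝ} (hs : 0 ≤ s)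
    (hps : star p = p) (hp : p * p = p) (hgs : star g = g) (hg : g * g = g) (hpg : ‖(1 - g) * ψ p‖ ≤ s ^ 2)
    (hpa : p * a = a) : ‖(1 - g) * ψ a‖ ≤ s * ‖a‖ := by
  letI := CStarAlgebra.spectralOrder D
  haveI := CStarAlgebra.spectralOrderedRing D
  letI := CStarAlgebra.spectralOrder B
  haveI := CStarAlgebra.spectralOrderedRing B
  have hq1 : (1 - g) * (1 - g) = 1 - g := by simp [mul_sub, sub_mul, hg]
  have hq2 : star (1 - g) = 1 - g := by simp [hgs]
  rw [pos_iff, sub_nonneg] at h1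
  have hap : star a * p = star a := by rw [← hps, ← star_mul, hpa]
  have haa : a * star a ≤ ((‖a‖ ^ 2 : ℝ) : ℂ) • p := by
    have h2 := CStarAlgebra.star_mul_le_algebraMap_norm_sq (a := star a)
    have h3 := star_left_conjugate_le_conjugate h2 p
    rw [hps, star_star, norm_star] at h3
    have e1 : p * (a * star a) * p = a * star a := by
      rw [← mul_assoc, hpa, mul_assoc, hap]
    rw [e1, Algebra.algebraMap_eq_smul_one, mul_smul_comm, mul_one, smul_mul_assoc, hp] at h3
    rw [Complex.coe_smul]
    exact h3
  have hm := cp_mono hψ haa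
  rw [map_smul] at hm
  have hk := kadison hψ h1 (star a)
  rw [star_star] at hk
  replace hk := hk.trans hm
  have hk2 := star_left_conjugate_le_conjugate hk (1 - g)
  rw [hq2] at hk2
  have e2 : (1 - g) * (star (ψ (star a)) * ψ (star a)) * (1 - g) =
      star (ψ (star a) * (1 - g)) * (ψ (star a) * (1 - g)) := by
    rw [star_mul, hq2]; noncomm_ring
  rw [e2] at hk2
  have h4 := norm_sq_le_of hk2
  have e3 : ‖(1 - g) * ψ a‖ = ‖ψ (star a) * (1 - g)‖ := by
    rw [← norm_star, star_mul, hq2, cp_star hψ]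
  rw [e3]
  refine (abs_le_of_sq_le_sq' (h4.trans ?_) (by positivity)).2
  rw [mul_smul_comm, smul_mul_assoc, norm_smul, Complex.norm_real, Real.norm_of_nonneg (by positivity)]
  have h5 : ‖(1 - g) * ψ p * (1 - g)‖ ≤ s ^ 2 * 1 := (norm_mul_le _ _).trans
    (mul_le_mul hpg (proj_norm_le hq1 hq2) (norm_nonneg _) (by positivity))
  rw [mul_pow, mul_comm]
  nlinarith [sq_nonneg ‖a‖]

lemma psi_est2 {B D : Type*} [CStarAlgebra B] [CStarAlgebra D] {ψ : B →ₗ[ℂ] D}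
    (hψ : IsCompletelyPositive ψ) (h1 : IsPosElem (1 - ψ 1)) {p a : B} {g : D} {s : ℝ} (hs : 0 ≤ s)
    (hps : star p = p) (hp : p * p = p) (hgs : star g = g) (hg : g * g = g) (hpg : ‖(1 - g) * ψ p‖ ≤ s ^ 2)
    (hpa : p * a = a) (hap : a * p = a) : ‖g * ψ a * g - ψ a‖ ≤ 2 * s * ‖a‖ := by
  have e1 := psi_est hψ h1 hs hps hp hgs hg hpg hpa
  have e2 := psi_est hψ h1 hs hps hp hgs hg hpg (a := star a) (by rw [← hps, ← star_mul, hap])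
  have e3 : ‖ψ a * (1 - g)‖ = ‖(1 - g) * ψ (star a)‖ := by
    rw [← norm_star, star_mul, cp_star hψ]; simp [hgs]
  rw [← e3, norm_star] at e2
  have e4 : g * ψ a * g - ψ a = -(g * (ψ a * (1 - g)) + (1 - g) * ψ a) := by noncomm_ring
  rw [e4, norm_neg]
  calc _ ≤ ‖g * (ψ a * (1 - g))‖ + ‖(1 - g) * ψ a‖ := norm_add_le _ _
    _ ≤ 1 * (s * ‖a‖) + s * ‖a‖ := by
      gcongr
      exact (norm_mul_le _ _).trans (mul_le_mul (proj_norm_le hg hgs) e2 (norm_nonneg _) (by norm_num))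
    _ = _ := by ring

/-- the range of the compressed map almost lies in the corner -/
lemma range_est {B D : Type*} [CStarAlgebra B] [CStarAlgebra D] {n : ℕ} {φ : Fin (n + 1) → D →ₗ[ℂ] B}
    (hφ : ∀ j, IsCompletelyPositive (φ j)) (h1 : ∀ j, IsPosElem (1 - φ j 1)) {p : B} {g c : D}
    {δ ε : ℝ} (hδ : 0 < δ) (hε : 0 < ε)
    (hps : star p = p) (hp : p * p = p) (hgs : star g = g) (hg : g * g = g) (hc : IsPosElem c)
    (hcg : IsPosElem (c - (δ : ℂ) • g)) (hs : ‖∑ j, φ j c - p‖ ≤ ε) (j : Fin (n + 1)) :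
    ‖(1 - p) * φ j g‖ ^ 2 ≤ ε / δ := by
  letI := CStarAlgebra.spectralOrder D
  haveI := CStarAlgebra.spectralOrderedRing D
  letI := CStarAlgebra.spectralOrder B
  haveI := CStarAlgebra.spectralOrderedRing B
  set q := 1 - p with hq
  have hq1 : q * q = q := by simp [hq, mul_sub, sub_mul, hp]
  have hq2 : star q = q := by simp [hq, hps]
  have hqp : q * p = 0 := by simp [hq, sub_mul, hp]
  have h1j := h1 j
  rw [pos_iff, sub_nonneg] at h1j
  have hk := kadison (hφ j) h1j g
  rw [hgs, hg] at hk
  have hk2 := star_left_conjugate_le_conjugate hk q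
  rw [hq2] at hk2
  have hgst : star (φ j g) = φ j g := by rw [← cp_star (hφ j), hgs]
  have e2 : q * (star (φ j g) * φ j g) * q = star (φ j g * q) * (φ j g * q) := by
    rw [star_mul, hq2]; noncomm_ring
  rw [e2] at hk2
  have h4 := norm_sq_le_of hk2
  have e3 : ‖q * φ j g‖ = ‖φ j g * q‖ := by
    rw [← norm_star, star_mul, hq2, hgst]
  rw [e3]
  refine h4.trans ?_
  rw [le_div_iff₀ hδ]
  rw [pos_iff, sub_nonneg] at hcg
  have h5 := cp_mono (hφ j) hcg
  have h6 : φ j c ≤ ∑ j, φ j c := Finset.single_le_sum (f := fun j => φ j c)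
    (fun i _ => pos_iff.1 (cp_pos (hφ i) hc)) (Finset.mem_univ j)
  have h7 := star_left_conjugate_le_conjugate (h5.trans h6) q
  rw [hq2] at h7
  have h8 : 0 ≤ q * φ j ((δ : ℂ) • g) * q := by
    have hgp : IsPosElem (φ j g) := cp_pos (hφ j) ⟨g, by rw [hgs, hg]⟩
    have := pos_iff.1 (pos_conj hgp q)
    rw [hq2] at this
    rw [map_smul, mul_smul_comm, smul_mul_assoc, Complex.coe_smul]
    exact smul_nonneg hδ.le this
  have h9 := CStarAlgebra.norm_le_norm_of_nonneg_of_le h8 h7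
  rw [map_smul, mul_smul_comm, smul_mul_assoc, norm_smul, Complex.norm_real, Real.norm_of_nonneg hδ.le] at h9
  rw [mul_comm]
  refine h9.trans ?_
  have e5 : q * (∑ j, φ j c) * q = q * (∑ j, φ j c - p) * q := by
    rw [mul_sub q, hqp, sub_zero]
  rw [e5]
  have hqn := proj_norm_le hq1 hq2
  calc _ ≤ ‖q‖ * ‖∑ j, φ j c - p‖ * ‖q‖ := norm_mul₃_le
    _ ≤ 1 * ε * 1 := by gcongr
    _ = ε := by ring

end NucLocal

namespace NucLocal

lemma corner_core {n : ℕ} {B : Type} [CStarAlgebra B] (hB : NuclearDimensionLE n B) {p : B}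
    (hp : p * p = p) (hps : star p = p) (S : Finset B) (hS : ∀ a ∈ S, p * a * p = a)
    (ε : ℝ) (hε : 0 < ε) : ∃ (ι : Type) (_ : Fintype ι) (_ : DecidableEq ι)
    (m : ι → Type) (_ : ∀ i, Fintype (m i)) (_ : ∀ i, DecidableEq (m i))
    (φ : Fin (n + 1) → FB ι m →ₗ[ℂ] B) (d : FB ι m) (x : B → FB ι m),
    (∀ j, IsCompletelyPositive (φ j)) ∧ (∀ j, OZ (φ j)) ∧ (∀ j, IsPosElem (1 - φ j 1)) ∧
    (∀ j y, p * φ j y * p = φ j y) ∧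
    IsPosElem d ∧ IsPosElem (1 - d) ∧
    ∀ a ∈ S,
      (∀ j i, ‖φ j (Pi.single i (x a i)) - φ j (Pi.single i (d i)) * a‖ ≤ ε) ∧
      (∀ j i, ‖φ j (Pi.single i (x a i)) - a * φ j (Pi.single i (d i))‖ ≤ ε) ∧
      ‖∑ j, φ j (x a) - a‖ ≤ ε := by
  classical
  set K : ℝ := 1 + ∑ a ∈ S, ‖a‖ with hK
  have hKa : ∀ a ∈ S, ‖a‖ ≤ K := fun a ha => by
    have := Finset.single_le_sum (f := fun a : B => ‖a‖) (fun a _ => norm_nonneg a) ha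
    linarith
  have hK1 : 1 ≤ K := by
    have : 0 ≤ ∑ a ∈ S, ‖a‖ := Finset.sum_nonneg fun a _ => norm_nonneg a
    linarith
  set s : ℝ := ε / (16 * K * (n + 1)) with hs
  have hs0 : 0 < s := by positivity
  have hsK : s * K * (n + 1) = ε / 16 := by rw [hs]; field_simp
  have hsK1 : s * K ≤ ε / 16 := by
    rw [← hsK]
    have : (0 : ℝ) ≤ n := n.cast_nonneg
    nlinarith [mul_pos hs0 (by linarith : 0 < K)]
  obtain ⟨κ₀, hκ, hcorner⟩ := corner_perturb s hs0
  set ε₀ : ℝ := min (ε / (4 * K)) (s ^ 2 * κ₀ ^ 2) with hε₀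
  have hε0 : 0 < ε₀ := lt_min (by positivity) (by positivity)
  have hεK : ε₀ * K ≤ ε / 4 := by
    calc ε₀ * K ≤ ε / (4 * K) * K := by gcongr; exact min_le_left _ _
      _ = ε / 4 := by field_simp
  have hεK' : ε₀ ≤ ε₀ * K := le_mul_of_one_le_right hε0.le hK1
  obtain ⟨ι, i1, i2, m, i3, i4, ψ, φ, hψ, hψ1, hφ, hoz, hφ1, hest⟩ :=
    nuc_data hB (insert p S) ε₀ hε0
  obtain ⟨hp1, hp2, hp3⟩ := hest p (Finset.mem_insert_self _ _)
  letI := CStarAlgebra.spectralOrder B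
  haveI := CStarAlgebra.spectralOrderedRing B
  have hpn := proj_norm_le hp hps
  have hppos : IsPosElem p := ⟨p, by rw [hps, hp]⟩
  have hc : IsPosElem (ψ p) := cp_pos hψ hppos
  have hψn : ∀ a, ‖ψ a‖ ≤ ‖a‖ := fun a => cp_norm_le' hψ hψ1 a
  have hc1 : IsPosElem (1 - ψ p) := pos_one_sub hc ((hψn p).trans hpn)
  obtain ⟨m', i5, i6, α, C, g, hα, hαm, hα1, hgs, hg, hcg, hgc, hαC, hCn, hCc, hCc1, hαs⟩ :=
    block_cut (ψ p) hc hc1 (δ := s ^ 2) (by positivity)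
  have hφn : ∀ j y, ‖φ j y‖ ≤ ‖y‖ := fun j y => cp_norm_le' (hφ j) (hφ1 j) y
  have hpert : ∀ j, ∃ φ' : FB ι m' →ₗ[ℂ] B, IsCompletelyPositive φ' ∧ OZ φ' ∧
        IsPosElem (1 - φ' 1) ∧ (∀ y, p * φ' y * p = φ' y) ∧
        ∀ y, ‖φ' y - ((φ j).comp α) y‖ ≤ s * ‖y‖ := by
    intro j
    have hgpos : IsPosElem (φ j g) := cp_pos (hφ j) ⟨g, by rw [hgs, hg]⟩
    apply hcorner hp hps
    · exact cp_comp (hφ j) hα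
    · intro x y hxy hyx
      simp only [LinearMap.comp_apply]
      apply hoz j
      · rw [← hαm, hxy, map_zero]
      · rw [← hαm, hyx, map_zero]
    · rw [LinearMap.comp_apply, hα1]
      exact pos_one_sub hgpos ((hφn j g).trans (proj_norm_le hg hgs))
    · rw [LinearMap.comp_apply, hα1]
      have h1 := range_est hφ hφ1 (δ := s ^ 2) (by positivity) hε0 hps hp hgs hg hc hcg hp3 j
      refine (abs_le_of_sq_le_sq' (h1.trans ?_) hκ.le).2
      rw [div_le_iff₀ (by positivity), mul_comm]
      exact min_le_right _ _
  choose φ' hφ' hoz' hφ1' hcor hnear using hpert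
  have hE : ∀ a, p * a * p = a → ∀ j, ‖φ' j (C (ψ a)) - φ j (ψ a)‖ ≤ 3 * s * ‖a‖ ∧
      ∀ i, ‖φ' j (Pi.single i (C (ψ a) i)) - φ j (Pi.single i (ψ a i))‖ ≤ 3 * s * ‖a‖ := by
    intro a ha j
    have hpa : p * a = a := by rw [← ha]; simp only [← mul_assoc, hp]
    have hap : a * p = a := by rw [← ha]; simp only [mul_assoc, hp]
    have h2 := psi_est2 hψ hψ1 hs0.le hps hp hgs hg hgc hpa hap
    have hCa : ‖C (ψ a)‖ ≤ ‖a‖ := (hCn _).trans (hψn a)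
    constructor
    · have h3 := hnear j (C (ψ a))
      rw [LinearMap.comp_apply, hαC] at h3
      have h4 := hφn j (g * ψ a * g - ψ a)
      rw [map_sub] at h4
      have h5 := norm_sub_le_norm_sub_add_norm_sub (φ' j (C (ψ a))) (φ j (g * ψ a * g)) (φ j (ψ a))
      have h6 : s * ‖C (ψ a)‖ ≤ s * ‖a‖ := by gcongr
      linarith
    · intro i
      have h3 := hnear j (Pi.single i (C (ψ a) i))
      rw [LinearMap.comp_apply, hαs, hαC] at h3
      have h4 := hφn j (Pi.single i ((g * ψ a * g - ψ a) i))
      have h7 : (Pi.single i ((g * ψ a * g - ψ a) i) : FB ι m) =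
        Pi.single i ((g * ψ a * g) i) - Pi.single i (ψ a i) := by
        rw [← Pi.single_sub]; rfl
      have h8 := norm_single_le i (g * ψ a * g - ψ a)
      have h9 := norm_single_le i (C (ψ a))
      have h4' := h4
      rw [h7, map_sub] at h4'
      rw [h7] at h8
      have h5 := norm_sub_le_norm_sub_add_norm_sub (φ' j (Pi.single i (C (ψ a) i)))
        (φ j (Pi.single i ((g * ψ a * g) i))) (φ j (Pi.single i (ψ a i)))
      have h6 : s * ‖(Pi.single i (C (ψ a) i) : FB ι m')‖ ≤ s * ‖a‖ := by
        gcongr; exact h9.trans hCa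
      rw [h7] at h4
      linarith
  have hpp : p * p * p = p := by rw [hp, hp]
  have hpE : ∀ j i, ‖φ' j (Pi.single i (C (ψ p) i)) - φ j (Pi.single i (ψ p i))‖ ≤ 3 * s :=
    fun j i => ((hE p hpp j).2 i).trans (by nlinarith)
  refine ⟨ι, i1, i2, m', i5, i6, φ', C (ψ p), fun a => C (ψ a), hφ', hoz', hφ1', hcor, hCc, hCc1, ?_⟩
  intro a ha
  obtain ⟨ha1, ha2, ha3⟩ := hest a (Finset.mem_insert_of_mem ha)
  have hac := hS a ha
  have hpa : p * a = a := by rw [← hac]; simp only [← mul_assoc, hp]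
  have hap : a * p = a := by rw [← hac]; simp only [mul_assoc, hp]
  have haK := hKa a ha
  have h3sK : 3 * s * ‖a‖ ≤ 3 * (s * K) := by
    rw [mul_assoc]; gcongr
  refine ⟨?_, ?_, ?_⟩
  · intro j i
    have t1 := (hE a hac j).2 i
    have t2 := ha1 j i
    have t3 : ‖(φ j (Pi.single i (ψ p i)) - φ j (Pi.single i (ψ 1 i)) * p) * a‖ ≤ ε₀ * K :=
      (norm_mul_le _ _).trans (mul_le_mul (hp1 j i) haK (norm_nonneg _) hε0.le)
    have t4 : ‖(φ' j (Pi.single i (C (ψ p) i)) - φ j (Pi.single i (ψ p i))) * a‖ ≤ 3 * s * K :=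
      (norm_mul_le _ _).trans (mul_le_mul (hpE j i) haK (norm_nonneg _) (by positivity))
    have e : φ' j (Pi.single i (C (ψ a) i)) - φ' j (Pi.single i (C (ψ p) i)) * a =
      (φ' j (Pi.single i (C (ψ a) i)) - φ j (Pi.single i (ψ a i))) +
      (φ j (Pi.single i (ψ a i)) - φ j (Pi.single i (ψ 1 i)) * a) -
      (φ j (Pi.single i (ψ p i)) - φ j (Pi.single i (ψ 1 i)) * p) * a -
      (φ' j (Pi.single i (C (ψ p) i)) - φ j (Pi.single i (ψ p i))) * a := by
      simp only [sub_mul, mul_assoc, hpa]; abel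
    rw [e]
    refine (norm_sub_le _ _).trans ?_
    have u1 := norm_sub_le ((φ' j (Pi.single i (C (ψ a) i)) - φ j (Pi.single i (ψ a i))) +
      (φ j (Pi.single i (ψ a i)) - φ j (Pi.single i (ψ 1 i)) * a))
      ((φ j (Pi.single i (ψ p i)) - φ j (Pi.single i (ψ 1 i)) * p) * a)
    have u2 := norm_add_le (φ' j (Pi.single i (C (ψ a) i)) - φ j (Pi.single i (ψ a i)))
      (φ j (Pi.single i (ψ a i)) - φ j (Pi.single i (ψ 1 i)) * a)
    linarith
  · intro j i
    have t1 := (hE a hac j).2 i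
    have t2 := ha2 j i
    have t3 : ‖a * (φ j (Pi.single i (ψ p i)) - p * φ j (Pi.single i (ψ 1 i)))‖ ≤ K * ε₀ :=
      (norm_mul_le _ _).trans (mul_le_mul haK (hp2 j i) (norm_nonneg _) (by positivity))
    have t4 : ‖a * (φ' j (Pi.single i (C (ψ p) i)) - φ j (Pi.single i (ψ p i)))‖ ≤ K * (3 * s) :=
      (norm_mul_le _ _).trans (mul_le_mul haK (hpE j i) (norm_nonneg _) (by positivity))
    have e : φ' j (Pi.single i (C (ψ a) i)) - a * φ' j (Pi.single i (C (ψ p) i)) =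
      (φ' j (Pi.single i (C (ψ a) i)) - φ j (Pi.single i (ψ a i))) +
      (φ j (Pi.single i (ψ a i)) - a * φ j (Pi.single i (ψ 1 i))) -
      a * (φ j (Pi.single i (ψ p i)) - p * φ j (Pi.single i (ψ 1 i))) -
      a * (φ' j (Pi.single i (C (ψ p) i)) - φ j (Pi.single i (ψ p i))) := by
      simp only [mul_sub, ← mul_assoc, hap]; abel
    rw [e]
    refine (norm_sub_le _ _).trans ?_
    have u1 := norm_sub_le ((φ' j (Pi.single i (C (ψ a) i)) - φ j (Pi.single i (ψ a i))) +
      (φ j (Pi.single i (ψ a i)) - a * φ j (Pi.single i (ψ 1 i))))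
      (a * (φ j (Pi.single i (ψ p i)) - p * φ j (Pi.single i (ψ 1 i))))
    have u2 := norm_add_le (φ' j (Pi.single i (C (ψ a) i)) - φ j (Pi.single i (ψ a i)))
      (φ j (Pi.single i (ψ a i)) - a * φ j (Pi.single i (ψ 1 i)))
    linarith
  · have e : ∑ j, φ' j (C (ψ a)) - a =
      ∑ j, (φ' j (C (ψ a)) - φ j (ψ a)) + (∑ j, φ j (ψ a) - a) := by
      rw [Finset.sum_sub_distrib]; abel
    have h1 : ‖∑ j, (φ' j (C (ψ a)) - φ j (ψ a))‖ ≤ ∑ j : Fin (n + 1), 3 * (s * K) :=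
      norm_sum_le_of_le _ fun j _ => ((hE a hac j).1).trans h3sK
    rw [Finset.sum_const, Finset.card_univ, Fintype.card_fin, nsmul_eq_mul] at h1
    push_cast at h1
    simp only
    rw [e]
    refine (norm_add_le _ _).trans ?_
    nlinarith

end NucLocal

namespace NucLocal

lemma pos_reflect {A B : Type*} [CStarAlgebra A] [CStarAlgebra B] (f : A →⋆ₙₐ[ℂ] B)
    (hf : Function.Injective f) {X : A} (h : IsPosElem (f X)) : IsPosElem X := by
  letI := CStarAlgebra.spectralOrder A
  haveI := CStarAlgebra.spectralOrderedRing A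
  letI := CStarAlgebra.spectralOrder B
  haveI := CStarAlgebra.spectralOrderedRing B
  have hX : star X = X := hf (by rw [map_star, pos_star h])
  have hsa : IsSelfAdjoint X := hX
  have hN0 : 0 ≤ X⁻ := CFC.negPart_nonneg X
  set N := X⁻ with hN
  have hNs : star N = N := (IsSelfAdjoint.of_nonneg hN0 : IsSelfAdjoint N)
  have hNX : N * X * N = -(N * N * N) := by
    conv_lhs => rw [← CFC.posPart_sub_negPart X hsa]
    rw [mul_sub, CFC.negPart_mul_posPart]; simp [hN]
  have h1 := pos_conj h (f N)
  have h2 : IsPosElem (f (N * N * N)) := by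
    obtain ⟨y, hy⟩ := pos_conj (pos_iff.2 hN0) N
    rw [hNs] at hy
    rw [hy]
    exact ⟨f y, by rw [map_mul, map_star]⟩
  rw [← map_star, hNs, ← map_mul, ← map_mul, hNX, map_neg, pos_iff] at h1
  rw [pos_iff] at h2
  have h3 : f (N * N * N) = 0 := le_antisymm (neg_nonneg.1 h1) h2
  have h4 : N * N * N = 0 := hf (by rw [h3, map_zero])
  have h5 : N * N = 0 := by
    rw [← CStarRing.star_mul_self_eq_zero_iff, star_mul, hNs, ← mul_assoc, h4, zero_mul]
  have h6 : N = 0 := by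
    rw [← CStarRing.star_mul_self_eq_zero_iff, hNs, h5]
  rw [pos_iff]
  exact (CFC.negPart_eq_zero_iff X hsa).1 h6

theorem good_corner {n : ℕ} {B B' : Type} [CStarAlgebra B] [CStarAlgebra B'] (hB : NuclearDimensionLE n B)
    {p : B} (hp : p * p = p) (hps : star p = p) (f : B' →⋆ₙₐ[ℂ] B) (hf : Function.Injective f)
    (hr : Set.range f = {x | p * x * p = x}) : Good n B' := by
  classical
  intro S ε hε
  have hfr : ∀ a, p * f a * p = f a := fun a => by
    have : f a ∈ Set.range f := ⟨a, rfl⟩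
    rw [hr] at this; exact this
  obtain ⟨ι, i1, i2, m, i3, i4, φ, d, x, h1, h2, h3, hcor, hd, hd1, hest⟩ :=
    corner_core hB hp hps (S.image f) (by simp only [Finset.mem_image]; rintro _ ⟨a, -, rfl⟩; exact hfr a) ε hε
  have hex : ∀ j y, ∃ b, f b = φ j y := fun j y => by
    have : φ j y ∈ Set.range f := by rw [hr]; exact hcor j y
    exact this
  choose F hF using hex
  let Φ : Fin (n + 1) → FB ι m →ₗ[ℂ] B' := fun j =>
    { toFun := F j
      map_add' := fun y z => hf (by rw [hF, map_add, map_add, hF, hF])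
      map_smul' := fun c y => hf (by rw [hF, map_smul, RingHom.id_apply, map_smul, hF]) }
  have hΦ : ∀ j y, f (Φ j y) = φ j y := fun j y => hF j y
  have hnorm : ∀ b, ‖f b‖ = ‖b‖ := fun b => NonUnitalStarAlgHom.norm_map f hf b
  have hcp : ∀ j, IsCompletelyPositive (Φ j) := by
    intro j k X hX
    letI := CStarAlgebra.spectralOrder B
    haveI := CStarAlgebra.spectralOrderedRing B
    letI := CStarAlgebra.spectralOrder B'
    haveI := CStarAlgebra.spectralOrderedRing B'
    have := h1 j k X hX
    refine pos_reflect (A := CStarMatrix (Fin k) (Fin k) B') (B := CStarMatrix (Fin k) (Fin k) B)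
      (CStarMatrix.mapₙₐ f) ?_ ?_
    · intro M N h
      refine CStarMatrix.ext fun a b => ?_
      have := congrFun (congrFun h a) b
      exact hf this
    · obtain ⟨y, hy⟩ := this
      refine ⟨y, Eq.trans ?_ hy⟩
      exact Matrix.ext fun a b => hΦ j (X a b)
  refine ⟨ι, i1, i2, m, i3, i4, Φ, fun _ => d, fun _ a => x (f a), hcp, ?_, ?_, fun _ => hd,
    fun _ => hd1, ?_⟩
  · intro j y z hyz hzy
    apply hf
    rw [map_mul, hΦ, hΦ, h2 j y z hyz hzy, map_zero]
  · intro j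
    apply pos_one_sub (cp_pos (hcp j) ⟨1, by simp⟩)
    rw [← hnorm, hΦ]
    exact norm_le_one_of_pos (cp_pos (h1 j) ⟨1, by simp⟩) (h3 j)
  · intro a ha
    obtain ⟨e1, e2, e3⟩ := hest (f a) (Finset.mem_image_of_mem f ha)
    refine ⟨fun j i => ?_, fun j i => ?_, ?_⟩
    · rw [← hnorm, map_sub, map_mul, hΦ, hΦ]; exact e1 j i
    · rw [← hnorm, map_sub, map_mul, hΦ, hΦ]; exact e2 j i
    · rw [← hnorm, map_sub, map_sum]
      simp only [hΦ]; exact e3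

end NucLocal

namespace NucLocal

theorem nuc_of_finSat {n : ℕ} {B : CStarAlg} (h : FinSat (nucClass n) B) :
    NuclearDimensionLE n B.carrier := by
  induction h with
  | base h => exact h.2
  | iso _ e ih =>
    obtain ⟨e⟩ := e
    exact nuc_of_good (good_iso (good_of_nuc ih) e.symm)
  | sum _ _ e ih1 ih2 =>
    obtain ⟨e⟩ := e
    exact nuc_of_good (good_iso (good_prod (good_of_nuc ih1) (good_of_nuc ih2)) e.symm)
  | @matrix B B' k _ e ih =>
    obtain ⟨e⟩ := e
    letI := CStarAlgebra.spectralOrder B.carrier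
    haveI := CStarAlgebra.spectralOrderedRing B.carrier
    exact nuc_of_good (good_iso (good_matrix (κ := Fin (k + 1)) (good_of_nuc ih))
      (CStarMatrix.ofMatrixStarAlgEquiv.symm.trans e.symm))
  | corner p _ h0 h1 h2 e ih =>
    obtain ⟨f, hf, -, hr⟩ := e
    exact nuc_of_good (good_corner ih h1 h2 f hf hr)

theorem main {n : ℕ} {A : Type} [CStarAlgebra A] (hA : IsUnitalLocalAlg (nucClass n) A) :
    NuclearDimensionLE n A := by
  apply nuc_of_good
  apply good_local
  intro S ε hε
  obtain ⟨B, hB, φ, hφ⟩ := hA S ε hε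
  exact ⟨B.carrier, inferInstance, good_of_nuc (nuc_of_finSat hB), φ, hφ⟩

end NucLocal

end NucLocalProof

open TopologicalSpace in
theorem stmt1 (n : ℕ) (A : Type) [CStarAlgebra A] [SeparableSpace A]
    (hA : IsUnitalLocalAlg (nucClass n) A) :
    NuclearDimensionLE n A := by
  exact NucLocal.main hA

end
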